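/- Let n ≥ 3 and let q > 1 satisfy 1/(q−1) < n−1. Let u be a positive bounded classical solution of the half-space problem ∂ₜu = Δu in ℝⁿ₊×ℝ, −∂u/∂x₁ = u^q on ∂ℝⁿ₊×ℝ, which is axially symmetric and such that |∇u| is bounded on closure(ℝⁿ₊)×ℝ. Then there exists C > 0 such that u(x,t) ≤ C|x|^{−1/(q−1)} for all x ∈ ℝⁿ₊ and t ∈ ℝ. -/

import Mathlib

open scoped BigOperators
open Set

/-- The Laplacian of `f : ℝⁿ → ℝ` at `x`, as the sum of the second partial
derivatives in the coordinate directions. -/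
noncomputable def lap {n : ℕ} (f : EuclideanSpace ℝ (Fin n) → ℝ)
    (x : EuclideanSpace ℝ (Fin n)) : ℝ :=
  ∑ i : Fin n,
    fderiv ℝ (fun y => fderiv ℝ f y (EuclideanSpace.single i 1)) x
      (EuclideanSpace.single i 1)

/-- The open half-space `ℝⁿ₊ = {x : x₁ > 0}`. -/
def openHalf (n : ℕ) (hn : 0 < n) : Set (EuclideanSpace ℝ (Fin n)) :=
  {x | 0 < x ⟨0, hn⟩}

/-- The closed half-space `{x : x₁ ≥ 0}` (the closure of `ℝⁿ₊`). -/
def closedHalf (n : ℕ) (hn : 0 < n) : Set (EuclideanSpace ℝ (Fin n)) :=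
  {x | 0 ≤ x ⟨0, hn⟩}

/-- `u` is a positive classical solution of the half-space problem
`∂ₜu = Δu` in `ℝⁿ₊ × ℝ`, `-∂u/∂x₁ = u^q` on `∂ℝⁿ₊ × ℝ`: it is continuous together
with its spatial gradient up to the boundary, `C²` in `x` and `C¹` in `t` in the
open half-space, satisfies the heat equation inside and the nonlinear boundary
condition on the boundary, and is everywhere positive. -/
def IsHalfSpaceSol (n : ℕ) (hn : 0 < n) (q : ℝ)
    (u : EuclideanSpace ℝ (Fin n) × ℝ → ℝ) : Prop :=
  ContinuousOn u (closedHalf n hn ×ˢ (univ : Set ℝ)) ∧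
  (∀ t, ContDiffOn ℝ 1 (fun x => u (x, t)) (closedHalf n hn)) ∧
  (∀ t, ContinuousOn
    (fun x => fderivWithin ℝ (fun y => u (y, t)) (closedHalf n hn) x)
    (closedHalf n hn)) ∧
  (∀ t, ContDiffOn ℝ 2 (fun x => u (x, t)) (openHalf n hn)) ∧
  (∀ x ∈ openHalf n hn, ContDiff ℝ 1 fun s => u (x, s)) ∧
  (∀ x ∈ openHalf n hn, ∀ t : ℝ,
    deriv (fun s => u (x, s)) t = lap (fun y => u (y, t)) x) ∧
  (∀ x : EuclideanSpace ℝ (Fin n), x ⟨0, hn⟩ = 0 → ∀ t : ℝ,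
    -(fderivWithin ℝ (fun y => u (y, t)) (closedHalf n hn) x
        (EuclideanSpace.single ⟨0, hn⟩ 1)) = u (x, t) ^ q) ∧
  (∀ x ∈ closedHalf n hn, ∀ t : ℝ, 0 < u (x, t))

/-- `u` is axially symmetric: `u(x₁, x̃, t)` depends on `x̃ = (x₂,…,xₙ)` only
through `|x̃|`. -/
def AxiallySymmetric (n : ℕ) (hn : 0 < n)
    (u : EuclideanSpace ℝ (Fin n) × ℝ → ℝ) : Prop :=
  ∀ x y : EuclideanSpace ℝ (Fin n), x ⟨0, hn⟩ = y ⟨0, hn⟩ →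
    (∑ i ∈ Finset.univ.erase ⟨0, hn⟩, (x i) ^ 2)
      = (∑ i ∈ Finset.univ.erase ⟨0, hn⟩, (y i) ^ 2) →
    ∀ t : ℝ, u (x, t) = u (y, t)


open Filter Topology

/-- `φ` is differentiable near `0`, with first and second derivatives `d` and `a` at `0`. -/
def J2 (φ : ℝ → ℝ) (d a : ℝ) : Prop :=
  ∃ g : ℝ → ℝ, (∀ᶠ k in 𝓝 0, HasDerivAt φ (g k) k) ∧ g 0 = d ∧ HasDerivAt g a 0

namespace J2

variable {φ ψ : ℝ → ℝ} {d a d' a' : ℝ}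

lemma hasDerivAt (h : J2 φ d a) : HasDerivAt φ d 0 := by
  obtain ⟨g, h1, h2, -⟩ := h
  exact h2 ▸ h1.self_of_nhds

lemma congr (h : J2 φ d a) (e : ∀ᶠ k in 𝓝 0, ψ k = φ k) : J2 ψ d a := by
  obtain ⟨g, h1, h2, h3⟩ := h
  refine ⟨g, ?_, h2, h3⟩
  filter_upwards [h1, e.eventually_nhds] with k hk hk'
  exact hk.congr_of_eventuallyEq hk'

lemma cast (h : J2 φ d a) (hd : d = d') (ha : a = a') : J2 φ d' a' := by
  subst hd ha; exact h

lemma add (h : J2 φ d a) (h' : J2 ψ d' a') : J2 (fun k => φ k + ψ k) (d + d') (a + a') := by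
  obtain ⟨g, h1, h2, h3⟩ := h
  obtain ⟨g', h1', h2', h3'⟩ := h'
  refine ⟨fun k => g k + g' k, ?_, by simp [h2, h2'], h3.add h3'⟩
  filter_upwards [h1, h1'] with k hk hk'
  exact hk.add hk'

lemma const_mul (c : ℝ) (h : J2 φ d a) : J2 (fun k => c * φ k) (c * d) (c * a) := by
  obtain ⟨g, h1, h2, h3⟩ := h
  refine ⟨fun k => c * g k, ?_, by simp [h2], h3.const_mul c⟩
  filter_upwards [h1] with k hk
  exact hk.const_mul c

lemma sub (h : J2 φ d a) (h' : J2 ψ d' a') : J2 (fun k => φ k - ψ k) (d - d') (a - a') := by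
  refine ((h.add (h'.const_mul (-1))).congr (Eventually.of_forall fun k => ?_)).cast ?_ ?_ <;> ring

lemma poly (c0 c1 c2 : ℝ) : J2 (fun k => c0 + c1 * k + c2 * k ^ 2) c1 (2 * c2) := by
  refine ⟨fun k => c1 + 2 * c2 * k, Eventually.of_forall fun k => ?_, by simp, ?_⟩
  · have := (((hasDerivAt_id k).const_mul c1).const_add c0).add
      (((hasDerivAt_id k).pow 2).const_mul c2)
    refine this.congr_deriv ?_
    simp; ring
  · simpa using (((hasDerivAt_id (0 : ℝ)).const_mul (2 * c2)).const_add c1)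

lemma comp_mul (h : J2 φ d a) (l : ℝ) : J2 (fun k => φ (l * k)) (l * d) (l ^ 2 * a) := by
  obtain ⟨g, h1, h2, h3⟩ := h
  have hl : Tendsto (fun k : ℝ => l * k) (𝓝 0) (𝓝 0) := by
    have : Continuous fun k : ℝ => l * k := by fun_prop
    simpa using this.tendsto 0
  have hd : ∀ k, HasDerivAt (fun k : ℝ => l * k) l k := fun k => by
    simpa using (hasDerivAt_id k).const_mul l
  refine ⟨fun k => l * g (l * k), ?_, by simp [h2], ?_⟩
  · filter_upwards [hl.eventually h1] with k hk
    refine (hk.comp k (hd k)).congr_deriv (mul_comm _ _)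
  · have h3' : HasDerivAt g a (l * 0) := by simpa using h3
    refine ((h3'.comp (0 : ℝ) (hd 0)).const_mul l).congr_deriv ?_
    ring

lemma comp_left (h : J2 φ d a) {F F' : ℝ → ℝ} {F'' : ℝ}
    (hF : ∀ᶠ s in 𝓝 (φ 0), HasDerivAt F (F' s) s) (hF' : HasDerivAt F' F'' (φ 0)) :
    J2 (fun k => F (φ k)) (F' (φ 0) * d) (F'' * d ^ 2 + F' (φ 0) * a) := by
  have e1 := h.hasDerivAt
  obtain ⟨g, h1, h2, h3⟩ := h
  refine ⟨fun k => F' (φ k) * g k, ?_, by simp [h2], ?_⟩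
  · filter_upwards [h1, e1.continuousAt.eventually hF] with k hk hk'
    exact hk'.comp k hk
  · refine ((hF'.comp (0 : ℝ) e1).mul h3).congr_deriv ?_
    rw [h2, Function.comp_apply]; ring

lemma unique (h : J2 φ d a) (h' : J2 φ d' a') : d = d' ∧ a = a' := by
  refine ⟨h.hasDerivAt.unique h'.hasDerivAt, ?_⟩
  obtain ⟨g, h1, -, h3⟩ := h
  obtain ⟨g', h1', -, h3'⟩ := h'
  refine h3.unique (h3'.congr_of_eventuallyEq ?_)
  filter_upwards [h1, h1'] with k hk hk'
  exact hk.unique hk'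

lemma nonpos_of_isLocalMax (h : J2 φ d a) (hm : IsLocalMax φ 0) : a ≤ 0 := by
  have hd : d = 0 := hm.hasDerivAt_eq_zero h.hasDerivAt
  obtain ⟨g, h1, h2, h3⟩ := h
  by_contra! ha
  have h4 : ∀ᶠ k in 𝓝[>] (0 : ℝ), 0 < g k := by
    have := (hasDerivAt_iff_tendsto_slope.1 h3).mono_left
      (nhdsWithin_mono 0 (fun x (hx : 0 < x) => hx.ne'))
    filter_upwards [this.eventually (lt_mem_nhds ha), self_mem_nhdsWithin] with k hk hk0
    rw [slope_def_field, h2, hd] at hk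
    have hk0' : (0 : ℝ) < k := hk0
    simp only [sub_zero] at hk
    exact (div_pos_iff_of_pos_right hk0').1 hk
  have h5 : ∀ᶠ k in 𝓝[>] (0 : ℝ), 0 < g k ∧ HasDerivAt φ (g k) k ∧ φ k ≤ φ 0 :=
    h4.and ((h1.filter_mono nhdsWithin_le_nhds).and (hm.filter_mono nhdsWithin_le_nhds))
  obtain ⟨b, hb, hb'⟩ := mem_nhdsGT_iff_exists_Ioo_subset.1 h5
  have hb : (0 : ℝ) < b := hb
  have hc : ContinuousOn φ (Icc 0 (b / 2)) := by
    intro x hx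
    rcases hx.1.eq_or_lt with h | h
    · exact h ▸ h1.self_of_nhds.continuousAt.continuousWithinAt
    · exact (hb' ⟨h, by linarith [hx.2]⟩).2.1.continuousAt.continuousWithinAt
  obtain ⟨c, hc1, hc2⟩ := exists_hasDerivAt_eq_slope φ g (by linarith : 0 < b / 2) hc
    (fun x hx => (hb' ⟨hx.1, by linarith [hx.2]⟩).2.1)
  have e1 := (hb' ⟨hc1.1, by linarith [hc1.2]⟩).1
  have e2 := (hb' (show b / 2 ∈ Ioo 0 b from ⟨by linarith, by linarith⟩)).2.2
  rw [hc2] at e1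
  rw [sub_zero, div_pos_iff_of_pos_right (by linarith)] at e1
  linarith

end J2

lemma HasDerivAt.nonneg_of_left_max {φ : ℝ → ℝ} {d t : ℝ} (h : HasDerivAt φ d t)
    (hm : ∀ᶠ s in 𝓝[<] t, φ s ≤ φ t) : 0 ≤ d := by
  have h1 : Tendsto (slope φ t) (𝓝[<] t) (𝓝 d) := (hasDerivAt_iff_tendsto_slope.1 h).mono_left
      (nhdsWithin_mono t (fun x (hx : x < t) => hx.ne))
  refine ge_of_tendsto h1 ?_
  filter_upwards [hm, self_mem_nhdsWithin] with s hs hs'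
  have hs' : s < t := hs'
  rw [slope_def_field]
  exact div_nonneg_of_nonpos (by linarith) (by linarith)

lemma HasDerivWithinAt.nonpos_of_right_max {φ : ℝ → ℝ} {d t : ℝ}
    (h : HasDerivWithinAt φ d (Ici t) t)
    (hm : ∀ᶠ s in 𝓝[>] t, φ s ≤ φ t) : d ≤ 0 := by
  have h1 := (hasDerivWithinAt_iff_tendsto_slope.1 h)
  rw [Ici_sdiff_left] at h1
  refine le_of_tendsto h1 ?_
  filter_upwards [hm, self_mem_nhdsWithin] with s hs hs'
  have hs' : t < s := hs'
  rw [slope_def_field]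
  exact div_nonpos_of_nonpos_of_nonneg (by linarith) (by linarith)

/-- Comparison by the maximum of the quotient on a compact set. -/
lemma le_mul_of_quotient_max {X : Type*} [TopologicalSpace X] {D : Set X} (hD : IsCompact D)
    {V B : X → ℝ} (hV : ContinuousOn V D) (hB : ContinuousOn B D) (hpos : ∀ x ∈ D, 0 < B x)
    {A : ℝ}
    (H : ∀ θ > A, ∀ P ∈ D, V P = θ * B P → (∀ x ∈ D, V x ≤ θ * B x) → False) :
    ∀ x ∈ D, V x ≤ A * B x := by
  intro x hx
  obtain ⟨P, hP, hm⟩ := hD.exists_isMaxOn ⟨x, hx⟩ (hV.div hB fun x hx => (hpos x hx).ne')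
  have hle : V P / B P ≤ A := by
    by_contra! hlt
    refine H _ hlt P hP ?_ fun y hy => ?_
    · field_simp [(hpos P hP).ne']
    · have := hm hy
      exact (div_le_iff₀ (hpos y hy)).1 this
  have := hm hx
  exact (div_le_iff₀ (hpos x hx)).1 (le_trans this hle)

/-- `n`-dimensional Euclidean space. -/
abbrev Eu (n : ℕ) := EuclideanSpace ℝ (Fin n)

/-- The standard basis vectors. -/
noncomputable def ee {n : ℕ} (i : Fin n) : Eu n := EuclideanSpace.single i 1

@[simp] lemma ee_apply {n : ℕ} (i j : Fin n) : (ee i : Eu n) j = if j = i then 1 else 0 := by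
  simp [ee]

/-- `f` has one-dimensional second order expansions at `(x, t)` along the coordinate axes and a
time derivative, and the value of the heat operator `∂ₜ - Δ` is `e`. -/
def HJ {n : ℕ} (f : Eu n × ℝ → ℝ) (x : Eu n) (t e : ℝ) : Prop :=
  ∃ (d a : Fin n → ℝ) (τ : ℝ), (∀ i, J2 (fun k => f (x + k • ee i, t)) (d i) (a i)) ∧
    HasDerivAt (fun s => f (x, s)) τ t ∧ τ - ∑ i, a i = e

namespace HJ

variable {n : ℕ} {f g : Eu n × ℝ → ℝ} {x : Eu n} {t e e' : ℝ}

lemma sub (h : HJ f x t e) (h' : HJ g x t e') : HJ (fun p => f p - g p) x t (e - e') := by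
  obtain ⟨d, a, τ, h1, h2, h3⟩ := h
  obtain ⟨d', a', τ', h1', h2', h3'⟩ := h'
  refine ⟨fun i => d i - d' i, fun i => a i - a' i, τ - τ', fun i => (h1 i).sub (h1' i),
    h2.sub h2', ?_⟩
  rw [Finset.sum_sub_distrib]; linarith

lemma const_mul (c : ℝ) (h : HJ f x t e) : HJ (fun p => c * f p) x t (c * e) := by
  obtain ⟨d, a, τ, h1, h2, h3⟩ := h
  refine ⟨fun i => c * d i, fun i => c * a i, c * τ, fun i => (h1 i).const_mul c,
    h2.const_mul c, ?_⟩
  rw [← Finset.mul_sum, ← h3]; ring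

lemma nonneg_of_max (h : HJ f x t e)
    (hx : ∀ i, ∀ᶠ k in 𝓝 (0 : ℝ), f (x + k • ee i, t) ≤ f (x, t))
    (ht : ∀ᶠ s in 𝓝[<] t, f (x, s) ≤ f (x, t)) : 0 ≤ e := by
  obtain ⟨d, a, τ, h1, h2, h3⟩ := h
  have : ∑ i, a i ≤ 0 := Finset.sum_nonpos fun i _ => (h1 i).nonpos_of_isLocalMax (by
    filter_upwards [hx i] with k hk
    simpa using hk)
  have := h2.nonneg_of_left_max ht
  linarith

lemma translate (c : Eu n) (h : HJ f (c + x) t e) : HJ (fun p => f (c + p.1, p.2)) x t e := by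
  obtain ⟨d, a, τ, h1, h2, h3⟩ := h
  exact ⟨d, a, τ, fun i => by simpa only [add_assoc] using h1 i, h2, h3⟩

lemma comp_concave (h : HJ f x t 0) {F F' : ℝ → ℝ} {F'' : ℝ}
    (hF : ∀ᶠ s in 𝓝 (f (x, t)), HasDerivAt F (F' s) s) (hF' : HasDerivAt F' F'' (f (x, t)))
    (hc : F'' ≤ 0) : ∃ e ≥ 0, HJ (fun p => F (f p)) x t e := by
  obtain ⟨d, a, τ, h1, h2, h3⟩ := h
  refine ⟨_, ?_, fun i => F' (f (x, t)) * d i, fun i => F'' * d i ^ 2 + F' (f (x, t)) * a i,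
    F' (f (x, t)) * τ, fun i => ?_, ?_, rfl⟩
  · rw [Finset.sum_add_distrib, ← Finset.mul_sum, ← Finset.mul_sum]
    have : F'' * ∑ i, d i ^ 2 ≤ 0 :=
      mul_nonpos_of_nonpos_of_nonneg hc (Finset.sum_nonneg fun i _ => sq_nonneg _)
    have h4 : τ = ∑ i, a i := by linarith
    rw [h4]; linarith
  · have := (h1 i).comp_left (F := F) (F' := F') (F'' := F'') (by simpa using hF)
      (by simpa using hF')
    simpa using this
  · exact hF.self_of_nhds.comp t h2

/-- A quadratic polynomial. -/
lemma quadratic (α κ : ℝ) (b c : Fin n → ℝ) (x : Eu n) (t : ℝ) :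
    HJ (fun p => α + ∑ j, (b j * p.1 j + c j * p.1 j ^ 2) + κ * p.2) x t (κ - ∑ j, 2 * c j) := by
  refine ⟨fun i => b i + 2 * c i * x i, fun i => 2 * c i, κ, fun i => ?_, ?_, rfl⟩
  · refine (J2.poly (α + ∑ j, (b j * x j + c j * x j ^ 2) + κ * t) (b i + 2 * c i * x i)
      (c i)).congr (Eventually.of_forall fun k => ?_)
    have : ∀ j, b j * (x + k • ee i) j + c j * (x + k • ee i) j ^ 2 =
        (b j * x j + c j * x j ^ 2) +
          if j = i then (b i + 2 * c i * x i) * k + c i * k ^ 2 else 0 := by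
      intro j
      by_cases hj : j = i
      · subst hj; simp; ring
      · simp [hj]
    simp only [this, Finset.sum_add_distrib, Finset.sum_ite_eq', Finset.mem_univ, if_true]
    ring
  · simpa using ((hasDerivAt_id t).const_mul κ).const_add (α + ∑ j, (b j * x j + c j * x j ^ 2))

end HJ

section maxprinciple
variable {n : ℕ}

/-- Parabolic comparison principle on a compact cylinder. -/
lemma parabolic_comparison {K : Set (Eu n)} (hK : IsCompact K) {t0 t1 A : ℝ} (hA : 0 ≤ A)
    {V B : Eu n × ℝ → ℝ} (hV : ContinuousOn V (K ×ˢ Icc t0 t1))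
    (hB : ContinuousOn B (K ×ˢ Icc t0 t1)) (hpos : ∀ x ∈ K, ∀ t ∈ Icc t0 t1, 0 < B (x, t))
    (H : ∀ x ∈ K, ∀ t ∈ Icc t0 t1, V (x, t) ≤ A * B (x, t) ∨
      (t0 < t ∧ (∀ i, ∀ᶠ k in 𝓝 (0 : ℝ), x + k • ee i ∈ K) ∧
        ∃ e e', HJ V x t e ∧ HJ B x t e' ∧ e ≤ 0 ∧ 0 < e') ∨
      (∃ (i : Fin n) (d d' : ℝ), (∀ᶠ k in 𝓝[>] (0 : ℝ), x + k • ee i ∈ K) ∧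
        HasDerivWithinAt (fun k : ℝ => V (x + k • ee i, t)) d (Ici 0) 0 ∧
        HasDerivWithinAt (fun k : ℝ => B (x + k • ee i, t)) d' (Ici 0) 0 ∧
        ∀ θ > A, V (x, t) = θ * B (x, t) → θ * d' < d)) :
    ∀ x ∈ K, ∀ t ∈ Icc t0 t1, V (x, t) ≤ A * B (x, t) := by
  intro x hx t ht
  refine le_mul_of_quotient_max (hK.prod isCompact_Icc) hV hB (fun p hp => hpos p.1 hp.1 p.2 hp.2)
    ?_ (x, t) ⟨hx, ht⟩
  rintro θ hθ ⟨y, s⟩ ⟨hy, hs⟩ he hmax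
  have hpB := hpos y hy s hs
  rcases H y hy s hs with h | ⟨h1, h2, e, e', h3, h4, h5, h6⟩ | ⟨i, d, d', h1, h2, h3, h4⟩
  · have : A * B (y, s) < θ * B (y, s) := mul_lt_mul_of_pos_right hθ hpB
    linarith
  · have hW := h3.sub (h4.const_mul θ)
    have := hW.nonneg_of_max (fun i => ?_) ?_
    · have : 0 < θ * e' := mul_pos (by linarith) h6
      linarith
    · filter_upwards [h2 i] with k hk
      have := hmax (y + k • ee i, s) ⟨hk, hs⟩
      linarith
    · have : ∀ᶠ r in 𝓝[<] s, r ∈ Ioo t0 s := Ioo_mem_nhdsLT h1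
      filter_upwards [this] with r hr
      have := hmax (y, r) ⟨hy, hr.1.le, hr.2.le.trans hs.2⟩
      linarith
  · have := (h2.sub (h3.const_mul θ)).nonpos_of_right_max ?_
    · have := h4 θ hθ he
      linarith
    · filter_upwards [h1] with k hk
      have := hmax (y + k • ee i, s) ⟨hk, hs⟩
      simp only [Pi.sub_apply, zero_smul, add_zero]; linarith

/-- Reflection in the `i`-th coordinate. -/
noncomputable def reflect (i : Fin n) (z : Eu n) : Eu n := z - (2 * z i) • ee i

lemma reflect_add_smul_self (i : Fin n) (z : Eu n) (k : ℝ) :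
    reflect i (z + k • ee i) = reflect i z + (-k) • ee i := by
  ext j; by_cases h : j = i <;> simp [reflect, h]; ring

lemma reflect_add_smul_ne {i j : Fin n} (hj : j ≠ i) (z : Eu n) (k : ℝ) :
    reflect i (z + k • ee j) = reflect i z + k • ee j := by
  ext l; simp [reflect, hj.symm]; ring

lemma reflect_apply (i j : Fin n) (z : Eu n) :
    reflect i z j = if j = i then - z i else z j := by
  by_cases h : j = i <;> simp [reflect, h]; ring

lemma norm_reflect (i : Fin n) (z : Eu n) : ‖reflect i z‖ = ‖z‖ := by
  rw [EuclideanSpace.norm_eq, EuclideanSpace.norm_eq]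
  congr 1
  refine Finset.sum_congr rfl fun j _ => ?_
  rw [reflect_apply]; by_cases h : j = i <;> simp [h]

@[fun_prop]
lemma continuous_reflect (i : Fin n) : Continuous (reflect i : Eu n → Eu n) := by
  unfold reflect; fun_prop

lemma reflect_of_zero {i : Fin n} {z : Eu n} (h : z i = 0) : reflect i z = z := by
  simp [reflect, h]

lemma HJ.reflect {f : Eu n × ℝ → ℝ} {x c : Eu n} {t e : ℝ} (i : Fin n)
    (h : HJ f (c + reflect i x) t e) :
    HJ (fun p => f (c + _root_.reflect i p.1, p.2)) x t e := by
  obtain ⟨d, a, τ, h1, h2, h3⟩ := h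
  refine ⟨fun j => if j = i then -d j else d j, a, τ, fun j => ?_, h2, h3⟩
  by_cases hj : j = i
  · subst hj
    have := (h1 j).comp_mul (-1)
    simpa [reflect_add_smul_self, add_assoc] using this
  · simpa [reflect_add_smul_ne hj, add_assoc, hj] using h1 j

lemma sum_sq_eq_norm (z : Eu n) : ∑ j, z j ^ 2 = ‖z‖ ^ 2 := by
  rw [EuclideanSpace.norm_sq_eq]; simp

lemma abs_apply_le_norm (z : Eu n) (i : Fin n) : |z i| ≤ ‖z‖ := by
  have := PiLp.norm_apply_le z i
  simpa using this

lemma norm_smul_ee (h : ℝ) (i : Fin n) : ‖h • (ee i : Eu n)‖ = |h| := by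
  rw [norm_smul]; simp [ee]

/-- The barrier `a (2 zᵢ/ℓ - zᵢ²/ℓ²) + |z|²/ℓ² + (t₁ - t)/ℓ² + ε` with `a = n + 1`. -/
noncomputable def barrier (i : Fin n) (l t1 ε : ℝ) (p : Eu n × ℝ) : ℝ :=
  (n + 1) * (2 * (p.1 i / l) - (p.1 i / l) ^ 2) + (‖p.1‖ / l) ^ 2 + (t1 - p.2) / l ^ 2 + ε

lemma barrier_HJ (i : Fin n) {l : ℝ} (hl : 0 < l) (t1 ε : ℝ) (x : Eu n) (t : ℝ) :
    HJ (barrier i l t1 ε) x t (1 / l ^ 2) := by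
  have := HJ.quadratic (t1 / l ^ 2 + ε) (-1 / l ^ 2)
    (fun j => if j = i then (n + 1) * (2 / l) else 0)
    (fun j => 1 / l ^ 2 - if j = i then (n + 1) / l ^ 2 else 0) x t
  have e2 : -1 / l ^ 2 - ∑ j : Fin n, 2 * (1 / l ^ 2 - if j = i then ((n : ℝ) + 1) / l ^ 2 else 0)
      = 1 / l ^ 2 := by
    simp only [mul_sub, Finset.sum_sub_distrib, mul_ite, mul_zero]
    simp; field_simp; ring
  rw [e2] at this
  convert this using 2 with p
  simp only [add_mul, sub_mul, ite_mul, zero_mul, Finset.sum_add_distrib, Finset.sum_sub_distrib,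
    Finset.sum_ite_eq', Finset.mem_univ, if_true, barrier, ← Finset.mul_sum, sum_sq_eq_norm]
  field_simp; ring

lemma barrier_continuous (i : Fin n) (l t1 ε : ℝ) : Continuous (barrier i l t1 ε) := by
  unfold barrier; fun_prop

lemma barrier_ge (i : Fin n) {l t1 ε t : ℝ} {z : Eu n} (hl : 0 < l) (hz : ‖z‖ ≤ l) (h0 : 0 ≤ z i) :
    (‖z‖ / l) ^ 2 + (t1 - t) / l ^ 2 + ε ≤ barrier i l t1 ε (z, t) := by
  have h1 : z i / l ≤ 1 := by
    rw [div_le_one hl]; exact ((le_abs_self _).trans (abs_apply_le_norm z i)).trans hz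
  have h2 : 0 ≤ z i / l := by positivity
  have : 0 ≤ ((n : ℝ) + 1) * (2 * (z i / l) - (z i / l) ^ 2) := by
    apply mul_nonneg (by positivity); nlinarith
  simp only [barrier]; linarith

lemma barrier_pos (i : Fin n) {l t1 ε t : ℝ} {z : Eu n} (hl : 0 < l) (hz : ‖z‖ ≤ l)
    (h0 : 0 ≤ z i) (hε : 0 < ε) (ht : t ≤ t1) : 0 < barrier i l t1 ε (z, t) := by
  have := barrier_ge i (t1 := t1) (ε := ε) (t := t) hl hz h0
  have h1 : 0 ≤ (t1 - t) / l ^ 2 := div_nonneg (by linarith) (by positivity)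
  have h2 : 0 ≤ (‖z‖ / l) ^ 2 := by positivity
  linarith

lemma eventually_norm_lt {l : ℝ} {z v : Eu n} (hz : ‖z‖ < l) :
    ∀ᶠ k in 𝓝 (0 : ℝ), ‖z + k • v‖ < l := by
  have : Continuous fun k : ℝ => ‖z + k • v‖ := by fun_prop
  exact this.continuousAt.eventually_lt continuousAt_const (by simpa using hz)

lemma eventually_apply_pos {z v : Eu n} {i : Fin n} (hz : 0 < z i) :
    ∀ᶠ k in 𝓝 (0 : ℝ), 0 < (z + k • v) i := by
  have : Continuous fun k : ℝ => (z + k • v) i := by fun_prop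
  exact continuousAt_const.eventually_lt this.continuousAt (by simpa using hz)

/-- Interior estimate for symmetric differences of bounded solutions. -/
lemma interior_symm_diff (i : Fin n) {v : Eu n × ℝ → ℝ} {c : Eu n} {l A : ℝ} (hl : 0 < l)
    (hA : 0 ≤ A)
    (hc : ContinuousOn v (Metric.closedBall c l ×ˢ univ))
    (hh : ∀ x ∈ Metric.ball c l, ∀ t, HJ v x t 0)
    (hb : ∀ x ∈ Metric.closedBall c l, ∀ t, |v (x, t)| ≤ A) {h : ℝ} (h0 : 0 ≤ h) (h1 : h ≤ l)
    (t : ℝ) :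
    v (c + h • ee i, t) - v (c - h • ee i, t) ≤ 2 * A * (2 * n + 3) * (h / l) := by
  set V : Eu n × ℝ → ℝ := fun p => v (c + p.1, p.2) - v (c + reflect i p.1, p.2) with hVdef
  set K : Set (Eu n) := {z | ‖z‖ ≤ l ∧ 0 ≤ z i} with hKdef
  have hK : IsCompact K := by
    have : K = Metric.closedBall 0 l ∩ {z : Eu n | 0 ≤ z i} := by
      ext z; simp [hKdef]
    rw [this]
    exact (isCompact_closedBall _ _).inter_right (isClosed_le continuous_const (by fun_prop))
  have hmem : ∀ z : Eu n, ‖z‖ ≤ l → c + z ∈ Metric.closedBall c l := fun z hz => by simpa using hz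
  have hmem' : ∀ z : Eu n, ‖z‖ < l → c + z ∈ Metric.ball c l := fun z hz => by simpa using hz
  have hVc : ContinuousOn V (K ×ˢ Icc (t - l ^ 2) t) := by
    refine ContinuousOn.sub (hc.comp (by fun_prop) ?_) (hc.comp (by fun_prop) ?_)
    · rintro ⟨z, s⟩ ⟨hz, -⟩; exact ⟨hmem z hz.1, trivial⟩
    · rintro ⟨z, s⟩ ⟨hz, -⟩; exact ⟨hmem _ (by rw [norm_reflect]; exact hz.1), trivial⟩
  have hVb : ∀ z : Eu n, ‖z‖ ≤ l → ∀ s, V (z, s) ≤ 2 * A := by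
    intro z hz s
    have h1 := abs_le.1 (hb _ (hmem z hz) s)
    have h2 := abs_le.1 (hb _ (hmem (reflect i z) (by rw [norm_reflect]; exact hz)) s)
    simp only [hVdef]; linarith
  have key : ∀ ε > 0, V (h • ee i, t) ≤ 2 * A * barrier i l t ε (h • ee i, t) := by
    intro ε hε
    refine parabolic_comparison hK (by positivity) hVc (barrier_continuous i l t ε).continuousOn
      (fun x hx s hs => barrier_pos i hl hx.1 hx.2 hε hs.2) ?_ (h • ee i)
      ⟨by rw [norm_smul_ee, abs_of_nonneg h0]; exact h1, by simpa using h0⟩ t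
      ⟨by nlinarith, le_rfl⟩
    intro z hz s hs
    have hge := barrier_ge i (t1 := t) (ε := ε) (t := s) hl hz.1 hz.2
    have hp1 : 0 ≤ (t - s) / l ^ 2 := div_nonneg (by linarith [hs.2]) (by positivity)
    have hp2 : 0 ≤ (‖z‖ / l) ^ 2 := by positivity
    have hone : 1 ≤ barrier i l t ε (z, s) → V (z, s) ≤ 2 * A * barrier i l t ε (z, s) := by
      intro h
      have := hVb z hz.1 s
      nlinarith
    rcases hz.1.eq_or_lt with hzl | hzl
    · left; apply hone; rw [hzl, div_self hl.ne'] at hge; linarith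
    rcases hz.2.eq_or_lt with hzi | hzi
    · left
      have hpos := barrier_pos i hl hz.1 hz.2 hε hs.2
      have : V (z, s) = 0 := by simp [hVdef, reflect_of_zero hzi.symm]
      rw [this]; positivity
    rcases hs.1.eq_or_lt with hst | hst
    · left; apply hone
      have : (t - s) / l ^ 2 = 1 := by rw [← hst]; field_simp; ring
      linarith
    right; left
    refine ⟨hst, fun j => ?_, 0, 1 / l ^ 2, ?_, barrier_HJ i hl t ε z s, le_rfl, by positivity⟩
    · filter_upwards [eventually_norm_lt (v := ee j) hzl, eventually_apply_pos (v := ee j) hzi]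
        with k h1 h2
      exact ⟨h1.le, h2.le⟩
    · have e1 := (hh _ (hmem' z hzl) s).translate
      have e2 := (hh _ (hmem' (reflect i z) (by rwa [norm_reflect])) s).reflect i
      simpa using e1.sub e2
  have hlim : V (h • ee i, t) ≤ 2 * A * barrier i l t 0 (h • ee i, t) := by
    have h2 : Tendsto (fun ε => 2 * A * barrier i l t ε (h • ee i, t)) (𝓝[>] 0)
        (𝓝 (2 * A * barrier i l t 0 (h • ee i, t))) := by
      have : Continuous fun ε => 2 * A * barrier i l t ε (h • ee i, t) := by
        unfold barrier; fun_prop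
      exact (this.tendsto 0).mono_left nhdsWithin_le_nhds
    exact ge_of_tendsto h2 (eventually_mem_nhdsWithin.mono fun ε hε => key ε hε)
  have hVe : V (h • ee i, t) = v (c + h • ee i, t) - v (c - h • ee i, t) := by
    have : reflect i (h • ee i : Eu n) = -(h • ee i) := by
      ext j; rw [reflect_apply]; by_cases hj : j = i <;> simp [hj]
    simp [hVdef, this, sub_eq_add_neg]
  rw [hVe] at hlim
  refine hlim.trans ?_
  rw [mul_assoc (2 * A)]
  refine mul_le_mul_of_nonneg_left ?_ (by positivity)
  have hr : h / l ≤ 1 := by rw [div_le_one hl]; exact h1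
  have hr0 : 0 ≤ h / l := by positivity
  simp only [barrier, norm_smul_ee, abs_of_nonneg h0, sub_self, zero_div, add_zero]
  simp only [PiLp.smul_apply, ee_apply, if_true, smul_eq_mul, mul_one]
  have hn : (0 : ℝ) ≤ n := by positivity
  nlinarith [mul_nonneg hn (sq_nonneg (h / l))]

end maxprinciple

/-- A solution in terms of one-dimensional expansions, bounded with Lipschitz bound `M`. -/
structure Sol (n : ℕ) (hn : 0 < n) (q M : ℝ) (u : Eu n × ℝ → ℝ) : Prop where
  cont : ContinuousOn u (closedHalf n hn ×ˢ univ)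
  pos : ∀ x ∈ closedHalf n hn, ∀ t, 0 < u (x, t)
  le : ∀ x ∈ closedHalf n hn, ∀ t, u (x, t) ≤ M
  lip : ∀ x ∈ closedHalf n hn, ∀ y ∈ closedHalf n hn, ∀ t, |u (x, t) - u (y, t)| ≤ M * ‖x - y‖
  heat : ∀ x ∈ openHalf n hn, ∀ t, HJ u x t 0
  bdry : ∀ x : Eu n, x ⟨0, hn⟩ = 0 → ∀ t,
    HasDerivWithinAt (fun k : ℝ => u (x + k • ee ⟨0, hn⟩, t)) (-(u (x, t) ^ q)) (Ici 0) 0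
  bdry_tendsto : ∀ x : Eu n, x ⟨0, hn⟩ = 0 → ∀ t,
    Tendsto (deriv fun k : ℝ => u (x + k • ee ⟨0, hn⟩, t)) (𝓝[>] 0) (𝓝 (-(u (x, t) ^ q)))
  sym : AxiallySymmetric n hn u

lemma rpow_sub_rpow_le {q a b P : ℝ} (hq : 1 < q) (hb : 0 < b) (hab : b ≤ a) (haP : a ≤ P) :
    a ^ q - b ^ q ≤ q * P ^ (q - 1) * (a - b) := by
  have ha : 0 < a := hb.trans_le hab
  have h1 : 1 + q * (b / a - 1) ≤ (b / a) ^ q := by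
    have := one_add_mul_self_le_rpow_one_add (s := b / a - 1) (p := q)
      (by have : 0 < b / a := by positivity
          linarith) hq.le
    simpa using this
  have h2 : a ^ q * (1 + q * (b / a - 1)) ≤ b ^ q := by
    calc a ^ q * (1 + q * (b / a - 1)) ≤ a ^ q * (b / a) ^ q := by gcongr
      _ = b ^ q := by rw [← Real.mul_rpow ha.le (by positivity)]; congr 1; field_simp
  have h3 : a ^ q = a ^ (q - 1) * a := by
    rw [← Real.rpow_add_one ha.ne']; congr 1; ring
  have h4 : a ^ q - b ^ q ≤ q * a ^ (q - 1) * (a - b) := by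
    have : a ^ q * (1 + q * (b / a - 1)) = a ^ q - q * a ^ (q - 1) * (a - b) := by
      rw [h3]; field_simp; ring
    linarith
  refine h4.trans ?_
  have : a ^ (q - 1) ≤ P ^ (q - 1) := Real.rpow_le_rpow ha.le haP (by linarith)
  have : 0 ≤ a - b := by linarith
  gcongr

lemma norm_add_smul_ee_sq {n : ℕ} (z : Eu n) (k : ℝ) (i : Fin n) :
    ‖z + k • ee i‖ ^ 2 = ‖z‖ ^ 2 + 2 * k * z i + k ^ 2 := by
  rw [← sum_sq_eq_norm, ← sum_sq_eq_norm]
  have : ∀ j, (z + k • ee i) j ^ 2 = z j ^ 2 + if j = i then 2 * k * z i + k ^ 2 else 0 := by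
    intro j
    by_cases hj : j = i
    · subst hj; simp; ring
    · simp [hj]
  simp only [this, Finset.sum_add_distrib, Finset.sum_ite_eq', Finset.mem_univ, if_true]
  ring

lemma HJ.congr {n : ℕ} {f g : Eu n × ℝ → ℝ} {x : Eu n} {t e : ℝ} (h : HJ f x t e)
    (hfg : ∀ p, g p = f p) : HJ g x t e := by
  rwa [funext hfg]

lemma HJ.coord_mul {n : ℕ} {f : Eu n × ℝ → ℝ} {x : Eu n} {t e : ℝ} (h : HJ f x t e) (i : Fin n)
    (hi : ∀ k : ℝ, f (x + k • ee i, t) = f (x, t)) :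
    HJ (fun p => p.1 i * f p) x t (x i * e) := by
  obtain ⟨d, a, τ, h1, h2, h3⟩ := h
  have hu := (h1 i).unique ((J2.poly (f (x, t)) 0 0).congr
    (Eventually.of_forall fun k => by simp [hi k]))
  refine ⟨fun j => if j = i then f (x, t) else x i * d j, fun j => x i * a j, x i * τ,
    fun j => ?_, h2.const_mul (x i), by rw [← Finset.mul_sum, ← h3]; ring⟩
  by_cases hj : j = i
  · subst hj
    refine ((J2.poly (x j * f (x, t)) (f (x, t)) 0).congr
      (Eventually.of_forall fun k => ?_)).cast (by simp) (by simp [hu.2])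
    simp [hi k]; ring
  · have := (h1 j).const_mul (x i)
    refine (this.congr (Eventually.of_forall fun k => ?_)).cast (by simp [hj]) rfl
    simp [Ne.symm hj]

/-- The part of `barrier` which does not depend on the coordinate `i`. -/
noncomputable def tangBarrier {n : ℕ} (i j : Fin n) (l t1 ε : ℝ) (p : Eu n × ℝ) : ℝ :=
  barrier j l t1 ε p - (p.1 i / l) ^ 2

lemma tangBarrier_indep {n : ℕ} {i j : Fin n} (hij : j ≠ i) (l t1 ε : ℝ) (x : Eu n) (t k : ℝ) :
    tangBarrier i j l t1 ε (x + k • ee i, t) = tangBarrier i j l t1 ε (x, t) := by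
  simp only [tangBarrier, barrier, div_pow, norm_add_smul_ee_sq]
  simp [hij]; ring

lemma tangBarrier_HJ {n : ℕ} (i j : Fin n) {l : ℝ} (hl : 0 < l) (t1 ε : ℝ) (x : Eu n) (t : ℝ) :
    HJ (tangBarrier i j l t1 ε) x t (3 / l ^ 2) := by
  have h := HJ.quadratic 0 0 (fun _ => 0) (fun k => if k = i then 1 / l ^ 2 else 0) x t
  have := (barrier_HJ j hl t1 ε x t).sub h
  convert this using 1
  · ext p
    simp [tangBarrier, div_eq_inv_mul]; ring
  · simp; ring

/-- The barrier used for the tangential estimate up to the boundary. -/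
noncomputable def robinBarrier {n : ℕ} (i j : Fin n) (l t1 ε : ℝ) (p : Eu n × ℝ) : ℝ :=
  (2 - p.1 i / l) * tangBarrier i j l t1 ε p + (p.1 i / l) ^ 2

lemma robinBarrier_HJ {n : ℕ} {i j : Fin n} (hij : j ≠ i) {l : ℝ} (hl : 0 < l) (t1 ε : ℝ)
    (x : Eu n) (t : ℝ) (hx : x i ≤ l) :
    ∃ e > 0, HJ (robinBarrier i j l t1 ε) x t e := by
  have h := HJ.quadratic 0 0 (fun _ => 0) (fun k => if k = i then - (1 / l ^ 2) else 0) x t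
  have h1 := tangBarrier_HJ i j hl t1 ε x t
  have h2 := ((h1.const_mul 2).sub ((h1.coord_mul i (tangBarrier_indep hij l t1 ε x t)).const_mul
    (1 / l))).sub h
  have h4 := h2.congr (g := robinBarrier i j l t1 ε) fun p => by
    simp [robinBarrier, div_eq_inv_mul]; ring
  refine ⟨_, ?_, h4⟩
  · have h3 : x i / l ≤ 1 := by rwa [div_le_one hl]
    have : 2 * (3 / l ^ 2) - 1 / l * (x i * (3 / l ^ 2)) -
        (0 - ∑ k : Fin n, 2 * (if k = i then - (1 / l ^ 2) else 0)) =
        ((2 - x i / l) * 3 - 2) / l ^ 2 := by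
      simp; field_simp
    rw [this]
    apply div_pos _ (by positivity); linarith

section
variable {n : ℕ} {hn : 0 < n} {q M : ℝ} {u : Eu n × ℝ → ℝ}

lemma isOpen_openHalf : IsOpen (openHalf n hn) :=
  isOpen_lt continuous_const (by fun_prop)

lemma eventually_Ioi_norm_le {l : ℝ} {z v : Eu n} (hz : ‖z‖ < l) :
    ∀ᶠ k in 𝓝[>] (0 : ℝ), ‖z + k • v‖ ≤ l :=
  ((eventually_norm_lt (v := v) hz).filter_mono nhdsWithin_le_nhds).mono fun _ h => h.le

/-- Tangential estimate at the boundary. -/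
lemma Sol.tangential (hu : Sol n hn q M u) (hq : 1 < q) {j : Fin n} (hj : j ≠ ⟨0, hn⟩) {c : Eu n}
    (hc : c ⟨0, hn⟩ = 0) {l P : ℝ} (hl : 0 < l) (hP : 0 < P)
    (hb : ∀ x ∈ closedHalf n hn, ‖x - c‖ ≤ l → ∀ t, u (x, t) ≤ P)
    (hPl : 2 * (q * P ^ (q - 1)) * l < 1) {h : ℝ} (h0 : 0 ≤ h) (h1 : h ≤ l) (t : ℝ) :
    u (c + h • ee j, t) - u (c - h • ee j, t) ≤ P * (4 * n + 6) * (h / l) := by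
  set i : Fin n := ⟨0, hn⟩ with hi
  set V : Eu n × ℝ → ℝ := fun p => u (c + p.1, p.2) - u (c + reflect j p.1, p.2) with hVdef
  set K : Set (Eu n) := {z | ‖z‖ ≤ l ∧ 0 ≤ z j ∧ 0 ≤ z i} with hKdef
  have hK : IsCompact K := by
    have : K = Metric.closedBall 0 l ∩ ({z : Eu n | 0 ≤ z j} ∩ {z : Eu n | 0 ≤ z i}) := by
      ext z; simp [hKdef]
    rw [this]
    exact (isCompact_closedBall _ _).inter_right
      ((isClosed_le continuous_const (by fun_prop)).inter
        (isClosed_le continuous_const (by fun_prop)))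
  have hmem : ∀ z : Eu n, 0 ≤ z i → c + z ∈ closedHalf n hn := fun z hz => by
    simp only [closedHalf, mem_ofPred_eq, PiLp.add_apply]; rw [hc]; linarith
  have hmemo : ∀ z : Eu n, 0 < z i → c + z ∈ openHalf n hn := fun z hz => by
    simp only [openHalf, mem_ofPred_eq, PiLp.add_apply]; rw [hc]; linarith
  have hri : ∀ z : Eu n, reflect j z i = z i := fun z => by
    rw [reflect_apply, if_neg hj.symm]
  have hVc : ContinuousOn V (K ×ˢ Icc (t - l ^ 2) t) := by
    refine ContinuousOn.sub (hu.cont.comp (by fun_prop) ?_) (hu.cont.comp (by fun_prop) ?_)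
    · rintro ⟨z, s⟩ ⟨hz, -⟩; exact ⟨hmem z hz.2.2, trivial⟩
    · rintro ⟨z, s⟩ ⟨hz, -⟩; exact ⟨hmem _ (by rw [hri]; exact hz.2.2), trivial⟩
  have hVb : ∀ z : Eu n, z ∈ K → ∀ s, V (z, s) ≤ P := by
    intro z hz s
    have h1 := hb _ (hmem z hz.2.2) (by simpa using hz.1) s
    have h2 := hu.pos _ (hmem (reflect j z) (by rw [hri]; exact hz.2.2)) s
    simp only [hVdef]; linarith
  have hBpos : ∀ ε > 0, ∀ z ∈ K, ∀ s ≤ t, 0 < tangBarrier i j l t ε (z, s) ∧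
      (‖z‖ / l) ^ 2 + (t - s) / l ^ 2 ≤ robinBarrier i j l t ε (z, s) ∧
      0 < robinBarrier i j l t ε (z, s) := by
    intro ε hε z hz s hs
    have e0 : 0 ≤ z j / l := div_nonneg hz.2.1 hl.le
    have e1 : 0 ≤ z i / l := div_nonneg hz.2.2 hl.le
    have e2 : z j / l ≤ 1 := by
      rw [div_le_one hl]; exact ((le_abs_self _).trans (abs_apply_le_norm z j)).trans hz.1
    have e3 : z i / l ≤ 1 := by
      rw [div_le_one hl]; exact ((le_abs_self _).trans (abs_apply_le_norm z i)).trans hz.1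
    have e4 : (z i / l) ^ 2 ≤ (‖z‖ / l) ^ 2 := by
      have := (le_abs_self _).trans (abs_apply_le_norm z i)
      gcongr
    have e5 : 0 ≤ (t - s) / l ^ 2 := div_nonneg (by linarith) (by positivity)
    have e6 := barrier_ge j (t1 := t) (ε := ε) (t := s) hl hz.1 hz.2.1
    have e7 : 0 < tangBarrier i j l t ε (z, s) := by simp only [tangBarrier]; linarith
    refine ⟨e7, ?_, ?_⟩
    · have : tangBarrier i j l t ε (z, s) = barrier j l t ε (z, s) - (z i / l) ^ 2 := rfl
      simp only [robinBarrier]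
      nlinarith
    · simp only [robinBarrier]
      have := sq_nonneg (z i / l)
      nlinarith
  have key : ∀ ε > 0, V (h • ee j, t) ≤ P * robinBarrier i j l t ε (h • ee j, t) := by
    intro ε hε
    refine parabolic_comparison hK hP.le hVc ?_
      (fun x hx s hs => (hBpos ε hε x hx s hs.2).2.2) ?_ (h • ee j)
      ⟨by rw [norm_smul_ee, abs_of_nonneg h0]; exact h1, by simpa using h0, by simp [hj.symm]⟩ t
      ⟨by nlinarith, le_rfl⟩
    · have := barrier_continuous j l t ε
      apply Continuous.continuousOn
      unfold robinBarrier tangBarrier; fun_prop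
    intro z hz s hs
    obtain ⟨hpt, hge, hpos⟩ := hBpos ε hε z hz s hs.2
    have hp1 : 0 ≤ (t - s) / l ^ 2 := div_nonneg (by linarith [hs.2]) (by positivity)
    have hp2 : 0 ≤ (‖z‖ / l) ^ 2 := by positivity
    have hone : 1 ≤ robinBarrier i j l t ε (z, s) →
        V (z, s) ≤ P * robinBarrier i j l t ε (z, s) := by
      intro h
      have := hVb z hz s
      nlinarith
    rcases hz.1.eq_or_lt with hzl | hzl
    · left; apply hone; rw [hzl, div_self hl.ne'] at hge; linarith
    rcases hz.2.1.eq_or_lt with hzj | hzj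
    · left
      have : V (z, s) = 0 := by simp [hVdef, reflect_of_zero hzj.symm]
      rw [this]; positivity
    rcases hs.1.eq_or_lt with hst | hst
    · left; apply hone
      have : (t - s) / l ^ 2 = 1 := by rw [← hst]; field_simp; ring
      linarith
    right
    rcases hz.2.2.eq_or_lt with hzi | hzi
    · right
      have hcz : ∀ y : Eu n, 0 = y i → (c + y) ⟨0, hn⟩ = 0 := fun y hy => by
        simp only [PiLp.add_apply]; rw [hc]; linarith
      have hd1 := hu.bdry (c + z) (hcz z hzi) s
      have hd2 := hu.bdry (c + reflect j z) (hcz _ (by rw [hri]; exact hzi)) s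
      have hd3 : HasDerivWithinAt (fun k : ℝ => robinBarrier i j l t ε (z + k • ee i, s))
          (-(1 / l) * tangBarrier i j l t ε (z, s)) (Ici 0) 0 := by
        refine ((J2.poly (2 * tangBarrier i j l t ε (z, s))
          (-(1 / l) * tangBarrier i j l t ε (z, s)) ((1 / l) ^ 2)).congr
            (Eventually.of_forall fun k => ?_)).hasDerivAt.hasDerivWithinAt
        simp only [robinBarrier, tangBarrier_indep hj]
        simp [← hzi]; ring
      refine ⟨i, _, _, ?_, (hd1.sub hd2).congr_of_mem (fun k _ => ?_) self_mem_Ici, hd3, ?_⟩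
      · filter_upwards [eventually_Ioi_norm_le (v := ee i) hzl, self_mem_nhdsWithin] with k e1 e2
        have e2 : 0 < k := e2
        exact ⟨e1, by simpa [hj] using hzj.le, by simp [← hzi, e2.le]⟩
      · have e := reflect_add_smul_ne hj.symm z k
        simp only [hVdef, Pi.sub_apply, add_assoc]
        rw [e]
      · intro θ hθ hVθ
        have hB : robinBarrier i j l t ε (z, s) = 2 * tangBarrier i j l t ε (z, s) := by
          simp [robinBarrier, ← hzi]
        rw [hB] at hVθ
        have hVpos : 0 < V (z, s) := by rw [hVθ]; have := hP.trans hθ; positivity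
        have e1 := rpow_sub_rpow_le hq (hu.pos (c + reflect j z) (hmem _ (by rw [hri, ← hzi])) s)
          (by simp only [hVdef] at hVpos; linarith) (hb (c + z) (hmem z hzi.le) (by simpa using hz.1) s)
        change _ ≤ q * P ^ (q - 1) * V (z, s) at e1
        rw [hVθ] at e1
        have e3 : 2 * (q * P ^ (q - 1)) < 1 / l := by rwa [lt_div_iff₀ hl]
        have e4 : 0 < θ * tangBarrier i j l t ε (z, s) := by have := hP.trans hθ; positivity
        nlinarith
    · left
      obtain ⟨e', he', hB⟩ := robinBarrier_HJ hj hl t ε z s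
        (((le_abs_self _).trans (abs_apply_le_norm z i)).trans hz.1)
      refine ⟨hst, fun m => ?_, 0, e', ?_, hB, le_rfl, he'⟩
      · filter_upwards [eventually_norm_lt (v := ee m) hzl, eventually_apply_pos (v := ee m) hzi,
          eventually_apply_pos (v := ee m) hzj] with k h1 h2 h3
        exact ⟨h1.le, h3.le, h2.le⟩
      · have e1 := (hu.heat _ (hmemo z hzi) s).translate
        have e2 := (hu.heat _ (hmemo (reflect j z) (by rwa [hri])) s).reflect j
        simpa using e1.sub e2
  have hlim : V (h • ee j, t) ≤ P * robinBarrier i j l t 0 (h • ee j, t) := by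
    have h2 : Tendsto (fun ε => P * robinBarrier i j l t ε (h • ee j, t)) (𝓝[>] 0)
        (𝓝 (P * robinBarrier i j l t 0 (h • ee j, t))) := by
      have : Continuous fun ε => P * robinBarrier i j l t ε (h • ee j, t) := by
        unfold robinBarrier tangBarrier barrier; fun_prop
      exact (this.tendsto 0).mono_left nhdsWithin_le_nhds
    exact ge_of_tendsto h2 (eventually_mem_nhdsWithin.mono fun ε hε => key ε hε)
  have hVe : V (h • ee j, t) = u (c + h • ee j, t) - u (c - h • ee j, t) := by
    have : reflect j (h • ee j : Eu n) = -(h • ee j) := by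
      ext m; rw [reflect_apply]; by_cases hm : m = j <;> simp [hm]
    simp [hVdef, this, sub_eq_add_neg]
  rw [hVe] at hlim
  refine hlim.trans ?_
  rw [mul_assoc P]
  refine mul_le_mul_of_nonneg_left ?_ hP.le
  have hr : h / l ≤ 1 := by rw [div_le_one hl]; exact h1
  have hr0 : 0 ≤ h / l := by positivity
  simp only [robinBarrier, tangBarrier, barrier, norm_smul_ee, abs_of_nonneg h0, sub_self, zero_div,
    add_zero]
  simp [hj.symm]
  have hn' : (0 : ℝ) ≤ n := by positivity
  nlinarith [mul_nonneg hn' (sq_nonneg (h / l))]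

end

section
variable {n : ℕ} {hn : 0 < n} {q M : ℝ} {u : Eu n × ℝ → ℝ}

/-- Growth estimate in time at a boundary point. -/
lemma Sol.time_growth (hu : Sol n hn q M u) (hq : 1 < q) {c : Eu n} (hc : c ⟨0, hn⟩ = 0)
    {l P L N m t1 r : ℝ} (hl : 0 < l) (hL : 0 ≤ L) (hN : 0 < N) (hr : 0 < r) (hm : 0 ≤ m)
    (hb : ∀ x ∈ closedHalf n hn, ‖x - c‖ ≤ l → ∀ t ∈ Icc t1 (t1 + r ^ 2), u (x, t) ≤ P)
    (hNP : P ^ q ≤ N) (h1 : ∀ x ∈ closedHalf n hn, ‖x - c‖ ≤ l → u (x, t1) ≤ m + L * ‖x - c‖)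
    (hdom : P * r ≤ (L + N) * l ^ 2) :
    u (c, t1 + r ^ 2) ≤ m + (2 * n + 5) * (L + N) * r := by
  set i : Fin n := ⟨0, hn⟩ with hi
  set G := L + N with hG
  have hGpos : 0 < G := by positivity
  set K : Set (Eu n) := {z | ‖z‖ ≤ l ∧ 0 ≤ z i} with hKdef
  have hK : IsCompact K := by
    have : K = Metric.closedBall 0 l ∩ {z : Eu n | 0 ≤ z i} := by
      ext z; simp [hKdef]
    rw [this]
    exact (isCompact_closedBall _ _).inter_right (isClosed_le continuous_const (by fun_prop))
  set V : Eu n × ℝ → ℝ := fun p => u (c + p.1, p.2) with hVdef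
  set B : Eu n × ℝ → ℝ := fun p => m + G * (‖p.1‖ ^ 2 / r + (2 * n + 3) * (p.2 - t1) / r + r)
    + N * r * (1 - p.1 i / r) ^ 2 with hBdef
  have hmem : ∀ z : Eu n, 0 ≤ z i → c + z ∈ closedHalf n hn := fun z hz => by
    simp only [closedHalf, mem_ofPred_eq, PiLp.add_apply]; rw [hc]; linarith
  have hmemo : ∀ z : Eu n, 0 < z i → c + z ∈ openHalf n hn := fun z hz => by
    simp only [openHalf, mem_ofPred_eq, PiLp.add_apply]; rw [hc]; linarith
  have hVc : ContinuousOn V (K ×ˢ Icc t1 (t1 + r ^ 2)) := by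
    refine hu.cont.comp (by fun_prop) ?_
    rintro ⟨z, s⟩ ⟨hz, -⟩; exact ⟨hmem z hz.2, trivial⟩
  have hBc : Continuous B := by simp only [hBdef]; fun_prop
  have hsq : ∀ z : Eu n, 0 ≤ N * r * (1 - z i / r) ^ 2 := fun z => by positivity
  have hBge : ∀ z ∈ K, ∀ s ≥ t1, m + G * (‖z‖ ^ 2 / r + r) ≤ B (z, s) := by
    intro z hz s hs
    have h2 : 0 ≤ (2 * (n : ℝ) + 3) * (s - t1) / r := by
      have : 0 ≤ s - t1 := by linarith
      positivity
    have h3 := mul_nonneg hGpos.le h2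
    have h4 := hsq z
    simp only [hBdef]; linarith
  have hBpos : ∀ z ∈ K, ∀ s ≥ t1, 0 < B (z, s) := by
    intro z hz s hs
    have := hBge z hz s hs
    have : 0 < G * (‖z‖ ^ 2 / r + r) := by positivity
    linarith
  have key := parabolic_comparison hK zero_le_one hVc hBc.continuousOn
    (fun z hz s hs => hBpos z hz s hs.1) ?_ 0 ⟨by simpa using hl.le, by simp⟩ (t1 + r ^ 2)
    ⟨by nlinarith, le_rfl⟩
  · have e : B (0, t1 + r ^ 2) = m + G * ((2 * n + 3) * r + r) + N * r := by
      have : (r : ℝ) ^ 2 / r = r := by field_simp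
      simp [hBdef, mul_div_assoc, this]
    simp only [hVdef, e, add_zero, one_mul] at key
    have : N * r ≤ G * r := by rw [hG]; nlinarith
    linarith
  intro z hz s hs
  have hge := hBge z hz s hs.1
  rcases hz.1.eq_or_lt with hzl | hzl
  · left
    have e1 := hb (c + z) (hmem z hz.2) (by simpa using hz.1) s hs
    have e2 : P ≤ G * (‖z‖ ^ 2 / r + r) := by
      have : P ≤ G * (l ^ 2 / r) := by rwa [← mul_div_assoc, le_div_iff₀ hr]
      rw [hzl]; nlinarith
    simp only [hVdef]; linarith
  rcases hs.1.eq_or_lt with hst | hst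
  · left
    have e1 := h1 (c + z) (hmem z hz.2) (by simpa using hz.1)
    rw [add_sub_cancel_left] at e1
    have e2 : ‖z‖ ≤ ‖z‖ ^ 2 / r + r := by
      rw [div_add' _ _ _ hr.ne', le_div_iff₀ hr]; nlinarith [sq_nonneg (‖z‖ - r), norm_nonneg z]
    have e3 : L * ‖z‖ ≤ G * (‖z‖ ^ 2 / r + r) :=
      mul_le_mul (by rw [hG]; linarith) e2 (norm_nonneg z) hGpos.le
    simp only [hVdef]; rw [← hst] at hge ⊢; linarith
  right
  rcases hz.2.eq_or_lt with hzi | hzi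
  · right
    have hcz : (c + z) ⟨0, hn⟩ = 0 := by
      change c i + z i = 0
      rw [hc, ← hzi, add_zero]
    have hd1 := hu.bdry (c + z) hcz s
    have hd3 : HasDerivWithinAt (fun k : ℝ => B (z + k • ee i, s)) (-2 * N) (Ici 0) 0 := by
      refine (((J2.poly (B (z, s)) (-2 * N) (G / r + N / r)).congr
          (Eventually.of_forall fun k => ?_)).hasDerivAt.hasDerivWithinAt)
      simp only [hBdef, norm_add_smul_ee_sq]
      simp [← hzi]; field_simp; ring
    refine ⟨i, _, _, ?_, hd1.congr_of_mem (fun k _ => ?_) self_mem_Ici, hd3, ?_⟩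
    · filter_upwards [eventually_Ioi_norm_le (v := ee i) hzl, self_mem_nhdsWithin] with k e1 e2
      have e2 : 0 < k := e2
      exact ⟨e1, by simp [← hzi, e2.le]⟩
    · simp only [hVdef, add_assoc]; rfl
    · intro θ hθ _
      have e1 := hb (c + z) (hmem z hz.2) (by simpa using hz.1) s hs
      have e2 : u (c + z, s) ^ q ≤ N := (Real.rpow_le_rpow (hu.pos _ (hmem z hz.2) s).le e1
        (by linarith)).trans hNP
      nlinarith
  · left
    have hB := HJ.quadratic (m + G * (-(2 * n + 3) * t1 / r + r) + N * r) (G * (2 * n + 3) / r)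
      (fun j => if j = i then -2 * N else 0)
      (fun j => G / r + if j = i then N / r else 0) z s
    refine ⟨hst, fun j => ?_, 0, G * (2 * n + 3) / r - 2 * (n * (G / r) + N / r), ?_, ?_, le_rfl, ?_⟩
    · filter_upwards [eventually_norm_lt (v := ee j) hzl, eventually_apply_pos (v := ee j) hzi]
        with k h1 h2
      exact ⟨h1.le, h2.le⟩
    · exact (hu.heat _ (hmemo z hzi) s).translate
    · convert hB.congr (g := B) fun p => ?_ using 1
      · rw [← Finset.mul_sum]; simp [Finset.sum_add_distrib]
      · simp only [add_mul, ite_mul, zero_mul, Finset.sum_add_distrib,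
          Finset.sum_ite_eq', Finset.mem_univ, if_true, ← Finset.mul_sum, sum_sq_eq_norm, hBdef]
        field_simp; ring
    · have : G * (2 * n + 3) / r - 2 * (n * (G / r) + N / r) = (3 * L + N) / r := by
        rw [hG]; field_simp; ring
      rw [this]; positivity


/-- The flow of `F' = -F^q` at time `h` started at `s`. -/
noncomputable def flow (q h s : ℝ) : ℝ := (s ^ (1 - q) + (q - 1) * h) ^ (-(1 / (q - 1)))

lemma flow_base_pos (hq : 1 < q) {h s : ℝ} (hh : 0 ≤ h) (hs : 0 < s) :
    0 < s ^ (1 - q) + (q - 1) * h := by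
  have : 0 ≤ (q - 1) * h := mul_nonneg (by linarith) hh
  have := Real.rpow_pos_of_pos hs (1 - q)
  linarith

lemma flow_zero (hq : 1 < q) {s : ℝ} (hs : 0 < s) : flow q 0 s = s := by
  have : (1 - q) * (-(1 / (q - 1))) = 1 := by
    have : q - 1 ≠ 0 := by linarith
    field_simp; ring
  rw [flow, mul_zero, add_zero, ← Real.rpow_mul hs.le, this, Real.rpow_one]

lemma flow_pos (hq : 1 < q) {h s : ℝ} (hh : 0 ≤ h) (hs : 0 < s) : 0 < flow q h s :=
  Real.rpow_pos_of_pos (flow_base_pos hq hh hs) _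

lemma flow_le (hq : 1 < q) {h s : ℝ} (hh : 0 ≤ h) (hs : 0 < s) : flow q h s ≤ s := by
  conv_rhs => rw [← flow_zero hq hs]
  have h1 := flow_base_pos hq le_rfl hs
  have : 0 ≤ (q - 1) * h := mul_nonneg (by linarith) hh
  have h2 : 0 < 1 / (q - 1) := by apply one_div_pos.2; linarith
  exact Real.rpow_le_rpow_of_nonpos h1 (by linarith) (by linarith)

lemma flow_le_rpow (hq : 1 < q) {h s : ℝ} (hh : 0 < h) (hs : 0 < s) :
    flow q h s ≤ ((q - 1) * h) ^ (-(1 / (q - 1))) := by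
  have : 0 < (q - 1) * h := mul_pos (by linarith) hh
  have h1 := Real.rpow_pos_of_pos hs (1 - q)
  have h2 : 0 < 1 / (q - 1) := by apply one_div_pos.2; linarith
  exact Real.rpow_le_rpow_of_nonpos this (by linarith) (by linarith)

lemma flow_hasDerivAt (hq : 1 < q) {h s : ℝ} (hh : 0 ≤ h) (hs : 0 < s) :
    HasDerivAt (flow q h)
      ((s ^ (1 - q) + (q - 1) * h) ^ (-(1 / (q - 1)) - 1) * s ^ (-q)) s := by
  have h1 := (Real.hasDerivAt_rpow_const (p := 1 - q) (Or.inl hs.ne')).add_const ((q - 1) * h)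
  have h2 := h1.rpow_const (p := -(1 / (q - 1))) (Or.inl (flow_base_pos hq hh hs).ne')
  refine h2.congr_deriv ?_
  have : q - 1 ≠ 0 := by linarith
  rw [show (1 : ℝ) - q - 1 = -q by ring]
  field_simp; ring

lemma flow_second_deriv (hq : 1 < q) {h s : ℝ} (hh : 0 ≤ h) (hs : 0 < s) :
    ∃ F2 ≤ 0, HasDerivAt
      (fun s => (s ^ (1 - q) + (q - 1) * h) ^ (-(1 / (q - 1)) - 1) * s ^ (-q)) F2 s := by
  have hy := flow_base_pos hq hh hs
  have h1 := (Real.hasDerivAt_rpow_const (p := 1 - q) (Or.inl hs.ne')).add_const ((q - 1) * h)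
  have h2 := h1.rpow_const (p := -(1 / (q - 1)) - 1) (Or.inl hy.ne')
  have h3 := h2.mul (Real.hasDerivAt_rpow_const (p := -q) (Or.inl hs.ne'))
  refine ⟨_, ?_, h3⟩
  have hq1 : q - 1 ≠ 0 := by linarith
  set y := s ^ (1 - q) + (q - 1) * h with hydef
  have e1 : y ^ (-(1 / (q - 1)) - 1) = y ^ (-(1 / (q - 1)) - 1 - 1) * y := by
    rw [← Real.rpow_add_one hy.ne']; congr 1; ring
  have e2 : s ^ (-q) = s ^ (1 - q - 1) := by congr 1; ring
  have e3 : s ^ (-q - 1) * s ^ (1 - q) = s ^ (-q) * s ^ (-q) := by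
    rw [← Real.rpow_add hs, ← Real.rpow_add hs]; congr 1; ring
  have e4 : s ^ (1 - q) ≤ y := by
    have : 0 ≤ (q - 1) * h := mul_nonneg (by linarith) hh
    rw [hydef]; linarith
  have e5 : (1 - q) * (-(1 / (q - 1)) - 1) = q := by field_simp; ring
  rw [e1, ← e2]
  have e6 : (1 - q) * s ^ (-q) * (-(1 / (q - 1)) - 1) * y ^ (-(1 / (q - 1)) - 1 - 1) * s ^ (-q) +
      y ^ (-(1 / (q - 1)) - 1 - 1) * y * (-q * s ^ (-q - 1)) =
      q * y ^ (-(1 / (q - 1)) - 1 - 1) * (s ^ (-q) * s ^ (-q) - s ^ (-q - 1) * y) := by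
    calc _ = ((1 - q) * (-(1 / (q - 1)) - 1)) * s ^ (-q) * y ^ (-(1 / (q - 1)) - 1 - 1) * s ^ (-q) -
        q * y ^ (-(1 / (q - 1)) - 1 - 1) * y * (s ^ (-q - 1)) := by ring
      _ = _ := by rw [e5]; ring
  rw [e6, ← e3]
  have p1 := Real.rpow_pos_of_pos hy (-(1 / (q - 1)) - 1 - 1)
  have p2 := Real.rpow_pos_of_pos hs (-q - 1)
  apply mul_nonpos_of_nonneg_of_nonpos (by positivity)
  nlinarith

lemma continuousOn_flow (hq : 1 < q) :
    ContinuousOn (fun p : ℝ × ℝ => flow q p.1 p.2) (Ici 0 ×ˢ Ioi 0) := by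
  unfold flow
  refine ContinuousOn.rpow_const (ContinuousOn.add ?_ (by fun_prop)) fun p hp =>
    Or.inl (flow_base_pos hq hp.1 hp.2).ne'
  exact ContinuousOn.rpow_const (by fun_prop) fun p hp => Or.inl (ne_of_gt hp.2)

lemma Sol.M_pos (hu : Sol n hn q M u) : 0 < M := by
  have h0 : (0 : Eu n) ∈ closedHalf n hn := by simp [closedHalf]
  exact (hu.pos 0 h0 0).trans_le (hu.le 0 h0 0)

lemma Sol.le_flow_aux (hu : Sol n hn q M u) (hq : 1 < q) {x' : Eu n} (hx' : x' ∈ closedHalf n hn)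
    {h' : ℝ} (hh' : 0 ≤ h') (t' : ℝ) {Z : ℝ} (hZ : 0 < Z) (hZ' : x' ⟨0, hn⟩ + h' ≤ Z) :
    u (x' + h' • ee ⟨0, hn⟩, t') - flow q h' (u (x', t')) ≤
      M * (2 * (n + 1) * (x' ⟨0, hn⟩ + h') + h' + 1) * Z⁻¹ := by
  set i : Fin n := ⟨0, hn⟩ with hi
  have hx'i : 0 ≤ x' i := hx'
  have hM := hu.M_pos
  set D : Set (Eu n × ℝ × ℝ) := {p | ‖p.1 - x'‖ ≤ Z ∧ 0 ≤ p.1 i ∧ p.1 i + p.2.1 ≤ Z ∧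
    0 ≤ p.2.1 ∧ p.2.2 ∈ Icc (t' - Z ^ 2) t'} with hDdef
  have hD : IsCompact D := by
    refine ((isCompact_closedBall x' Z).prod (isCompact_Icc (a := 0) (b := Z)|>.prod
      (isCompact_Icc (a := t' - Z ^ 2) (b := t')))).of_isClosed_subset ?_ ?_
    · have e : D = {p | ‖p.1 - x'‖ ≤ Z} ∩ ({p | 0 ≤ p.1 i} ∩ ({p | p.1 i + p.2.1 ≤ Z} ∩
          ({p | 0 ≤ p.2.1} ∩ ({p | t' - Z ^ 2 ≤ p.2.2} ∩ {p | p.2.2 ≤ t'})))) := rfl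
      rw [e]
      refine IsClosed.inter ?_ (IsClosed.inter ?_ (IsClosed.inter ?_ (IsClosed.inter ?_
        (IsClosed.inter ?_ ?_)))) <;> exact isClosed_le (by fun_prop) (by fun_prop)
    · rintro ⟨x, h, t⟩ ⟨h1, h2, h3, h4, h5⟩
      refine ⟨by simpa [dist_eq_norm] using h1, ⟨h4, ?_⟩, h5⟩
      simp only at h2 h3; linarith
  set V : Eu n × ℝ × ℝ → ℝ := fun p => u (p.1 + p.2.1 • ee i, p.2.2) - flow q p.2.1 (u (p.1, p.2.2))
    with hVdef
  set B : Eu n × ℝ × ℝ → ℝ := fun p =>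
    (n + 1) * (2 * ((p.1 i + p.2.1) / Z) - ((p.1 i + p.2.1) / Z) ^ 2) + (‖p.1 - x'‖ / Z) ^ 2 +
      (t' - p.2.2) / Z ^ 2 + p.2.1 / Z + 1 / Z with hBdef
  have hmem1 : ∀ x : Eu n, 0 ≤ x i → x ∈ closedHalf n hn := fun x hx => hx
  have hmem2 : ∀ (x : Eu n) (h : ℝ), 0 ≤ x i → 0 ≤ h → x + h • ee i ∈ closedHalf n hn := by
    intro x h h1 h2
    simp only [closedHalf, mem_ofPred_eq]; simp [hi] at h1 ⊢; linarith
  have hmem3 : ∀ (x : Eu n) (h : ℝ), 0 < x i → 0 ≤ h → x + h • ee i ∈ openHalf n hn := by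
    intro x h h1 h2
    simp only [openHalf, mem_ofPred_eq]; simp [hi] at h1 ⊢; linarith
  have hVc : ContinuousOn V D := by
    have c1 : ContinuousOn (fun p : Eu n × ℝ × ℝ => u (p.1, p.2.2)) D :=
      hu.cont.comp (by fun_prop) (fun p hp => ⟨hmem1 _ hp.2.1, trivial⟩)
    refine ContinuousOn.sub (hu.cont.comp (by fun_prop) ?_) ?_
    · exact fun p hp => ⟨hmem2 _ _ hp.2.1 hp.2.2.2.1, trivial⟩
    · exact (continuousOn_flow hq).comp
        (f := fun p : Eu n × ℝ × ℝ => (p.2.1, u (p.1, p.2.2))) (ContinuousOn.prodMk (by fun_prop) c1)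
        (fun p hp => ⟨hp.2.2.2.1, hu.pos _ (hmem1 _ hp.2.1) _⟩)
  have hBc : Continuous B := by simp only [hBdef]; fun_prop
  have hBge : ∀ p ∈ D, (‖p.1 - x'‖ / Z) ^ 2 + (t' - p.2.2) / Z ^ 2 + 1 / Z ≤ B p ∧
      ((p.1 i + p.2.1) / Z) + 1 / Z ≤ B p := by
    rintro ⟨x, h, t⟩ ⟨h1, h2, h3, h4, h5⟩
    simp only at h1 h2 h3 h4 h5 ⊢
    have e1 : (x i + h) / Z ≤ 1 := by rwa [div_le_one hZ]
    have e2 : 0 ≤ (x i + h) / Z := by positivity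
    have e3 : (x i + h) / Z ≤ (n + 1) * (2 * ((x i + h) / Z) - ((x i + h) / Z) ^ 2) := by
      have : (x i + h) / Z ≤ 2 * ((x i + h) / Z) - ((x i + h) / Z) ^ 2 := by nlinarith
      have hn0 : (0 : ℝ) ≤ n := by positivity
      nlinarith
    have e4 : 0 ≤ h / Z := by positivity
    have e5 : 0 ≤ (t' - t) / Z ^ 2 := div_nonneg (by linarith [h5.2]) (by positivity)
    have e6 : 0 ≤ (‖x - x'‖ / Z) ^ 2 := by positivity
    simp only [hBdef]
    constructor <;> linarith
  have hBpos : ∀ p ∈ D, 0 < B p := by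
    intro p hp
    have := (hBge p hp).2
    have h1 : 0 ≤ (p.1 i + p.2.1) / Z := div_nonneg (add_nonneg hp.2.1 hp.2.2.2.1) hZ.le
    have : 0 < 1 / Z := by positivity
    linarith
  have hVb : ∀ p ∈ D, V p ≤ M := by
    intro p hp
    have h1 := hu.le _ (hmem2 p.1 p.2.1 hp.2.1 hp.2.2.2.1) p.2.2
    have h2 := flow_pos hq hp.2.2.2.1 (hu.pos _ (hmem1 _ hp.2.1) p.2.2)
    simp only [hVdef]; linarith
  have key := le_mul_of_quotient_max hD hVc hBc.continuousOn hBpos (A := M) ?_ (x', h', t')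
    ⟨by simpa using hZ.le, hx'i, hZ', hh', by nlinarith, le_rfl⟩
  · refine key.trans ?_
    rw [mul_assoc]
    refine mul_le_mul_of_nonneg_left ?_ hM.le
    simp only [hBdef, sub_self, norm_zero, div_eq_mul_inv]
    have : 0 ≤ ((n : ℝ) + 1) * ((x' i + h') * Z⁻¹) ^ 2 := by positivity
    linarith
  rintro θ hθ ⟨x, h, t⟩ ⟨h1, h2, h3, h4, h5⟩ heq hmax
  simp only at h1 h2 h3 h4 h5
  have hp : (x, h, t) ∈ D := ⟨h1, h2, h3, h4, h5⟩
  obtain ⟨hge1, hge2⟩ := hBge _ hp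
  simp only at hge1 hge2
  have hBP := hBpos _ hp
  have hlt : M * B (x, h, t) < V (x, h, t) := by rw [heq]; exact mul_lt_mul_of_pos_right hθ hBP
  have hB1 : B (x, h, t) < 1 := by
    by_contra! hc
    have := hVb _ hp
    nlinarith
  have e5 : 0 ≤ (t' - t) / Z ^ 2 := div_nonneg (by linarith [h5.2]) (by positivity)
  have e6 : 0 ≤ (‖x - x'‖ / Z) ^ 2 := by positivity
  have e7 : 0 < 1 / Z := by positivity
  have hxl : ‖x - x'‖ < Z := by
    refine h1.lt_of_ne fun hc => ?_
    rw [hc, div_self hZ.ne'] at hge1; linarith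
  have hzl : x i + h < Z := by
    refine h3.lt_of_ne fun hc => ?_
    rw [hc, div_self hZ.ne'] at hge2; linarith
  have htl : t' - Z ^ 2 < t := by
    refine h5.1.lt_of_ne fun hc => ?_
    have : (t' - t) / Z ^ 2 = 1 := by rw [← hc]; field_simp; ring
    linarith
  have hh0 : 0 < h := by
    refine h4.lt_of_ne fun hc => ?_
    have : V (x, h, t) = 0 := by
      simp [hVdef, ← hc, flow_zero hq (hu.pos x (hmem1 x h2) t)]
    rw [this] at hlt
    have := mul_pos hM hBP
    linarith
  have hux := hu.pos x (hmem1 x h2) t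
  rcases h2.eq_or_lt with hx0 | hx0
  · -- the lateral boundary: move along `(e₀, -1)`
    have d1 := hu.bdry x hx0.symm t
    have d2 : HasDerivWithinAt (fun k : ℝ => flow q (h - k) (u (x + k • ee i, t))) 0 (Ici 0) 0 := by
      have a1 := d1.rpow_const (p := 1 - q) (Or.inl (by simpa using hux.ne'))
      have a2 := a1.add (((hasDerivWithinAt_id (0 : ℝ) (Ici 0)).const_sub h).const_mul (q - 1))
      have a3 := a2.rpow_const (p := -(1 / (q - 1)))
        (Or.inl (by simpa using (flow_base_pos hq hh0.le hux).ne'))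
      refine a3.congr_deriv ?_
      have : u (x, t) ^ q * u (x, t) ^ (-q) = 1 := by
        rw [← Real.rpow_add hux]; simp
      simp only [zero_smul, add_zero, show (1 : ℝ) - q - 1 = -q by ring]
      rw [show -u (x, t) ^ q * (1 - q) * u (x, t) ^ (-q) + (q - 1) * -1 =
        (q - 1) * (u (x, t) ^ q * u (x, t) ^ (-q) - 1) by ring, this]
      simp
    have d3 : HasDerivWithinAt (fun k : ℝ => B (x + k • ee i, h - k, t))
        (-(2 * x' i / Z ^ 2 + 1 / Z)) (Ici 0) 0 := by
      refine (((J2.poly (B (x, h, t)) (-(2 * x' i / Z ^ 2 + 1 / Z)) (1 / Z ^ 2)).congr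
        (Eventually.of_forall fun k => ?_)).hasDerivAt.hasDerivWithinAt)
      simp only [hBdef, add_sub_right_comm x (k • ee i) x', div_pow, norm_add_smul_ee_sq]
      simp [← hx0]; field_simp; ring
    have d4 := (d2.const_sub (u (x + h • ee i, t))).sub (d3.const_mul θ)
    have := d4.nonpos_of_right_max ?_
    · have hθ0 : 0 < θ := hM.trans hθ
      have : 0 < θ * (2 * x' i / Z ^ 2 + 1 / Z) := by positivity
      linarith
    · have hn1 : ‖x - x'‖ < Z := hxl
      filter_upwards [eventually_Ioi_norm_le (v := ee i) hxl, Ioo_mem_nhdsGT hh0] with k e1 e2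
      have := hmax (x + k • ee i, h - k, t) ⟨by rwa [add_sub_right_comm],
        by simpa [← hx0] using e2.1.le, by simpa using h3, by simpa using e2.2.le, h5⟩
      simp only [hVdef] at this heq
      rw [show x + k • ee i + (h - k) • ee i = x + h • ee i by rw [sub_smul]; abel] at this
      simp only [Pi.sub_apply, zero_smul, add_zero, sub_zero]
      linarith
  · obtain ⟨F2, hF2, hF2'⟩ := flow_second_deriv hq hh0.le hux
    obtain ⟨e, he, c1⟩ := (hu.heat x hx0 t).comp_concave (F := flow q h)
      ((lt_mem_nhds hux).mono fun s hs => flow_hasDerivAt hq hh0.le hs) hF2' hF2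
    have c2 : HJ (fun p => u (p.1 + h • ee i, p.2)) x t 0 := by
      have := (by simpa [add_comm] using hu.heat _ (hmem3 x h hx0 hh0.le) t :
        HJ u (h • ee i + x) t 0).translate
      simpa [add_comm] using this
    have c3 : HJ (fun p => B (p.1, h, p.2)) x t (1 / Z ^ 2) := by
      have := HJ.quadratic ((n + 1) * (2 * (h / Z) - (h / Z) ^ 2) + ‖x'‖ ^ 2 / Z ^ 2 + t' / Z ^ 2
          + h / Z + 1 / Z) (-1 / Z ^ 2)
        (fun j => -2 / Z ^ 2 * x' j + if j = i then (n + 1) * (2 / Z - 2 * h / Z ^ 2) else 0)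
        (fun j => 1 / Z ^ 2 - if j = i then (n + 1) / Z ^ 2 else 0) x t
      convert this.congr (g := fun p => B (p.1, h, p.2)) fun p => ?_ using 1
      · simp only [mul_sub, Finset.sum_sub_distrib, mul_ite, mul_zero]
        simp; field_simp; ring
      · have e : ‖p.1 - x'‖ ^ 2 = ‖p.1‖ ^ 2 - 2 * ∑ j, x' j * p.1 j + ‖x'‖ ^ 2 := by
          rw [← sum_sq_eq_norm, ← sum_sq_eq_norm, ← sum_sq_eq_norm, Finset.mul_sum,
            ← Finset.sum_sub_distrib, ← Finset.sum_add_distrib]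
          refine Finset.sum_congr rfl fun j _ => ?_
          simp; ring
        simp only [add_mul, sub_mul, ite_mul, zero_mul, Finset.sum_add_distrib,
          Finset.sum_sub_distrib, Finset.sum_ite_eq', Finset.mem_univ, if_true, mul_assoc,
          ← Finset.mul_sum, sum_sq_eq_norm, hBdef, div_pow, e]
        field_simp; ring
    have := ((c2.sub c1).sub (c3.const_mul θ)).nonneg_of_max (fun j => ?_) ?_
    · have hθ0 : 0 < θ := hM.trans hθ
      have : 0 < θ * (1 / Z ^ 2) := by positivity
      linarith
    · have e3 : ∀ᶠ k in 𝓝 (0 : ℝ), (x + k • ee j) i + h < Z := by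
        have : Continuous fun k : ℝ => (x + k • ee j) i + h := by fun_prop
        exact this.continuousAt.eventually_lt continuousAt_const (by simpa using hzl)
      filter_upwards [eventually_norm_lt (v := ee j) hxl, eventually_apply_pos (v := ee j) hx0, e3]
        with k e1 e2 e3
      have := hmax (x + k • ee j, h, t) ⟨by simpa only [add_sub_right_comm] using e1.le,
        e2.le, e3.le, h4, h5⟩
      simp only [hVdef] at this heq
      linarith
    · filter_upwards [Ioo_mem_nhdsLT htl] with s hs
      have := hmax (x, h, s) ⟨h1, h2, h3, h4, hs.1.le, hs.2.le.trans h5.2⟩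
      simp only [hVdef] at this heq
      linarith

/-- Decay of a solution in the normal direction. -/
lemma Sol.le_flow (hu : Sol n hn q M u) (hq : 1 < q) {x : Eu n} (hx : x ∈ closedHalf n hn)
    {h : ℝ} (hh : 0 ≤ h) (t : ℝ) : u (x + h • ee ⟨0, hn⟩, t) ≤ flow q h (u (x, t)) := by
  have h1 : Tendsto (fun Z : ℝ => M * (2 * (n + 1) * (x ⟨0, hn⟩ + h) + h + 1) * Z⁻¹) atTop (𝓝 0) := by
    simpa using tendsto_inv_atTop_zero.const_mul (M * (2 * (n + 1) * (x ⟨0, hn⟩ + h) + h + 1))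
  have h2 : u (x + h • ee ⟨0, hn⟩, t) - flow q h (u (x, t)) ≤ 0 := by
    refine ge_of_tendsto h1 ?_
    filter_upwards [eventually_gt_atTop 0, eventually_ge_atTop (x ⟨0, hn⟩ + h)] with Z hZ hZ'
    exact hu.le_flow_aux hq hx hh t hZ hZ'
  linarith

end

section
variable {n : ℕ} {hn : 0 < n}

/-- A bounded solution of the heat equation on `{δ ≤ x₁}`. -/
structure HeatOn (hn : 0 < n) (δ A : ℝ) (v : Eu n × ℝ → ℝ) : Prop where
  cont : ContinuousOn v ({x : Eu n | δ ≤ x ⟨0, hn⟩} ×ˢ univ)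
  heat : ∀ x : Eu n, δ < x ⟨0, hn⟩ → ∀ t, HJ v x t 0
  bd : ∀ x : Eu n, δ ≤ x ⟨0, hn⟩ → ∀ t, |v (x, t)| ≤ A

/-- The difference quotient in the direction of the `i`-th axis. -/
noncomputable def dq (i : Fin n) (k : ℝ) (v : Eu n × ℝ → ℝ) (p : Eu n × ℝ) : ℝ :=
  (v (p.1 + k • ee i, p.2) - v p) / k

lemma neg_le_smul_ee_apply (i j : Fin n) (k : ℝ) : -|k| ≤ (k • (ee i : Eu n)) j := by
  by_cases h : j = i
  · simp [h, neg_abs_le]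
  · simp [h]

namespace HeatOn

variable {δ δ' A l k : ℝ} {v : Eu n × ℝ → ℝ}

lemma nonneg_bd (h : HeatOn hn δ A v) : 0 ≤ A :=
  (abs_nonneg _).trans (h.bd (δ • ee ⟨0, hn⟩) (by simp) 0)

lemma neg (h : HeatOn hn δ A v) : HeatOn hn δ A (fun p => -1 * v p) where
  cont := continuousOn_const.mul h.cont
  heat x hx t := by simpa using (h.heat x hx t).const_mul (-1)
  bd x hx t := by simpa using h.bd x hx t

lemma mono (h : HeatOn hn δ A v) (hd : δ ≤ δ') : HeatOn hn δ' A v where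
  cont := h.cont.mono (prod_mono (fun _ hx => hd.trans hx) subset_rfl)
  heat x hx t := h.heat x (hd.trans_lt hx) t
  bd x hx t := h.bd x (hd.trans hx) t

lemma diff_le_aux (h : HeatOn hn δ A v) (hl : 0 < l) (hk0 : 0 ≤ k) (hk : k ≤ l) (i : Fin n)
    {x : Eu n} (hx : δ + 2 * l ≤ x ⟨0, hn⟩ + (k / 2) * (ee i : Eu n) ⟨0, hn⟩ + l / 2) (t : ℝ) :
    v (x + k • ee i, t) - v (x, t) ≤ A * (2 * n + 3) / l * k := by
  set c : Eu n := x + (k / 2) • ee i with hc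
  have hc0 : c ⟨0, hn⟩ = x ⟨0, hn⟩ + (k / 2) * (ee i : Eu n) ⟨0, hn⟩ := by simp [hc]
  have hin : ∀ y ∈ Metric.closedBall c l, δ + l / 2 ≤ y ⟨0, hn⟩ := by
    intro y hy
    have h1 : ‖y - c‖ ≤ l := by simpa [dist_eq_norm] using hy
    have h2 := (abs_le.1 ((abs_apply_le_norm (y - c) ⟨0, hn⟩).trans h1)).1
    rw [PiLp.sub_apply] at h2
    linarith
  have := interior_symm_diff i (v := v) (c := c) hl h.nonneg_bd
    (h.cont.mono (prod_mono (fun y hy => (by linarith [hin y hy] : δ ≤ y ⟨0, hn⟩)) subset_rfl))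
    (fun y hy t => h.heat y (by linarith [hin y (Metric.ball_subset_closedBall hy)]) t)
    (fun y hy t => h.bd y (by linarith [hin y hy]) t) (h := k / 2) (by linarith) (by linarith) t
  have e1 : c + (k / 2) • ee i = x + k • ee i := by
    rw [hc, add_assoc, ← add_smul]; congr 2; ring
  have e2 : c - (k / 2) • ee i = x := by rw [hc]; abel
  rw [e1, e2] at this
  refine this.trans (le_of_eq ?_)
  field_simp

lemma diff_le (h : HeatOn hn δ A v) (hl : 0 < l) (hk : |k| ≤ l) (i : Fin n)
    {x : Eu n} (hx : δ + 2 * l ≤ x ⟨0, hn⟩) (t : ℝ) :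
    |v (x + k • ee i, t) - v (x, t)| ≤ A * (2 * n + 3) / l * |k| := by
  have key : ∀ w : Eu n × ℝ → ℝ, HeatOn hn δ A w →
      w (x + k • ee i, t) - w (x, t) ≤ A * (2 * n + 3) / l * |k| ∧
      w (x, t) - w (x + k • ee i, t) ≤ A * (2 * n + 3) / l * |k| := by
    have aux : ∀ w : Eu n × ℝ → ℝ, HeatOn hn δ A w → (0 ≤ k →
        w (x + k • ee i, t) - w (x, t) ≤ A * (2 * n + 3) / l * |k|) ∧ (k ≤ 0 →
        w (x, t) - w (x + k • ee i, t) ≤ A * (2 * n + 3) / l * |k|) := by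
      intro w hw
      have he : (0 : ℝ) ≤ (ee i : Eu n) ⟨0, hn⟩ ∧ (ee i : Eu n) ⟨0, hn⟩ ≤ 1 := by
        rw [ee_apply]; split_ifs <;> norm_num
      obtain ⟨hk1, hk2⟩ := abs_le.1 hk
      refine ⟨fun h0 => ?_, fun h0 => ?_⟩
      · rw [abs_of_nonneg h0]
        exact hw.diff_le_aux hl h0 hk2 i (by nlinarith) t
      · rw [abs_of_nonpos h0]
        have := hw.diff_le_aux hl (k := -k) (by linarith) (by linarith) i (x := x + k • ee i)
          (by simp only [PiLp.add_apply, PiLp.smul_apply, smul_eq_mul]; nlinarith) t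
        rwa [add_assoc, ← add_smul, add_neg_cancel, zero_smul, add_zero] at this
    intro w hw
    obtain ⟨a1, a2⟩ := aux w hw
    obtain ⟨b1, b2⟩ := aux _ hw.neg
    rcases le_total 0 k with h0 | h0
    · exact ⟨a1 h0, by linarith [b1 h0]⟩
    · exact ⟨by linarith [b2 h0], a2 h0⟩
  rw [abs_le]
  have := key v h
  constructor <;> linarith [this.1, this.2]

lemma dq_of_bound (h : HeatOn hn δ A v) {A' : ℝ} (i : Fin n) (hk0 : k ≠ 0) (hk : |k| ≤ l)
    (hA : ∀ x : Eu n, δ + l ≤ x ⟨0, hn⟩ → ∀ t, |v (x + k • ee i, t) - v (x, t)| ≤ A' * |k|) :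
    HeatOn hn (δ + l) A' (dq i k v) where
  cont := by
    have hl : 0 ≤ l := (abs_nonneg k).trans hk
    refine ContinuousOn.div_const (ContinuousOn.sub (h.cont.comp (by fun_prop) ?_) (h.cont.mono ?_)) _
    · rintro ⟨y, s⟩ ⟨hy, -⟩
      refine ⟨?_, trivial⟩
      have := neg_le_smul_ee_apply i ⟨0, hn⟩ k
      change δ + l ≤ y ⟨0, hn⟩ at hy
      change δ ≤ (y + k • ee i) ⟨0, hn⟩
      rw [PiLp.add_apply]; linarith
    · rintro ⟨y, s⟩ ⟨hy, -⟩
      exact ⟨(by change δ + l ≤ y ⟨0, hn⟩ at hy; change δ ≤ y ⟨0, hn⟩; linarith), trivial⟩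
  heat x hx t := by
    have hl : 0 ≤ l := (abs_nonneg k).trans hk
    have h1 : HJ v (k • ee i + x) t 0 := h.heat _ (by
      have := neg_le_smul_ee_apply i ⟨0, hn⟩ k
      rw [PiLp.add_apply]; linarith) t
    have h2 := (h1.translate.sub (h.heat x (by linarith) t)).const_mul k⁻¹
    rw [sub_zero, mul_zero] at h2
    refine h2.congr ?_
    intro p
    simp only [dq, add_comm (k • ee i) p.1]
    ring
  bd x hx t := by
    rw [dq, abs_div, div_le_iff₀ (abs_pos.2 hk0)]
    exact hA x hx t

lemma dq (h : HeatOn hn δ A v) (hl : 0 < l) (i : Fin n) (hk0 : k ≠ 0) (hk : |k| ≤ l) :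
    HeatOn hn (δ + 2 * l) (A * (2 * n + 3) / l) (dq i k v) :=
  (h.mono (by linarith : δ ≤ δ + l)).dq_of_bound i hk0 hk (fun x hx t =>
    h.diff_le hl hk i (by linarith) t) |>.mono (by linarith)

end HeatOn

/-- The partial derivative along the `i`-th axis. -/
noncomputable def pd (i : Fin n) (v : Eu n × ℝ → ℝ) (p : Eu n × ℝ) : ℝ :=
  deriv (fun k : ℝ => v (p.1 + k • ee i, p.2)) 0

lemma hasDerivAt_slice {i : Fin n} {v : Eu n × ℝ → ℝ} {x : Eu n} {t k d : ℝ}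
    (h : HasDerivAt (fun r : ℝ => v ((x + k • ee i) + r • ee i, t)) d 0) :
    HasDerivAt (fun r : ℝ => v (x + r • ee i, t)) d k := by
  have h1 : HasDerivAt (fun r : ℝ => v ((x + k • ee i) + (r - k) • ee i, t)) d k := by
    have := HasDerivAt.comp k (h₂ := fun r : ℝ => v ((x + k • ee i) + r • ee i, t)) (h₂' := d)
      (h := fun r => r - k) (h' := 1) (by simpa using h) ((hasDerivAt_id k).sub_const k)
    simpa [Function.comp_def] using this
  refine h1.congr_of_eventuallyEq (Eventually.of_forall fun r => ?_)
  simp only [add_assoc, ← add_smul, add_sub_cancel]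

lemma HJ.pd_spec {v : Eu n × ℝ → ℝ} {x : Eu n} {t e : ℝ} (h : HJ v x t e) (i : Fin n) :
    HasDerivAt (fun k : ℝ => v (x + k • ee i, t)) (pd i v (x, t)) 0 := by
  obtain ⟨d, a, τ, h1, -⟩ := h
  exact (h1 i).hasDerivAt.differentiableAt.hasDerivAt

lemma HJ.J2_pd {v : Eu n × ℝ → ℝ} {x : Eu n} {t e : ℝ} (h : HJ v x t e) (i : Fin n)  :
    J2 (fun k : ℝ => v (x + k • ee i, t)) (pd i v (x, t)) (pd i (pd i v) (x, t)) ∧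
    HasDerivAt (fun k : ℝ => pd i v (x + k • ee i, t)) (pd i (pd i v) (x, t)) 0 := by
  have h0 := h
  obtain ⟨d, a, τ, h1, -⟩ := h
  obtain ⟨g, hg1, hg2, hg3⟩ := h1 i
  have hev : ∀ᶠ k in 𝓝 (0:ℝ), pd i v (x + k • ee i, t) = g k := by
    filter_upwards [hg1] with k hk
    have h2 : HasDerivAt (fun r : ℝ => v ((x + k • ee i) + r • ee i, t)) (g k) 0 := by
      have := HasDerivAt.comp 0 (h₂ := fun r : ℝ => v (x + r • ee i, t)) (h₂' := g k)
        (h := fun r => k + r) (h' := 1) (by simpa using hk) ((hasDerivAt_id _).const_add k)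
      simpa [Function.comp_def, add_smul, add_assoc] using this
    exact h2.deriv
  have h4 : HasDerivAt (fun k : ℝ => pd i v (x + k • ee i, t)) (a i) 0 :=
    hg3.congr_of_eventuallyEq hev
  have h5 : pd i (pd i v) (x, t) = a i := h4.deriv
  rw [h5]
  exact ⟨⟨g, hg1, by rw [← hev.self_of_nhds]; simp, hg3⟩, h4⟩

lemma HJ.time_deriv {v : Eu n × ℝ → ℝ} {x : Eu n} {t e : ℝ} (h : HJ v x t e) :
    HasDerivAt (fun s => v (x, s)) (e + ∑ i, pd i (pd i v) (x, t)) t := by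
  have h0 := h
  obtain ⟨d, a, τ, h1, h2, h3⟩ := h
  have : ∀ i, pd i (pd i v) (x, t) = a i := fun i => ((h0.J2_pd i).1.unique (h1 i)).2
  simp only [this]
  convert h2 using 1
  linarith

lemma abs_sub_mul_le_of_deriv_lip {φ φ' : ℝ → ℝ} {C k : ℝ}
    (h : ∀ r, |r| ≤ |k| → HasDerivAt φ (φ' r) r) (h' : ∀ r, |r| ≤ |k| → |φ' r - φ' 0| ≤ C * |r|)
    (hC : 0 ≤ C) : |φ k - φ 0 - φ' 0 * k| ≤ C * |k| * |k| := by
  have := Convex.norm_image_sub_le_of_norm_hasDerivWithin_le (f := fun r => φ r - φ' 0 * r)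
    (f' := fun r => φ' r - φ' 0) (C := C * |k|) (s := Icc (-|k|) |k|) (x := 0) (y := k)
    (fun r hr => by
      have := (h r (abs_le.2 hr)).fun_sub ((hasDerivAt_id r).const_mul (φ' 0))
      simpa using this.hasDerivWithinAt)
    (fun r hr => (h' r (abs_le.2 hr)).trans (mul_le_mul_of_nonneg_left (abs_le.2 hr) hC))
    (convex_Icc _ _) (by simp) (abs_le.1 le_rfl)
  simp only [Real.norm_eq_abs, sub_zero, mul_zero] at this
  convert this using 2
  ring

lemma eventually_abs_le {l : ℝ} (hl : 0 < l) : ∀ᶠ k in 𝓝[≠] (0 : ℝ), |k| ≤ l ∧ k ≠ 0 := by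
  have : ∀ᶠ k in 𝓝 (0 : ℝ), |k| < l :=
    continuous_abs.continuousAt.eventually_lt continuousAt_const (by simpa)
  filter_upwards [this.filter_mono nhdsWithin_le_nhds, self_mem_nhdsWithin] with k hk h
    using ⟨hk.le, h⟩

/-- A directional derivative which is Lipschitz along its own direction is jointly continuous. -/
lemma continuousOn_of_dq {f g : Eu n × ℝ → ℝ} {δ l C : ℝ} (i : Fin n) (hl : 0 < l) (hC : 0 ≤ C)
    (hf : ContinuousOn f ({x : Eu n | δ ≤ x ⟨0, hn⟩} ×ˢ univ))
    (hd : ∀ x : Eu n, δ ≤ x ⟨0, hn⟩ → ∀ t,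
      HasDerivAt (fun k : ℝ => f (x + k • ee i, t)) (g (x, t)) 0)
    (hg : ∀ x : Eu n, δ + l ≤ x ⟨0, hn⟩ → ∀ t k, |k| ≤ l →
      |g (x + k • ee i, t) - g (x, t)| ≤ C * |k|) :
    ContinuousOn g ({x : Eu n | δ + l ≤ x ⟨0, hn⟩} ×ˢ univ) := by
  have hmem : ∀ (x : Eu n) (k : ℝ), δ + l ≤ x ⟨0, hn⟩ → |k| ≤ l → δ ≤ (x + k • ee i) ⟨0, hn⟩ := by
    intro x k hx hk
    have := neg_le_smul_ee_apply i ⟨0, hn⟩ k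
    rw [PiLp.add_apply]; linarith
  have hunif : TendstoUniformlyOn (fun k => dq i k f) g (𝓝[≠] (0 : ℝ))
      ({x : Eu n | δ + l ≤ x ⟨0, hn⟩} ×ˢ univ) := by
    rw [Metric.tendstoUniformlyOn_iff]
    intro ε hε
    have h1 : ∀ᶠ k in 𝓝[≠] (0 : ℝ), C * |k| < ε := by
      have : ∀ᶠ k in 𝓝 (0 : ℝ), C * |k| < ε :=
        (by fun_prop : Continuous fun k : ℝ => C * |k|).continuousAt.eventually_lt
          continuousAt_const (by simpa)
      exact this.filter_mono nhdsWithin_le_nhds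
    filter_upwards [eventually_abs_le hl, h1] with k ⟨hk, hk0⟩ hk'
    rintro ⟨x, t⟩ ⟨hx, -⟩
    have h2 := abs_sub_mul_le_of_deriv_lip (φ := fun r : ℝ => f (x + r • ee i, t))
      (φ' := fun r => g (x + r • ee i, t)) (C := C) (k := k)
      (fun r hr => hasDerivAt_slice (hd _ (hmem x r hx (hr.trans hk)) t))
      (fun r hr => by simpa using hg x hx t r (hr.trans hk)) hC
    simp only [zero_smul, add_zero] at h2
    have hk0' : (0 : ℝ) < |k| := abs_pos.2 hk0
    refine lt_of_le_of_lt ?_ hk'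
    rw [dist_comm, Real.dist_eq, dq]
    rw [← mul_le_mul_iff_left₀ hk0', ← abs_mul]
    have h3 : ((f (x + k • ee i, t) - f (x, t)) / k - g (x, t)) * k =
        f (x + k • ee i, t) - f (x, t) - g (x, t) * k := by field_simp
    simp only [h3]
    exact h2
  refine hunif.continuousOn (Eventually.frequently ?_)
  filter_upwards [eventually_abs_le hl] with k ⟨hk, _⟩
  refine ContinuousOn.div_const (ContinuousOn.sub (hf.comp (by fun_prop) ?_) (hf.mono ?_)) _
  · rintro ⟨y, s⟩ ⟨hy, -⟩
    exact ⟨hmem y k hy hk, trivial⟩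
  · rintro ⟨y, s⟩ ⟨hy, -⟩
    exact ⟨(by change δ + l ≤ y ⟨0, hn⟩ at hy; change δ ≤ y ⟨0, hn⟩; linarith), trivial⟩

lemma tendsto_dq {f g : Eu n × ℝ → ℝ} {i : Fin n} {x : Eu n} {t : ℝ}
    (h : HasDerivAt (fun k : ℝ => f (x + k • ee i, t)) (g (x, t)) 0) :
    Tendsto (fun k => dq i k f (x, t)) (𝓝[≠] 0) (𝓝 (g (x, t))) := by
  have := hasDerivAt_iff_tendsto_slope_zero.1 h
  refine this.congr fun k => ?_
  simp [dq, div_eq_inv_mul]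

namespace HeatOn
variable {δ A l : ℝ} {v : Eu n × ℝ → ℝ}

lemma shift_mem {i : Fin n} {x : Eu n} {k a b : ℝ} (hx : a ≤ x ⟨0, hn⟩) (hk : |k| ≤ l)
    (h : b + l ≤ a) : b ≤ (x + k • ee i) ⟨0, hn⟩ := by
  have := neg_le_smul_ee_apply i ⟨0, hn⟩ k
  rw [PiLp.add_apply]; linarith

lemma pd_lip (h : HeatOn hn δ A v) (hl : 0 < l) (i : Fin n) {x : Eu n} (hx : δ + 4 * l ≤ x ⟨0, hn⟩)
    {t k : ℝ} (hk : |k| ≤ l) :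
    |pd i v (x + k • ee i, t) - pd i v (x, t)| ≤ A * (2 * n + 3) / l * (2 * n + 3) / l * |k| := by
  have t1 := tendsto_dq ((h.heat (x + k • ee i) (by
    have := shift_mem (hn := hn) (i := i) hx hk (b := δ + 3 * l) (by linarith); linarith) t).pd_spec i)
  have t2 := tendsto_dq ((h.heat x (by linarith) t).pd_spec i)
  refine le_of_tendsto (t1.sub t2).abs ?_
  filter_upwards [eventually_abs_le hl] with r hr
  exact (h.dq hl i hr.2 hr.1).diff_le hl hk i (by linarith) t

lemma pd_pd_lip (h : HeatOn hn δ A v) (hl : 0 < l) (i : Fin n) {x : Eu n}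
    (hx : δ + 6 * l ≤ x ⟨0, hn⟩) {t k : ℝ} (hk : |k| ≤ l) :
    |pd i (pd i v) (x + k • ee i, t) - pd i (pd i v) (x, t)| ≤
      A * (2 * n + 3) / l * (2 * n + 3) / l * (2 * n + 3) / l * |k| := by
  have hx' : δ + 5 * l ≤ (x + k • ee i) ⟨0, hn⟩ := shift_mem hx hk (by linarith)
  have t1 := tendsto_dq ((h.heat (x + k • ee i) (by linarith) t).J2_pd i).2
  have t2 := tendsto_dq ((h.heat x (by linarith) t).J2_pd i).2
  refine le_of_tendsto (t1.sub t2).abs ?_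
  filter_upwards [eventually_abs_le hl] with r hr
  have lim : ∀ y : Eu n, δ + 5 * l ≤ y ⟨0, hn⟩ →
      Tendsto (fun m => _root_.dq i r (_root_.dq i m v) (y, t)) (𝓝[≠] 0)
        (𝓝 (_root_.dq i r (pd i v) (y, t))) := by
    intro y hy
    have hy' : δ + 4 * l ≤ (y + r • ee i) ⟨0, hn⟩ := shift_mem hy hr.1 (by linarith)
    exact ((tendsto_dq ((h.heat _ (by linarith) t).pd_spec i)).sub
      (tendsto_dq ((h.heat y (by linarith) t).pd_spec i))).div_const r
  refine le_of_tendsto ((lim _ hx').sub (lim x (by linarith))).abs ?_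
  filter_upwards [eventually_abs_le hl] with m hm
  exact ((h.dq hl i hm.2 hm.1).dq hl i hr.2 hr.1).diff_le hl hk i (by linarith) t

lemma continuousOn_pd (h : HeatOn hn δ A v) (hl : 0 < l) (i : Fin n) :
    ContinuousOn (pd i v) ({x : Eu n | δ + 5 * l ≤ x ⟨0, hn⟩} ×ˢ univ) := by
  have hA := h.nonneg_bd
  have := continuousOn_of_dq (hn := hn) (δ := δ + 4 * l) (l := l) (g := pd i v) (f := v)
    (C := A * (2 * n + 3) / l * (2 * n + 3) / l) i hl (by positivity)
    (h.mono (by linarith : δ ≤ δ + 4 * l)).cont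
    (fun x hx t => (h.heat x (by linarith) t).pd_spec i)
    (fun x hx t k hk => h.pd_lip hl i (by linarith) hk)
  refine this.mono (prod_mono (fun x hx => ?_) subset_rfl)
  change δ + 5 * l ≤ x ⟨0, hn⟩ at hx
  change δ + 4 * l + l ≤ x ⟨0, hn⟩
  linarith

lemma continuousOn_pd_pd (h : HeatOn hn δ A v) (hl : 0 < l) (i : Fin n) :
    ContinuousOn (pd i (pd i v)) ({x : Eu n | δ + 6 * l ≤ x ⟨0, hn⟩} ×ˢ univ) := by
  have hA := h.nonneg_bd
  have := continuousOn_of_dq (hn := hn) (δ := δ + 5 * l) (l := l) (g := pd i (pd i v)) (f := pd i v)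
    (C := A * (2 * n + 3) / l * (2 * n + 3) / l * (2 * n + 3) / l) i hl (by positivity)
    (h.continuousOn_pd hl i)
    (fun x hx t => ((h.heat x (by linarith) t).J2_pd i).2)
    (fun x hx t k hk => h.pd_pd_lip hl i (by linarith) hk)
  refine this.mono (prod_mono (fun x hx => ?_) subset_rfl)
  change δ + 6 * l ≤ x ⟨0, hn⟩ at hx
  change δ + 5 * l + l ≤ x ⟨0, hn⟩
  linarith

end HeatOn

section
variable {q M : ℝ} {u : Eu n × ℝ → ℝ}

lemma Sol.heatOn (hu : Sol n hn q M u) {δ : ℝ} (hδ : 0 ≤ δ) : HeatOn hn δ M u where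
  cont := hu.cont.mono (prod_mono (fun _ hx => hδ.trans hx) subset_rfl)
  heat x hx t := hu.heat x (hδ.trans_lt hx) t
  bd x hx t := by
    rw [abs_of_pos (hu.pos x (hδ.trans hx) t)]
    exact hu.le x (hδ.trans hx) t

lemma Sol.continuousOn_of_forall {f : Eu n × ℝ → ℝ}
    (h : ∀ l > 0, ContinuousOn f ({x : Eu n | 6 * l ≤ x ⟨0, hn⟩} ×ˢ univ)) :
    ContinuousOn f (openHalf n hn ×ˢ univ) := by
  rintro ⟨x, t⟩ ⟨hx, -⟩
  change 0 < x ⟨0, hn⟩ at hx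
  refine ((h (x ⟨0, hn⟩ / 12) (by positivity)).continuousAt ?_).continuousWithinAt
  have h1 : ContinuousAt (fun p : Eu n × ℝ => p.1 ⟨0, hn⟩) (x, t) := by fun_prop
  filter_upwards [h1.eventually_const_lt (show x ⟨0, hn⟩ / 2 < _ by simp only; linarith)] with p hp
  exact ⟨(by change 6 * (x ⟨0, hn⟩ / 12) ≤ p.1 ⟨0, hn⟩; linarith), trivial⟩

lemma Sol.continuousOn_pd (hu : Sol n hn q M u) (i : Fin n) :
    ContinuousOn (pd i u) (openHalf n hn ×ˢ univ) :=
  Sol.continuousOn_of_forall fun l hl => ((hu.heatOn le_rfl).continuousOn_pd hl i).mono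
    (prod_mono (fun x hx => by
      change 6 * l ≤ x ⟨0, hn⟩ at hx
      change 0 + 5 * l ≤ x ⟨0, hn⟩
      linarith) subset_rfl)

lemma Sol.continuousOn_pd_pd (hu : Sol n hn q M u) (i : Fin n) :
    ContinuousOn (pd i (pd i u)) (openHalf n hn ×ˢ univ) :=
  Sol.continuousOn_of_forall fun l hl => ((hu.heatOn le_rfl).continuousOn_pd_pd hl i).mono
    (prod_mono (fun x hx => by
      change 6 * l ≤ x ⟨0, hn⟩ at hx
      change 0 + 6 * l ≤ x ⟨0, hn⟩
      linarith) subset_rfl)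

lemma Sol.abs_pd_le (hu : Sol n hn q M u) (i : Fin n) {x : Eu n} (hx : x ∈ openHalf n hn) (t : ℝ) :
    |pd i u (x, t)| ≤ M := by
  have hx' : 0 < x ⟨0, hn⟩ := hx
  refine le_of_tendsto (tendsto_dq ((hu.heat x hx t).pd_spec i)).abs ?_
  filter_upwards [eventually_abs_le (l := x ⟨0, hn⟩) hx'] with k hk
  rw [dq, abs_div, div_le_iff₀ (abs_pos.2 hk.2)]
  refine (hu.lip _ ?_ x hx'.le t).trans ?_
  · have : (0:ℝ) ≤ (x + k • ee i) ⟨0, hn⟩ := HeatOn.shift_mem (hn := hn) (i := i) le_rfl hk.1 (by linarith)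
    exact this
  · rw [add_sub_cancel_left, norm_smul_ee]

lemma Sol.abs_pd_pd_le (hu : Sol n hn q M u) (i : Fin n) {x : Eu n} {l : ℝ} (hl : 0 < l)
    (hx : 4 * l ≤ x ⟨0, hn⟩) (t : ℝ) :
    |pd i (pd i u) (x, t)| ≤ M * (2 * n + 3) / l := by
  refine le_of_tendsto (tendsto_dq ((hu.heat x (by change 0 < x ⟨0, hn⟩; linarith) t).J2_pd i).2).abs ?_
  filter_upwards [eventually_abs_le hl] with k hk
  rw [dq, abs_div, div_le_iff₀ (abs_pos.2 hk.2)]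
  have hx' : 3 * l ≤ (x + k • ee i) ⟨0, hn⟩ := HeatOn.shift_mem hx hk.1 (by linarith)
  refine le_of_tendsto ((tendsto_dq ((hu.heat (x + k • ee i)
      (by change 0 < (x + k • ee i) ⟨0, hn⟩; linarith) t).pd_spec i)).sub
    (tendsto_dq ((hu.heat x (by change 0 < x ⟨0, hn⟩; linarith) t).pd_spec i))).abs ?_
  filter_upwards [eventually_abs_le hl] with r hr
  have h1 : HeatOn hn (0 + l) M (dq i r u) := (hu.heatOn le_rfl).dq_of_bound i hr.2 hr.1 (by
    intro y hy t
    have : (0:ℝ) ≤ (y + r • ee i) ⟨0, hn⟩ := HeatOn.shift_mem hy hr.1 (by linarith)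
    refine (hu.lip _ this y (by change (0:ℝ) ≤ y ⟨0, hn⟩; linarith) t).trans ?_
    rw [add_sub_cancel_left, norm_smul_ee])
  exact h1.diff_le hl hk.1 i (by linarith) t

/-- Uniform Hölder continuity in time. -/
lemma Sol.time_holder (hu : Sol n hn q M u) {x : Eu n} (hx : x ∈ closedHalf n hn) {t r : ℝ}
    (hr : 0 < r) (t' : ℝ) (ht : |t' - t| ≤ r ^ 2) :
    |u (x, t') - u (x, t)| ≤ (2 * M + 4 * n * (M * (2 * n + 3))) * r := by
  have hM : 0 ≤ M := (hu.heatOn le_rfl).nonneg_bd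
  set y : Eu n := x + r • ee ⟨0, hn⟩ with hy
  have hx' : 0 ≤ x ⟨0, hn⟩ := hx
  have hy0 : r ≤ y ⟨0, hn⟩ := by simp [hy]; exact hx
  have hyo : y ∈ openHalf n hn := hr.trans_le hy0
  have h1 : ∀ s, |u (y, s) - u (x, s)| ≤ M * r := by
    intro s
    refine (hu.lip y (hr.le.trans hy0) x hx s).trans (le_of_eq ?_)
    rw [hy, add_sub_cancel_left, norm_smul_ee, abs_of_pos hr]
  have h2 := Convex.norm_image_sub_le_of_norm_hasDerivWithin_le (f := fun s => u (y, s))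
    (f' := fun s => 0 + ∑ i, pd i (pd i u) (y, s)) (C := n * (M * (2 * n + 3) / (r / 4)))
    (s := univ) (x := t) (y := t')
    (fun s _ => (hu.heat y hyo s).time_deriv.hasDerivWithinAt)
    (fun s _ => by
      rw [zero_add]
      refine (norm_sum_le _ _).trans ?_
      refine (Finset.sum_le_sum (g := fun _ => M * (2 * n + 3) / (r / 4)) fun i _ => ?_).trans ?_
      · exact hu.abs_pd_pd_le i (by positivity) (by linarith) s
      · simp)
    convex_univ trivial trivial
  simp only [Real.norm_eq_abs] at h2
  have h3 : |u (y, t') - u (y, t)| ≤ 4 * n * (M * (2 * n + 3)) * r := by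
    refine h2.trans ((mul_le_mul_of_nonneg_left ht (by positivity)).trans (le_of_eq ?_))
    field_simp
  have a1 := abs_le.1 (h1 t)
  have a2 := abs_le.1 (h1 t')
  have a3 := abs_le.1 h3
  rw [abs_le]
  constructor <;> linarith [a1.1, a1.2, a2.1, a2.2, a3.1, a3.2]

end

end

section
open MeasureTheory

lemma setIntegral_Icc_eq_sub {f f' : ℝ → ℝ} {a b : ℝ} (hab : a ≤ b)
    (hd : ∀ x ∈ Icc a b, HasDerivAt f (f' x) x) (hc : ContinuousOn f' (Icc a b)) :
    ∫ x in Icc a b, f' x = f b - f a := by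
  rw [integral_Icc_eq_integral_Ioc, ← intervalIntegral.integral_of_le hab]
  refine intervalIntegral.integral_eq_sub_of_hasDerivAt (fun x hx => hd x (by rwa [uIcc_of_le hab] at hx)) ?_
  exact ContinuousOn.intervalIntegrable (by rwa [uIcc_of_le hab])

/-- Integration of a derivative in the first variable over a product set. -/
lemma setIntegral_prod_fst_deriv {Y : Type*} [TopologicalSpace Y] [MeasureSpace Y] [BorelSpace Y]
    [SecondCountableTopology Y] [T2Space Y] [IsFiniteMeasureOnCompacts (volume : Measure Y)]
    [SFinite (volume : Measure Y)] {S : Set Y} (hS : IsCompact S)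
    {f f' : ℝ × Y → ℝ} {a b : ℝ} (hab : a ≤ b)
    (hd : ∀ x ∈ Icc a b, ∀ y ∈ S, HasDerivAt (fun r => f (r, y)) (f' (x, y)) x)
    (hc : ContinuousOn f' (Icc a b ×ˢ S)) :
    ∫ p in Icc a b ×ˢ S, f' p = ∫ y in S, (f (b, y) - f (a, y)) := by
  rw [Measure.volume_eq_prod, ← setIntegral_prod_swap, setIntegral_prod]
  · refine setIntegral_congr_fun hS.measurableSet fun y hy => ?_
    exact setIntegral_Icc_eq_sub (f := fun r => f (r, y)) (f' := fun r => f' (r, y)) hab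
      (fun x hx => hd x hx y hy)
      (hc.comp (by fun_prop) fun x hx => ⟨hx, hy⟩)
  · refine ContinuousOn.integrableOn_compact (hS.prod isCompact_Icc) (f := fun z : Y × ℝ => f' z.swap)
      (hc.comp (by fun_prop) ?_)
    rintro ⟨y, x⟩ ⟨hy, hx⟩
    exact ⟨hx, hy⟩

/-- A divergence inequality on a space-time box. -/
lemma divergence_inequality {X a b t1 t2 c : ℝ} (hX : 0 ≤ X) (hab : a ≤ b) (ht : t1 ≤ t2)
    {T F G T' F' G' H : ℝ × ℝ × ℝ → ℝ}
    (hT : ∀ x ∈ Icc 0 X, ∀ s ∈ Icc a b, ∀ t ∈ Icc t1 t2,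
      HasDerivAt (fun r => T (x, s, r)) (T' (x, s, t)) t)
    (hF : ∀ x ∈ Icc 0 X, ∀ s ∈ Icc a b, ∀ t ∈ Icc t1 t2,
      HasDerivAt (fun r => F (r, s, t)) (F' (x, s, t)) x)
    (hG : ∀ x ∈ Icc 0 X, ∀ s ∈ Icc a b, ∀ t ∈ Icc t1 t2,
      HasDerivAt (fun r => G (x, r, t)) (G' (x, s, t)) s)
    (cT : ContinuousOn T' (Icc 0 X ×ˢ Icc a b ×ˢ Icc t1 t2))
    (cF : ContinuousOn F' (Icc 0 X ×ˢ Icc a b ×ˢ Icc t1 t2))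
    (cG : ContinuousOn G' (Icc 0 X ×ˢ Icc a b ×ˢ Icc t1 t2))
    (cH : ContinuousOn H (Icc 0 X ×ˢ Icc a b ×ˢ Icc t1 t2))
    (hTc : ∀ x ∈ Icc 0 X, ∀ s ∈ Icc a b, -c ≤ T (x, s, t2) - T (x, s, t1))
    (hF0 : ∀ s ∈ Icc a b, ∀ t ∈ Icc t1 t2, F (X, s, t) = 0)
    (hG0 : ∀ x ∈ Icc 0 X, ∀ t ∈ Icc t1 t2, G (x, a, t) = 0 ∧ G (x, b, t) = 0)
    (hH : ∀ x ∈ Icc 0 X, ∀ s ∈ Icc a b, ∀ t ∈ Icc t1 t2,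
      T' (x, s, t) + F' (x, s, t) + G' (x, s, t) ≤ H (x, s, t)) :
    ∫ z in Icc a b ×ˢ Icc t1 t2, -F (0, z.1, z.2) ≤
      (∫ p in Icc 0 X ×ˢ Icc a b ×ˢ Icc t1 t2, H p) + c * (X * (b - a)) := by
  set Q : Set (ℝ × ℝ × ℝ) := Icc 0 X ×ˢ Icc a b ×ˢ Icc t1 t2 with hQ
  have hS : IsCompact (Icc a b ×ˢ Icc t1 t2) := isCompact_Icc.prod isCompact_Icc
  have hQc : IsCompact Q := isCompact_Icc.prod hS
  have iT : IntegrableOn T' Q := cT.integrableOn_compact hQc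
  have iF : IntegrableOn F' Q := cF.integrableOn_compact hQc
  have iG : IntegrableOn G' Q := cG.integrableOn_compact hQc
  have eF : ∫ p in Q, F' p = ∫ z in Icc a b ×ˢ Icc t1 t2, -F (0, z.1, z.2) := by
    rw [hQ, setIntegral_prod_fst_deriv hS hX (f := F) (fun x hx y hy => hF x hx y.1 hy.1 y.2 hy.2) cF]
    refine setIntegral_congr_fun hS.measurableSet fun z hz => ?_
    rw [show (X, z) = (X, z.1, z.2) from rfl, hF0 z.1 hz.1 z.2 hz.2, zero_sub]
  have eG : ∫ p in Q, G' p = 0 := by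
    rw [hQ, Measure.volume_eq_prod, setIntegral_prod _ iG]
    refine setIntegral_eq_zero_of_forall_eq_zero fun x hx => ?_
    rw [setIntegral_prod_fst_deriv isCompact_Icc hab (f := fun z => G (x, z.1, z.2))
      (f' := fun z => G' (x, z))
      (fun s hs t ht => hG x hx s hs t ht) (cG.comp (by fun_prop) fun z hz => ⟨hx, hz⟩)]
    refine setIntegral_eq_zero_of_forall_eq_zero fun t ht => ?_
    simp [hG0 x hx t ht]
  have eT : -(c * (X * (b - a))) ≤ ∫ p in Q, T' p := by
    rw [hQ, Measure.volume_eq_prod, setIntegral_prod _ iT]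
    have hin : ∀ x ∈ Icc 0 X, -c * (b - a) ≤ ∫ z in Icc a b ×ˢ Icc t1 t2, T' (x, z) := by
      intro x hx
      have cTx : ContinuousOn (fun z => T' (x, z)) (Icc a b ×ˢ Icc t1 t2) :=
        cT.comp (by fun_prop) fun z hz => ⟨hx, hz⟩
      have iTx : IntegrableOn (fun z => T' (x, z)) (Icc a b ×ˢ Icc t1 t2) :=
        cTx.integrableOn_compact hS
      have iTx' := iTx
      rw [IntegrableOn, Measure.volume_eq_prod, ← Measure.prod_restrict] at iTx'
      rw [Measure.volume_eq_prod, setIntegral_prod _ iTx]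
      calc -c * (b - a) = ∫ s in Icc a b, -c := by
            simp [Measure.real, ENNReal.toReal_ofReal (sub_nonneg.2 hab)]; ring
        _ ≤ _ := by
            refine setIntegral_mono_on (integrableOn_const (by simp) enorm_ne_top)
              iTx'.integral_prod_left measurableSet_Icc fun s hs => ?_
            rw [setIntegral_Icc_eq_sub (f := fun r => T (x, s, r)) ht (fun t h => hT x hx s hs t h)
              (cTx.comp (f := fun t => (s, t)) (by fun_prop) fun t h => ⟨hs, h⟩)]
            exact hTc x hx s hs
    have iT' := iT
    rw [IntegrableOn, hQ, Measure.volume_eq_prod, ← Measure.prod_restrict] at iT'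
    calc -(c * (X * (b - a))) = ∫ x in Icc 0 X, -c * (b - a) := by
          simp [Measure.real, ENNReal.toReal_ofReal hX]; ring
      _ ≤ _ := setIntegral_mono_on (integrableOn_const (by simp) enorm_ne_top)
        iT'.integral_prod_left measurableSet_Icc hin
  have h1 : ∫ p in Q, (T' p + F' p + G' p) ≤ ∫ p in Q, H p :=
    setIntegral_mono_on ((iT.add iF).add iG) (cH.integrableOn_compact hQc) hQc.measurableSet
      fun p hp => hH p.1 hp.1 p.2.1 hp.2.1 p.2.2 hp.2.2
  have h2 : ∫ p in Q, (T' p + F' p + G' p) =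
      (∫ p in Q, T' p) + (∫ p in Q, F' p) + ∫ p in Q, G' p := by
    rw [← integral_add iT iF]
    exact integral_add (iT.add iF) iG
  rw [h2, eF, eG] at h1
  linarith

end

section
open MeasureTheory Real

/-- The weight making `∂ₛ² + (m / s) ∂ₛ` symmetric. -/
noncomputable def wgt (m : ℕ) (ρ s : ℝ) : ℝ := (s / ρ) ^ m

lemma hasDerivAt_wgt {m : ℕ} {ρ s : ℝ} (hs : 0 < s) :
    HasDerivAt (wgt m ρ) (m / s * wgt m ρ s) s := by
  have := ((hasDerivAt_id s).div_const ρ).pow m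
  refine this.congr_deriv ?_
  rcases m with _ | m
  · simp [wgt]
  · simp only [wgt, id, Nat.add_sub_cancel, pow_succ (s / ρ) m]
    field_simp

lemma continuous_wgt (m : ℕ) (ρ : ℝ) : Continuous (wgt m ρ) := by
  unfold wgt; fun_prop

lemma wgt_le {m : ℕ} {ρ s : ℝ} (hρ : 4 ≤ ρ) (hs : s ∈ Icc (ρ - 1) (ρ + 1)) :
    wgt m ρ s ≤ (5 / 4) ^ m := by
  have : 0 < ρ := by linarith
  obtain ⟨h1, h2⟩ := hs
  refine pow_le_pow_left₀ (div_nonneg (by linarith) this.le) ?_ m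
  rw [div_le_iff₀ this]; linarith

lemma le_wgt {m : ℕ} {ρ s : ℝ} (hρ : 4 ≤ ρ) (hs : s ∈ Icc (ρ - 1) (ρ + 1)) :
    (3 / 4) ^ m ≤ wgt m ρ s := by
  have : 0 < ρ := by linarith
  obtain ⟨h1, h2⟩ := hs
  refine pow_le_pow_left₀ (by norm_num) ?_ m
  rw [le_div_iff₀ this]; linarith

/-- A positive solution of `∂ₜw = ∂ₓ²w + ∂ₛ²w + (m / s) ∂ₛw` near the boundary point `(0, ρ)` of
the half plane, bounded by `B`, whose flux through `x = 0` is at least `w ^ q`. -/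
structure Flat (m : ℕ) (ρ q B : ℝ) where
  w : ℝ × ℝ × ℝ → ℝ
  wx : ℝ × ℝ × ℝ → ℝ
  ws : ℝ × ℝ × ℝ → ℝ
  wxx : ℝ × ℝ × ℝ → ℝ
  wss : ℝ × ℝ × ℝ → ℝ
  wt : ℝ × ℝ × ℝ → ℝ
  wxt : ℝ × ℝ × ℝ → ℝ
  wst : ℝ × ℝ × ℝ → ℝ
  cw : ContinuousOn w (Icc 0 1 ×ˢ Icc (ρ - 1) (ρ + 1) ×ˢ univ)
  cwx : ContinuousOn wx (Icc 0 1 ×ˢ Icc (ρ - 1) (ρ + 1) ×ˢ univ)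
  cws : ContinuousOn ws (Icc 0 1 ×ˢ Icc (ρ - 1) (ρ + 1) ×ˢ univ)
  cwxx : ContinuousOn wxx (Icc 0 1 ×ˢ Icc (ρ - 1) (ρ + 1) ×ˢ univ)
  cwt : ContinuousOn wt (Icc 0 1 ×ˢ Icc (ρ - 1) (ρ + 1) ×ˢ univ)
  cwxt : ContinuousOn wxt (Icc 0 1 ×ˢ Icc (ρ - 1) (ρ + 1) ×ˢ univ)
  cwst : ContinuousOn wst (Icc 0 1 ×ˢ Icc (ρ - 1) (ρ + 1) ×ˢ univ)
  dx : ∀ x ∈ Icc (0:ℝ) 1, ∀ s ∈ Icc (ρ - 1) (ρ + 1), ∀ t,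
    HasDerivAt (fun r => w (r, s, t)) (wx (x, s, t)) x
  ds : ∀ x ∈ Icc (0:ℝ) 1, ∀ s ∈ Icc (ρ - 1) (ρ + 1), ∀ t,
    HasDerivAt (fun r => w (x, r, t)) (ws (x, s, t)) s
  dt : ∀ x ∈ Icc (0:ℝ) 1, ∀ s ∈ Icc (ρ - 1) (ρ + 1), ∀ t,
    HasDerivAt (fun r => w (x, s, r)) (wt (x, s, t)) t
  dxx : ∀ x ∈ Icc (0:ℝ) 1, ∀ s ∈ Icc (ρ - 1) (ρ + 1), ∀ t,
    HasDerivAt (fun r => wx (r, s, t)) (wxx (x, s, t)) x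
  dss : ∀ x ∈ Icc (0:ℝ) 1, ∀ s ∈ Icc (ρ - 1) (ρ + 1), ∀ t,
    HasDerivAt (fun r => ws (x, r, t)) (wss (x, s, t)) s
  dxt : ∀ x ∈ Icc (0:ℝ) 1, ∀ s ∈ Icc (ρ - 1) (ρ + 1), ∀ t,
    HasDerivAt (fun r => wx (x, s, r)) (wxt (x, s, t)) t
  dst : ∀ x ∈ Icc (0:ℝ) 1, ∀ s ∈ Icc (ρ - 1) (ρ + 1), ∀ t,
    HasDerivAt (fun r => ws (x, s, r)) (wst (x, s, t)) t
  dtx : ∀ x ∈ Icc (0:ℝ) 1, ∀ s ∈ Icc (ρ - 1) (ρ + 1), ∀ t,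
    HasDerivAt (fun r => wt (r, s, t)) (wxt (x, s, t)) x
  dts : ∀ x ∈ Icc (0:ℝ) 1, ∀ s ∈ Icc (ρ - 1) (ρ + 1), ∀ t,
    HasDerivAt (fun r => wt (x, r, t)) (wst (x, s, t)) s
  eq : ∀ x ∈ Icc (0:ℝ) 1, ∀ s ∈ Icc (ρ - 1) (ρ + 1), ∀ t,
    wt (x, s, t) = wxx (x, s, t) + wss (x, s, t) + m / s * ws (x, s, t)
  pos : ∀ x ∈ Icc (0:ℝ) 1, ∀ s ∈ Icc (ρ - 1) (ρ + 1), ∀ t, 0 < w (x, s, t)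
  le : ∀ x ∈ Icc (0:ℝ) 1, ∀ s ∈ Icc (ρ - 1) (ρ + 1), ∀ t, w (x, s, t) ≤ B
  flux : ∀ s ∈ Icc (ρ - 1) (ρ + 1), ∀ t, w (0, s, t) ^ q ≤ -wx (0, s, t)

namespace Flat

variable {m : ℕ} {ρ q B : ℝ}

/-- The derivative in the definition of `Flat` after multiplication by the weight. -/
lemma hasDerivAt_wgt_ws (F : Flat m ρ q B) (hρ : 4 ≤ ρ) {x s : ℝ} (hx : x ∈ Icc (0:ℝ) 1)
    (hs : s ∈ Icc (ρ - 1) (ρ + 1)) (t : ℝ) :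
    HasDerivAt (fun r => wgt m ρ r * F.ws (x, r, t))
      (wgt m ρ s * (F.wt (x, s, t) - F.wxx (x, s, t))) s := by
  have hs0 : 0 < s := by linarith [hs.1]
  refine ((hasDerivAt_wgt (m := m) (ρ := ρ) hs0).mul (F.dss x hx s hs t)).congr_deriv ?_
  rw [F.eq x hx s hs t]
  ring

lemma B_pos (F : Flat m ρ q B) : 0 < B :=
  (F.pos 0 (by simp) ρ (by simp) 0).trans_le (F.le 0 (by simp) ρ (by simp) 0)

end Flat

lemma setIntegral_exp_neg {a b t1 t2 : ℝ} (hab : a ≤ b) (ht : t1 ≤ t2) (K : ℝ) :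
    ∫ z in Icc a b ×ˢ Icc t1 t2, K * exp (-z.2) = K * (exp (-t1) - exp (-t2)) * (b - a) := by
  rw [Measure.volume_eq_prod, setIntegral_prod]
  · have : ∀ s : ℝ, ∫ t in Icc t1 t2, K * exp (-t) = K * (exp (-t1) - exp (-t2)) := fun s => by
      rw [setIntegral_Icc_eq_sub (f := fun t => -(K * exp (-t))) ht]
      · ring
      · intro t _
        refine (((hasDerivAt_neg t).exp.const_mul K).neg).congr_deriv (by ring)
      · fun_prop
    simp only [this 0]
    simp [Measure.real, ENNReal.toReal_ofReal (sub_nonneg.2 hab)]; ring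
  · exact ContinuousOn.integrableOn_compact (isCompact_Icc.prod isCompact_Icc) (by fun_prop)

lemma young_flux {q X w : ℝ} (hq : 1 < q) (hX : 0 < X) (hw : 0 < w) :
    2 * X * w ≤ 1 / 2 * X ^ 2 * w ^ q + 2 * X * (4 / X) ^ (1 / (q - 1)) := by
  have hq' : 0 < q - 1 := by linarith
  have h0 : 0 < w ^ q := rpow_pos_of_pos hw q
  have h00 : 0 < (4 / X) ^ (1 / (q - 1)) := rpow_pos_of_pos (by positivity) _
  rcases le_total w ((4 / X) ^ (1 / (q - 1))) with h | h
  · have : 2 * X * w ≤ 2 * X * (4 / X) ^ (1 / (q - 1)) := by gcongr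
    have : 0 ≤ 1 / 2 * X ^ 2 * w ^ q := by positivity
    linarith
  · have h1 : 4 / X ≤ w ^ (q - 1) := by
      calc 4 / X = ((4 / X) ^ (1 / (q - 1))) ^ (q - 1) := by
            rw [← rpow_mul (by positivity), one_div_mul_cancel hq'.ne', rpow_one]
        _ ≤ _ := by gcongr
    have h2 : w ^ q = w ^ (q - 1) * w := by
      rw [← rpow_add_one hw.ne']; congr 1; ring
    have h3 : 2 * X * w ≤ 1 / 2 * X ^ 2 * w ^ q := by
      rw [h2]
      calc 2 * X * w = 1 / 2 * X ^ 2 * (4 / X * w) := by field_simp; norm_num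
        _ ≤ _ := by gcongr
    have : 0 ≤ 2 * X * (4 / X) ^ (1 / (q - 1)) := by positivity
    linarith

/-- The bump `(1 - σ²)²` is a subsolution up to a multiple of itself. -/
lemma bump_ineq (m : ℕ) {ρ s : ℝ} (hρ : 4 ≤ ρ) (hs : s ∈ Icc (ρ - 1) (ρ + 1)) :
    -((12 + 4 * m / 3) ^ 2 / 32) * (1 - (s - ρ) ^ 2) ^ 2 ≤
      (12 * (s - ρ) ^ 2 - 4) + m / s * (-4 * (s - ρ) * (1 - (s - ρ) ^ 2)) := by
  obtain ⟨h1, h2⟩ := hs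
  have hs0 : 3 ≤ s := by linarith
  set y := 1 - (s - ρ) ^ 2 with hy
  have hy0 : 0 ≤ y := by rw [hy]; nlinarith
  have hm : (m : ℝ) / s ≤ m / 3 := by gcongr
  have hm0 : (0:ℝ) ≤ m / s := by positivity
  have h3 : -(4 * m / 3) * y ≤ m / s * (-4 * (s - ρ) * y) := by
    have : (m : ℝ) / s * ((s - ρ) * y) ≤ m / 3 * (1 * y) := by
      calc (m : ℝ) / s * ((s - ρ) * y) ≤ m / s * (1 * y) := by gcongr; linarith
        _ ≤ _ := by gcongr
    nlinarith
  have h4 : (s - ρ) ^ 2 = 1 - y := by rw [hy]; ring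
  rw [h4]
  nlinarith [sq_nonneg ((12 + 4 * m / 3) * y - 16)]

end

section
open MeasureTheory Real

lemma box_subset {ρ X a b t1 t2 : ℝ} (hX : X ≤ 1) (ha : ρ - 1 ≤ a) (hb : b ≤ ρ + 1) :
    Icc 0 X ×ˢ Icc a b ×ˢ Icc t1 t2 ⊆ Icc (0:ℝ) 1 ×ˢ Icc (ρ - 1) (ρ + 1) ×ˢ univ :=
  prod_mono (Icc_subset_Icc_right hX) (prod_mono (Icc_subset_Icc ha hb) (subset_univ _))

lemma ContinuousOn.trace_zero {f : ℝ × ℝ × ℝ → ℝ} {ρ a b t1 t2 : ℝ}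
    (h : ContinuousOn f (Icc (0:ℝ) 1 ×ˢ Icc (ρ - 1) (ρ + 1) ×ˢ univ))
    (ha : ρ - 1 ≤ a) (hb : b ≤ ρ + 1) :
    ContinuousOn (fun z : ℝ × ℝ => f (0, z.1, z.2)) (Icc a b ×ˢ Icc t1 t2) :=
  h.comp (by fun_prop) fun _ hz => ⟨by simp, ⟨ha.trans hz.1.1, hz.1.2.trans hb⟩, trivial⟩

lemma isCompact_box2 {a b t1 t2 : ℝ} : IsCompact (Icc a b ×ˢ Icc t1 t2) :=
  isCompact_Icc.prod isCompact_Icc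

lemma isCompact_box3 {X a b t1 t2 : ℝ} : IsCompact (Icc (0:ℝ) X ×ˢ Icc a b ×ˢ Icc t1 t2) :=
  isCompact_Icc.prod isCompact_box2

namespace Flat

variable {m : ℕ} {ρ q B : ℝ}

lemma mass_aux (F : Flat m ρ q B) (hq : 1 < q) (hρ : 4 ≤ ρ) {X : ℝ} (hX0 : 0 < X) (hX1 : X ≤ 1)
    (hXm : X ^ 2 * (2 + (12 + 4 * m / 3) ^ 2 / 32) ≤ 2) {τ : ℝ} (hτ : 2 ≤ τ) :
    ∫ z in Icc (ρ - 1) (ρ + 1) ×ˢ Icc (-2) τ,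
        (1 / 2 * X ^ 2 * (exp (-z.2) * ((1 - (z.1 - ρ) ^ 2) ^ 2 * wgt m ρ z.1 *
          -F.wx (0, z.1, z.2))) -
        2 * X * (4 / X) ^ (1 / (q - 1)) * (5 / 4) ^ m * exp (-z.2)) ≤
      (∫ p in Icc 0 X ×ˢ Icc (ρ - 1) (ρ + 1) ×ˢ Icc (-2) τ, -(exp (-p.2.2) *
        ((X - p.1) ^ 2 * (1 - (p.2.1 - ρ) ^ 2) ^ 2 * wgt m ρ p.2.1 * F.w p))) +
      exp (-τ) * (5 / 4) ^ m * B * (X * ((ρ + 1) - (ρ - 1))) := by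
  have hsub := box_subset (ρ := ρ) (t1 := -2) (t2 := τ) hX1 (le_refl (ρ - 1)) (le_refl (ρ + 1))
  have cw := F.cw.mono hsub
  have cwx := F.cwx.mono hsub
  have cws := F.cws.mono hsub
  have cwxx := F.cwxx.mono hsub
  have cwt := F.cwt.mono hsub
  have cg := F.cwx.trace_zero (t1 := -2) (t2 := τ) (le_refl (ρ - 1)) (le_refl (ρ + 1))
  have cP := continuous_wgt m ρ
  have hx1 : ∀ x ∈ Icc 0 X, x ∈ Icc (0:ℝ) 1 := fun x hx => ⟨hx.1, hx.2.trans hX1⟩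
  refine le_trans ?_ (divergence_inequality (X := X) (a := ρ - 1) (b := ρ + 1) (t1 := -2) (t2 := τ)
    (T := fun p => -(exp (-p.2.2) * ((X - p.1) ^ 2 * (1 - (p.2.1 - ρ) ^ 2) ^ 2 * wgt m ρ p.2.1 *
      F.w p)))
    (F := fun p => exp (-p.2.2) * (1 - (p.2.1 - ρ) ^ 2) ^ 2 * wgt m ρ p.2.1 *
      ((X - p.1) ^ 2 * F.wx p + 2 * (X - p.1) * F.w p))
    (G := fun p => exp (-p.2.2) * (X - p.1) ^ 2 * ((1 - (p.2.1 - ρ) ^ 2) ^ 2 *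
      (wgt m ρ p.2.1 * F.ws p) - (-4 * (p.2.1 - ρ) * (1 - (p.2.1 - ρ) ^ 2)) * (wgt m ρ p.2.1 * F.w p)))
    (T' := fun p => exp (-p.2.2) * ((X - p.1) ^ 2 * (1 - (p.2.1 - ρ) ^ 2) ^ 2 * wgt m ρ p.2.1) *
      (F.w p - F.wt p))
    (F' := fun p => exp (-p.2.2) * (1 - (p.2.1 - ρ) ^ 2) ^ 2 * wgt m ρ p.2.1 *
      ((X - p.1) ^ 2 * F.wxx p - 2 * F.w p))
    (G' := fun p => exp (-p.2.2) * (X - p.1) ^ 2 * ((1 - (p.2.1 - ρ) ^ 2) ^ 2 *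
      (wgt m ρ p.2.1 * (F.wt p - F.wxx p)) - wgt m ρ p.2.1 * F.w p *
        ((12 * (p.2.1 - ρ) ^ 2 - 4) + m / p.2.1 * (-4 * (p.2.1 - ρ) * (1 - (p.2.1 - ρ) ^ 2)))))
    hX0.le (by linarith) (by linarith)
    ?_ ?_ ?_ ?_ ?_ ?_ ?_ ?_ ?_ ?_ ?_)
  · refine setIntegral_mono_on ?_ ?_ isCompact_box2.measurableSet fun z hz => ?_
    · exact ContinuousOn.integrableOn_compact isCompact_box2 (by fun_prop)
    · have cw0 := F.cw.trace_zero (t1 := -2) (t2 := τ) (le_refl (ρ - 1)) (le_refl (ρ + 1))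
      exact ContinuousOn.integrableOn_compact isCompact_box2 (by fun_prop)
    · obtain ⟨hs, -⟩ := hz
      have h1 := F.flux z.1 hs z.2
      have h2 := young_flux hq hX0 (F.pos 0 (by simp) z.1 hs z.2)
      have h3 := wgt_le (m := m) hρ hs
      have h4 : 0 < wgt m ρ z.1 := lt_of_lt_of_le (by positivity) (le_wgt hρ hs)
      have h5 : 0 < exp (-z.2) := exp_pos _
      have h6 : 0 ≤ (1 - (z.1 - ρ) ^ 2) ^ 2 := sq_nonneg _
      have h7 : (1 - (z.1 - ρ) ^ 2) ^ 2 ≤ 1 := by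
        have := hs.1; have := hs.2
        have : (z.1 - ρ) ^ 2 ≤ 1 := by nlinarith
        nlinarith [sq_nonneg (z.1 - ρ)]
      set c0 := (4 / X) ^ (1 / (q - 1))
      have hc0 : 0 < c0 := rpow_pos_of_pos (by positivity) _
      have h8 : (1 - (z.1 - ρ) ^ 2) ^ 2 * wgt m ρ z.1 ≤ 1 * (5 / 4) ^ m := by gcongr
      have h9 : 2 * X * F.w (0, z.1, z.2) ≤ 1 / 2 * X ^ 2 * -F.wx (0, z.1, z.2) + 2 * X * c0 := by
        have : 1 / 2 * X ^ 2 * F.w (0, z.1, z.2) ^ q ≤ 1 / 2 * X ^ 2 * -F.wx (0, z.1, z.2) := by gcongr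
        linarith
      have h10 := mul_le_mul_of_nonneg_left h9
        (by positivity : 0 ≤ exp (-z.2) * ((1 - (z.1 - ρ) ^ 2) ^ 2 * wgt m ρ z.1))
      have h11 := mul_le_mul_of_nonneg_left h8 (by positivity : 0 ≤ exp (-z.2) * (2 * X * c0))
      simp only [sub_zero]
      nlinarith
  · intro x hx s hs t _
    refine (((hasDerivAt_neg t).exp.mul ((F.dt x (hx1 x hx) s hs t).const_mul
      ((X - x) ^ 2 * (1 - (s - ρ) ^ 2) ^ 2 * wgt m ρ s))).neg).congr_deriv ?_
    ring
  · intro x hx s hs t _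
    have h1 : HasDerivAt (fun r => X - r) (-1) x := (hasDerivAt_id x).const_sub X
    refine ((((h1.fun_pow 2).fun_mul (F.dxx x (hx1 x hx) s hs t)).fun_add ((h1.const_mul 2).fun_mul
      (F.dx x (hx1 x hx) s hs t))).const_mul
        (exp (-t) * (1 - (s - ρ) ^ 2) ^ 2 * wgt m ρ s)).congr_deriv ?_
    simp only [Nat.cast_ofNat, Nat.add_one_sub_one, pow_one]
    ring
  · intro x hx s hs t _
    have hs0 : s ≠ 0 := by linarith [hs.1]
    have h1 : HasDerivAt (fun r => r - ρ) 1 s := (hasDerivAt_id s).sub_const ρ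
    have h2 := (h1.fun_pow 2).const_sub 1
    have h3 := (hasDerivAt_wgt (m := m) (ρ := ρ) (by linarith [hs.1] : 0 < s)).fun_mul
      (F.ds x (hx1 x hx) s hs t)
    refine ((((h2.fun_pow 2).fun_mul (F.hasDerivAt_wgt_ws hρ (hx1 x hx) hs t)).fun_sub
      (((h1.const_mul (-4)).fun_mul h2).fun_mul h3)).const_mul
        (exp (-t) * (X - x) ^ 2)).congr_deriv ?_
    simp only [Nat.cast_ofNat, Nat.add_one_sub_one, pow_one]
    ring
  · fun_prop
  · fun_prop
  · have : ∀ p ∈ Icc 0 X ×ˢ Icc (ρ - 1) (ρ + 1) ×ˢ Icc (-2) τ, p.2.1 ≠ (0:ℝ) := by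
      rintro ⟨x, s, t⟩ ⟨-, hs, -⟩
      have := hs.1
      simp only at this ⊢
      linarith
    fun_prop (disch := assumption)
  · fun_prop
  · intro x hx s hs
    have h1 := F.pos x (hx1 x hx) s hs τ
    have h2 := F.pos x (hx1 x hx) s hs (-2)
    have h3 := wgt_le (m := m) hρ hs
    have h4 : 0 < wgt m ρ s := lt_of_lt_of_le (by positivity) (le_wgt hρ hs)
    have h5 := F.le x (hx1 x hx) s hs τ
    have h6 : (1 - (s - ρ) ^ 2) ^ 2 ≤ 1 := by
      have := hs.1; have := hs.2
      have : (s - ρ) ^ 2 ≤ 1 := by nlinarith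
      nlinarith [sq_nonneg (s - ρ)]
    have h7 : (X - x) ^ 2 ≤ 1 := by
      have := hx.1; have := hx.2
      nlinarith
    have h8 : exp (-τ) * ((X - x) ^ 2 * (1 - (s - ρ) ^ 2) ^ 2 * wgt m ρ s * F.w (x, s, τ)) ≤
        exp (-τ) * (1 * 1 * (5 / 4) ^ m * B) := by gcongr
    have h9 : 0 ≤ exp (-(-2)) * ((X - x) ^ 2 * (1 - (s - ρ) ^ 2) ^ 2 * wgt m ρ s * F.w (x, s, -2)) := by
      positivity
    have h10 : exp (-τ) * (1 * 1 * (5 / 4) ^ m * B) = exp (-τ) * (5 / 4) ^ m * B := by ring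
    rw [h10] at h8
    simp only [sub_neg_eq_add]
    exact (neg_le_neg h8).trans (le_add_of_nonneg_right h9)
  · intro s hs t _
    simp
  · intro x hx t _
    simp
  · intro x hx s hs t _
    have h1 := F.pos x (hx1 x hx) s hs t
    have h4 : 0 < wgt m ρ s := lt_of_lt_of_le (by positivity) (le_wgt hρ hs)
    have h2 := bump_ineq m hρ hs
    set b := m / s * (-4 * (s - ρ) * (1 - (s - ρ) ^ 2))
    set y := (1 - (s - ρ) ^ 2) ^ 2
    have hy : 0 ≤ y := sq_nonneg _
    set c := (12 + 4 * (m:ℝ) / 3) ^ 2 / 32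
    have h7 : (X - x) ^ 2 ≤ X ^ 2 := by
      have := hx.1; have := hx.2
      nlinarith
    have hc : 0 ≤ c := by positivity
    have h8 : (X - x) ^ 2 * (2 + c) ≤ 2 := le_trans (by gcongr) hXm
    have h9 := mul_le_mul_of_nonneg_left h2 (sq_nonneg (X - x))
    have h10 := mul_le_mul_of_nonneg_right h8 hy
    have h11 : (X - x) ^ 2 * y * 2 - 2 * y - (X - x) ^ 2 * (12 * (s - ρ) ^ 2 - 4 + b) ≤ 0 := by
      nlinarith
    have h12 := mul_nonpos_of_nonneg_of_nonpos
      (by positivity : 0 ≤ exp (-t) * wgt m ρ s * F.w (x, s, t)) h11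
    simp only
    rw [← sub_nonpos]
    refine le_of_eq_of_le ?_ h12
    ring

end Flat
end

section
open MeasureTheory Real

namespace Flat

/-- Local mass and flux bounds, uniform in the upper bound `B` of the solution. -/
lemma mass (m : ℕ) {q : ℝ} (hq : 1 < q) {X : ℝ} (hX0 : 0 < X) (hX1 : X ≤ 1)
    (hXm : X ^ 2 * (2 + (12 + 4 * m / 3) ^ 2 / 32) ≤ 2) :
    ∃ C > 0, ∀ ρ B : ℝ, 4 ≤ ρ → ∀ F : Flat m ρ q B,
      (∫ z in Icc (ρ - 1) (ρ + 1) ×ˢ Icc (-2) 2,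
        (1 - (z.1 - ρ) ^ 2) ^ 2 * wgt m ρ z.1 * -F.wx (0, z.1, z.2)) ≤ C ∧
      (∫ p in Icc 0 X ×ˢ Icc (ρ - 1) (ρ + 1) ×ˢ Icc (-2) 2,
        (X - p.1) ^ 2 * (1 - (p.2.1 - ρ) ^ 2) ^ 2 * wgt m ρ p.2.1 * F.w p) ≤ C := by
  set c0 := 2 * X * (4 / X) ^ (1 / (q - 1)) * (5 / 4) ^ m with hc0
  have hc0' : 0 < c0 := by
    have : 0 < (4 / X) ^ (1 / (q - 1)) := rpow_pos_of_pos (by positivity) _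
    positivity
  set c1 := 2 * c0 * exp 2 + 2 * (5 / 4) ^ m with hc1
  have hc1' : 0 < c1 := by positivity
  refine ⟨exp 2 * c1 * (1 + 2 / X ^ 2), by positivity, fun ρ B hρ F => ?_⟩
  have hB := F.B_pos
  have key := F.mass_aux hq hρ hX0 hX1 hXm (τ := 2 + B) (by linarith)
  rw [← hc0] at key
  have hsub := box_subset (ρ := ρ) (t1 := -2) (t2 := 2 + B) hX1 (le_refl (ρ - 1)) (le_refl (ρ + 1))
  have cw := F.cw.mono hsub
  have cg := F.cwx.trace_zero (t1 := -2) (t2 := 2 + B) (le_refl (ρ - 1)) (le_refl (ρ + 1))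
  have cP := continuous_wgt m ρ
  have hP : ∀ s ∈ Icc (ρ - 1) (ρ + 1), 0 < wgt m ρ s :=
    fun s hs => lt_of_lt_of_le (by positivity) (le_wgt hρ hs)
  have hg : ∀ s ∈ Icc (ρ - 1) (ρ + 1), ∀ t, 0 ≤ -F.wx (0, s, t) := fun s hs t =>
    (rpow_nonneg (F.pos 0 (by simp) s hs t).le q).trans (F.flux s hs t)
  have i1 : IntegrableOn (fun z : ℝ × ℝ => exp (-z.2) * ((1 - (z.1 - ρ) ^ 2) ^ 2 * wgt m ρ z.1 *
      -F.wx (0, z.1, z.2))) (Icc (ρ - 1) (ρ + 1) ×ˢ Icc (-2) (2 + B)) :=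
    ContinuousOn.integrableOn_compact isCompact_box2 (by fun_prop)
  have i2 : IntegrableOn (fun p : ℝ × ℝ × ℝ => exp (-p.2.2) *
        ((X - p.1) ^ 2 * (1 - (p.2.1 - ρ) ^ 2) ^ 2 * wgt m ρ p.2.1 * F.w p))
        (Icc 0 X ×ˢ Icc (ρ - 1) (ρ + 1) ×ˢ Icc (-2) (2 + B)) :=
    ContinuousOn.integrableOn_compact isCompact_box3 (by fun_prop)
  rw [integral_sub (i1.const_mul _) (ContinuousOn.integrableOn_compact isCompact_box2 (by fun_prop)),
    setIntegral_exp_neg (by linarith) (by linarith), integral_const_mul, integral_neg] at key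
  have hs1 : Icc (ρ - 1) (ρ + 1) ×ˢ Icc (-2) 2 ⊆ Icc (ρ - 1) (ρ + 1) ×ˢ Icc (-2) (2 + B) :=
    prod_mono le_rfl (Icc_subset_Icc_right (by linarith))
  have hs2 : Icc 0 X ×ˢ Icc (ρ - 1) (ρ + 1) ×ˢ Icc (-2) 2 ⊆
      Icc 0 X ×ˢ Icc (ρ - 1) (ρ + 1) ×ˢ Icc (-2) (2 + B) := prod_mono le_rfl hs1
  have e2 : ∀ t : ℝ, t ≤ 2 → 1 ≤ exp 2 * exp (-t) := fun t ht => by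
    rw [← exp_add]; exact one_le_exp (by linarith)
  have b1 : (∫ z in Icc (ρ - 1) (ρ + 1) ×ˢ Icc (-2) 2,
        (1 - (z.1 - ρ) ^ 2) ^ 2 * wgt m ρ z.1 * -F.wx (0, z.1, z.2)) ≤
      exp 2 * ∫ z in Icc (ρ - 1) (ρ + 1) ×ˢ Icc (-2) (2 + B), exp (-z.2) *
        ((1 - (z.1 - ρ) ^ 2) ^ 2 * wgt m ρ z.1 * -F.wx (0, z.1, z.2)) := by
    rw [← integral_const_mul]
    refine (setIntegral_mono_on ?_ (IntegrableOn.mono_set (i1.const_mul (exp 2)) hs1)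
      isCompact_box2.measurableSet fun z hz => ?_).trans
      (setIntegral_mono_set (i1.const_mul _) ?_ hs1.eventuallyLE)
    · have cg := cg.mono hs1
      exact ContinuousOn.integrableOn_compact isCompact_box2 (by fun_prop)
    · have h1 := hP z.1 hz.1
      have h2 := hg z.1 hz.1 z.2
      rw [← mul_assoc]
      exact le_mul_of_one_le_left (by positivity) (e2 _ hz.2.2)
    · refine (ae_restrict_iff' isCompact_box2.measurableSet).2 (ae_of_all _ fun z hz => ?_)
      have h1 := hP z.1 hz.1
      have h2 := hg z.1 hz.1 z.2
      simp only [Pi.zero_apply]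
      positivity
  have b2 : (∫ p in Icc 0 X ×ˢ Icc (ρ - 1) (ρ + 1) ×ˢ Icc (-2) 2,
        (X - p.1) ^ 2 * (1 - (p.2.1 - ρ) ^ 2) ^ 2 * wgt m ρ p.2.1 * F.w p) ≤
      exp 2 * ∫ p in Icc 0 X ×ˢ Icc (ρ - 1) (ρ + 1) ×ˢ Icc (-2) (2 + B), exp (-p.2.2) *
        ((X - p.1) ^ 2 * (1 - (p.2.1 - ρ) ^ 2) ^ 2 * wgt m ρ p.2.1 * F.w p) := by
    rw [← integral_const_mul]
    refine (setIntegral_mono_on ?_ (IntegrableOn.mono_set (i2.const_mul (exp 2)) hs2)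
      isCompact_box3.measurableSet fun z hz => ?_).trans
      (setIntegral_mono_set (i2.const_mul _) ?_ hs2.eventuallyLE)
    · have cw := cw.mono hs2
      exact ContinuousOn.integrableOn_compact isCompact_box3 (by fun_prop)
    · have h1 := hP z.2.1 hz.2.1
      have h2 := F.pos z.1 (hsub (hs2 hz)).1 z.2.1 hz.2.1 z.2.2
      rw [← mul_assoc]
      exact le_mul_of_one_le_left (by positivity) (e2 _ hz.2.2.2)
    · refine (ae_restrict_iff' isCompact_box3.measurableSet).2 (ae_of_all _ fun z hz => ?_)
      have h1 := hP z.2.1 hz.2.1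
      have h2 := F.pos z.1 (hsub hz).1 z.2.1 hz.2.1 z.2.2
      simp only [Pi.zero_apply]
      positivity
  have n1 : 0 ≤ ∫ z in Icc (ρ - 1) (ρ + 1) ×ˢ Icc (-2) (2 + B), exp (-z.2) *
        ((1 - (z.1 - ρ) ^ 2) ^ 2 * wgt m ρ z.1 * -F.wx (0, z.1, z.2)) := by
    refine setIntegral_nonneg isCompact_box2.measurableSet fun z hz => ?_
    have h1 := hP z.1 hz.1
    have h2 := hg z.1 hz.1 z.2
    positivity
  have n2 : 0 ≤ ∫ p in Icc 0 X ×ˢ Icc (ρ - 1) (ρ + 1) ×ˢ Icc (-2) (2 + B), exp (-p.2.2) *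
        ((X - p.1) ^ 2 * (1 - (p.2.1 - ρ) ^ 2) ^ 2 * wgt m ρ p.2.1 * F.w p) := by
    refine setIntegral_nonneg isCompact_box3.measurableSet fun z hz => ?_
    have h1 := hP z.2.1 hz.2.1
    have h2 := F.pos z.1 (hsub hz).1 z.2.1 hz.2.1 z.2.2
    positivity
  set I1 := ∫ z in Icc (ρ - 1) (ρ + 1) ×ˢ Icc (-2) (2 + B), exp (-z.2) *
        ((1 - (z.1 - ρ) ^ 2) ^ 2 * wgt m ρ z.1 * -F.wx (0, z.1, z.2))
  set I2 := ∫ p in Icc 0 X ×ˢ Icc (ρ - 1) (ρ + 1) ×ˢ Icc (-2) (2 + B), exp (-p.2.2) *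
        ((X - p.1) ^ 2 * (1 - (p.2.1 - ρ) ^ 2) ^ 2 * wgt m ρ p.2.1 * F.w p)
  have k1 : exp (-(2 + B)) * B ≤ 1 := by
    have : B ≤ exp (2 + B) := by linarith [add_one_le_exp (2 + B)]
    calc exp (-(2 + B)) * B ≤ exp (-(2 + B)) * exp (2 + B) := by gcongr
      _ = 1 := by rw [← exp_add]; simp
  have k2 : exp (-(2 + B)) * (5 / 4) ^ m * B * (X * ((ρ + 1) - (ρ - 1))) ≤ 2 * (5 / 4) ^ m := by
    have : exp (-(2 + B)) * B * X ≤ 1 * 1 := by gcongr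
    have h5 : (0:ℝ) < (5 / 4) ^ m := by positivity
    nlinarith
  have k3 : c0 * (exp (- -2) - exp (-(2 + B))) * ((ρ + 1) - (ρ - 1)) ≤ 2 * c0 * exp 2 := by
    rw [neg_neg]
    have : 0 ≤ c0 * exp (-(2 + B)) := by positivity
    nlinarith
  have k4 : 1 / 2 * X ^ 2 * I1 + I2 ≤ c1 := by
    generalize c0 * (exp (- -2) - exp (-(2 + B))) * ((ρ + 1) - (ρ - 1)) = a at key k3
    generalize exp (-(2 + B)) * (5 / 4) ^ m * B * (X * ((ρ + 1) - (ρ - 1))) = b at key k2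
    rw [hc1]
    linarith
  have k5 : I2 ≤ c1 := by
    have : 0 ≤ 1 / 2 * X ^ 2 * I1 := by positivity
    linarith
  have k6 : I1 ≤ c1 * (2 / X ^ 2) := by
    rw [← mul_div_assoc, le_div_iff₀ (by positivity)]
    linarith
  have k7 : 0 ≤ c1 * (2 / X ^ 2) := by positivity
  constructor
  · refine b1.trans ?_
    rw [mul_assoc]
    gcongr
    linarith
  · refine b2.trans ?_
    rw [mul_assoc]
    gcongr
    linarith

end Flat
end

section
open MeasureTheory Real

lemma integrableOn_box3 {f : ℝ × ℝ × ℝ → ℝ} {X a b t1 t2 : ℝ}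
    (hf : ContinuousOn f (Icc 0 X ×ˢ Icc a b ×ˢ Icc t1 t2)) :
    IntegrableOn f (Icc 0 X ×ˢ Icc a b ×ˢ Icc t1 t2) :=
  hf.integrableOn_compact isCompact_box3

lemma integrableOn_box2 {f : ℝ × ℝ → ℝ} {a b t1 t2 : ℝ}
    (hf : ContinuousOn f (Icc a b ×ˢ Icc t1 t2)) :
    IntegrableOn f (Icc a b ×ˢ Icc t1 t2) :=
  hf.integrableOn_compact isCompact_box2

/-- Monotonicity of the integral in both the domain and a nonnegative integrand. -/
lemma setIntegral_le_of_subset {Y : Type*} [MeasureSpace Y] {S S' : Set Y} {f : Y → ℝ}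
    (hS : MeasurableSet S') (h : S ⊆ S') (hf : IntegrableOn f S') (h0 : ∀ y ∈ S', 0 ≤ f y) :
    ∫ y in S, f y ≤ ∫ y in S', f y :=
  setIntegral_mono_set hf ((ae_restrict_iff' hS).2 (ae_of_all _ h0)) h.eventuallyLE

lemma hasDerivAt_cutoff_sq (κ ρ s : ℝ) :
    HasDerivAt (fun r => (κ - (r - ρ) ^ 2) ^ 2) (-4 * (s - ρ) * (κ - (s - ρ) ^ 2)) s := by
  have h1 : HasDerivAt (fun r => r - ρ) 1 s := (hasDerivAt_id s).sub_const ρ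
  refine (((h1.fun_pow 2).const_sub κ).fun_pow 2).congr_deriv ?_
  simp only [Nat.cast_ofNat, Nat.add_one_sub_one, pow_one]
  ring

lemma hasDerivAt_sub_sq (X x : ℝ) : HasDerivAt (fun r => (X - r) ^ 2) (-2 * (X - x)) x := by
  refine (((hasDerivAt_id' x).const_sub X).fun_pow 2).congr_deriv ?_
  simp only [Nat.cast_ofNat, Nat.add_one_sub_one, pow_one]
  ring

lemma hasDerivAt_time_sq (κ t : ℝ) :
    HasDerivAt (fun r => (κ - r ^ 2) ^ 2) (-4 * t * (κ - t ^ 2)) t := by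
  simpa using hasDerivAt_cutoff_sq κ 0 t

/-- `divergence_inequality` when the boundary terms in time have a favourable sign. -/
lemma divergence_inequality_zero {X a b t1 t2 : ℝ} (hX : 0 ≤ X) (hab : a ≤ b) (ht : t1 ≤ t2)
    {T F G T' F' G' H : ℝ × ℝ × ℝ → ℝ}
    (hT : ∀ x ∈ Icc 0 X, ∀ s ∈ Icc a b, ∀ t ∈ Icc t1 t2,
      HasDerivAt (fun r => T (x, s, r)) (T' (x, s, t)) t)
    (hF : ∀ x ∈ Icc 0 X, ∀ s ∈ Icc a b, ∀ t ∈ Icc t1 t2,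
      HasDerivAt (fun r => F (r, s, t)) (F' (x, s, t)) x)
    (hG : ∀ x ∈ Icc 0 X, ∀ s ∈ Icc a b, ∀ t ∈ Icc t1 t2,
      HasDerivAt (fun r => G (x, r, t)) (G' (x, s, t)) s)
    (cT : ContinuousOn T' (Icc 0 X ×ˢ Icc a b ×ˢ Icc t1 t2))
    (cF : ContinuousOn F' (Icc 0 X ×ˢ Icc a b ×ˢ Icc t1 t2))
    (cG : ContinuousOn G' (Icc 0 X ×ˢ Icc a b ×ˢ Icc t1 t2))
    (cH : ContinuousOn H (Icc 0 X ×ˢ Icc a b ×ˢ Icc t1 t2))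
    (hT0 : ∀ x ∈ Icc 0 X, ∀ s ∈ Icc a b, T (x, s, t1) ≤ T (x, s, t2))
    (hF0 : ∀ s ∈ Icc a b, ∀ t ∈ Icc t1 t2, F (X, s, t) = 0)
    (hG0 : ∀ x ∈ Icc 0 X, ∀ t ∈ Icc t1 t2, G (x, a, t) = 0 ∧ G (x, b, t) = 0)
    (hH : ∀ x ∈ Icc 0 X, ∀ s ∈ Icc a b, ∀ t ∈ Icc t1 t2,
      T' (x, s, t) + F' (x, s, t) + G' (x, s, t) ≤ H (x, s, t)) :
    ∫ z in Icc a b ×ˢ Icc t1 t2, -F (0, z.1, z.2) ≤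
      ∫ p in Icc 0 X ×ˢ Icc a b ×ˢ Icc t1 t2, H p := by
  refine (divergence_inequality (c := 0) hX hab ht hT hF hG cT cF cG cH (fun x hx s hs => ?_)
    hF0 hG0 hH).trans_eq (by rw [zero_mul, add_zero])
  rw [neg_zero]
  exact sub_nonneg.2 (hT0 x hx s hs)

lemma energy_pointwise (w a b y z e κ : ℝ) :
    -(a ^ 2 + b ^ 2) * (y ^ 2 * z ^ 2) - 2 * w * (a * (-y) * z ^ 2 + b * (-2 * e) * z * y ^ 2) +
      κ * w ^ 2 ≤
    -(1 / 2 * ((a ^ 2 + b ^ 2) * (y ^ 2 * z ^ 2))) +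
      (2 * (z ^ 2 + 4 * e ^ 2 * y ^ 2) + κ) * w ^ 2 := by
  nlinarith [sq_nonneg (a * y * z - 2 * w * z), sq_nonneg (b * y * z - 4 * w * e * y)]

namespace Flat

variable {m : ℕ} {ρ q B : ℝ}

set_option maxHeartbeats 1000000 in
lemma energy_aux (F : Flat m ρ q B) (hρ : 4 ≤ ρ) {X : ℝ} (hX0 : 0 < X) (hX1 : X ≤ 1) :
    ∫ z in Icc (ρ - 1 / 2) (ρ + 1 / 2) ×ˢ Icc (-2) 2,
        -(4 * B * ((1 - (z.1 - ρ) ^ 2) ^ 2 * wgt m ρ z.1 * -F.wx (0, z.1, z.2))) ≤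
      ∫ p in Icc 0 (X / 2) ×ˢ Icc (ρ - 1 / 2) (ρ + 1 / 2) ×ˢ Icc (-2) 2,
        (80 / X ^ 2 * B * ((X - p.1) ^ 2 * (1 - (p.2.1 - ρ) ^ 2) ^ 2 * wgt m ρ p.2.1 * F.w p)
        - 1 / 2 * ((F.wx p ^ 2 + F.ws p ^ 2) * ((X / 2 - p.1) ^ 2 * (1 / 4 - (p.2.1 - ρ) ^ 2) ^ 2 *
          (4 - p.2.2 ^ 2) ^ 2 * wgt m ρ p.2.1))) := by
  have hsub := box_subset (X := X / 2) (ρ := ρ) (t1 := -2) (t2 := 2) (by linarith)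
    (by linarith : ρ - 1 ≤ ρ - 1 / 2) (by linarith : ρ + 1 / 2 ≤ ρ + 1)
  have cw := F.cw.mono hsub
  have cwx := F.cwx.mono hsub
  have cws := F.cws.mono hsub
  have cwxx := F.cwxx.mono hsub
  have cwt := F.cwt.mono hsub
  have cg := F.cwx.trace_zero (t1 := -2) (t2 := 2)
    (by linarith : ρ - 1 ≤ ρ - 1 / 2) (by linarith : ρ + 1 / 2 ≤ ρ + 1)
  have cP := continuous_wgt m ρ
  have hx1 : ∀ x ∈ Icc 0 (X / 2), x ∈ Icc (0:ℝ) 1 := fun x hx => ⟨hx.1, hx.2.trans (by linarith)⟩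
  have hs1 : ∀ s ∈ Icc (ρ - 1 / 2) (ρ + 1 / 2), s ∈ Icc (ρ - 1) (ρ + 1) := fun s hs =>
    ⟨by linarith [hs.1], by linarith [hs.2]⟩
  have hP : ∀ s ∈ Icc (ρ - 1 / 2) (ρ + 1 / 2), 0 < wgt m ρ s :=
    fun s hs => lt_of_lt_of_le (by positivity) (le_wgt hρ (hs1 s hs))
  have hσ : ∀ s ∈ Icc (ρ - 1 / 2) (ρ + 1 / 2), (s - ρ) ^ 2 ≤ 1 / 4 := fun s hs => by
    nlinarith [hs.1, hs.2]
  have hB := F.B_pos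
  refine le_trans ?_ (divergence_inequality_zero (X := X / 2) (a := ρ - 1 / 2) (b := ρ + 1 / 2)
    (t1 := -2) (t2 := 2)
    (T := fun p => (4 - p.2.2 ^ 2) ^ 2 * (1 / 2 * F.w p ^ 2 * ((X / 2 - p.1) ^ 2 *
      (1 / 4 - (p.2.1 - ρ) ^ 2) ^ 2 * wgt m ρ p.2.1)))
    (F := fun p => -((X / 2 - p.1) ^ 2 * (F.w p * F.wx p) * ((1 / 4 - (p.2.1 - ρ) ^ 2) ^ 2 *
      (4 - p.2.2 ^ 2) ^ 2 * wgt m ρ p.2.1)))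
    (G := fun p => -((1 / 4 - (p.2.1 - ρ) ^ 2) ^ 2 * (F.w p * (wgt m ρ p.2.1 * F.ws p)) *
      ((X / 2 - p.1) ^ 2 * (4 - p.2.2 ^ 2) ^ 2)))
    (T' := fun p => (-4 * p.2.2 * (4 - p.2.2 ^ 2) * (1 / 2 * F.w p ^ 2) +
      (4 - p.2.2 ^ 2) ^ 2 * (F.w p * F.wt p)) * ((X / 2 - p.1) ^ 2 *
      (1 / 4 - (p.2.1 - ρ) ^ 2) ^ 2 * wgt m ρ p.2.1))
    (F' := fun p => -((-2 * (X / 2 - p.1) * (F.w p * F.wx p) + (X / 2 - p.1) ^ 2 *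
      (F.wx p ^ 2 + F.w p * F.wxx p)) * ((1 / 4 - (p.2.1 - ρ) ^ 2) ^ 2 *
      (4 - p.2.2 ^ 2) ^ 2 * wgt m ρ p.2.1)))
    (G' := fun p => -((-4 * (p.2.1 - ρ) * (1 / 4 - (p.2.1 - ρ) ^ 2) *
      (F.w p * (wgt m ρ p.2.1 * F.ws p)) + (1 / 4 - (p.2.1 - ρ) ^ 2) ^ 2 *
        (F.ws p * (wgt m ρ p.2.1 * F.ws p) + F.w p * (wgt m ρ p.2.1 * (F.wt p - F.wxx p)))) *
      ((X / 2 - p.1) ^ 2 * (4 - p.2.2 ^ 2) ^ 2)))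
    (by linarith) (by linarith) (by linarith)
    ?_ ?_ ?_ ?_ ?_ ?_ ?_ ?_ ?_ ?_ ?_)
  · refine setIntegral_mono_on ?_ ?_ isCompact_box2.measurableSet fun z hz => ?_
    · exact integrableOn_box2 (by fun_prop)
    · have cw0 := F.cw.trace_zero (t1 := -2) (t2 := 2)
        (by linarith : ρ - 1 ≤ ρ - 1 / 2) (by linarith : ρ + 1 / 2 ≤ ρ + 1)
      exact integrableOn_box2 (by fun_prop)
    · obtain ⟨hs, ht⟩ := hz
      have h1 := (rpow_nonneg (F.pos 0 (by simp) z.1 (hs1 _ hs) z.2).le q).trans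
        (F.flux z.1 (hs1 _ hs) z.2)
      have h2 := F.pos 0 (by simp) z.1 (hs1 _ hs) z.2
      have h3 := F.le 0 (by simp) z.1 (hs1 _ hs) z.2
      have h4 := hP _ hs
      have h5 := hσ _ hs
      have h6 : (1 / 4 - (z.1 - ρ) ^ 2) ^ 2 ≤ (1 - (z.1 - ρ) ^ 2) ^ 2 :=
        pow_le_pow_left₀ (by linarith) (by linarith) 2
      have h7 : (4 - z.2 ^ 2) ^ 2 ≤ 16 := by
        have : z.2 ^ 2 ≤ 4 := by nlinarith [ht.1, ht.2]
        nlinarith [sq_nonneg z.2]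
      have h8 : (X / 2) ^ 2 ≤ 1 / 4 := by nlinarith
      have h9 : (X / 2) ^ 2 * (F.w (0, z.1, z.2) * -F.wx (0, z.1, z.2)) *
          ((1 / 4 - (z.1 - ρ) ^ 2) ^ 2 * (4 - z.2 ^ 2) ^ 2 * wgt m ρ z.1) ≤
          1 / 4 * (B * -F.wx (0, z.1, z.2)) * ((1 - (z.1 - ρ) ^ 2) ^ 2 * 16 * wgt m ρ z.1) := by
        gcongr
      simp only [sub_zero]
      linarith
  · intro x hx s hs t _
    refine ((hasDerivAt_time_sq 4 t).fun_mul ((((F.dt x (hx1 x hx) s (hs1 s hs) t).fun_pow 2).const_mul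
      (1 / 2)).mul_const ((X / 2 - x) ^ 2 * (1 / 4 - (s - ρ) ^ 2) ^ 2 * wgt m ρ s))).congr_deriv ?_
    simp only [Nat.cast_ofNat, Nat.add_one_sub_one, pow_one]
    ring
  · intro x hx s hs t _
    refine ((((hasDerivAt_sub_sq (X / 2) x).fun_mul ((F.dx x (hx1 x hx) s (hs1 s hs) t).fun_mul
      (F.dxx x (hx1 x hx) s (hs1 s hs) t))).mul_const ((1 / 4 - (s - ρ) ^ 2) ^ 2 *
      (4 - t ^ 2) ^ 2 * wgt m ρ s)).fun_neg).congr_deriv ?_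
    ring
  · intro x hx s hs t _
    refine ((((hasDerivAt_cutoff_sq (1 / 4) ρ s).fun_mul ((F.ds x (hx1 x hx) s (hs1 s hs) t).fun_mul
      (F.hasDerivAt_wgt_ws hρ (hx1 x hx) (hs1 s hs) t))).mul_const
        ((X / 2 - x) ^ 2 * (4 - t ^ 2) ^ 2)).fun_neg).congr_deriv ?_
    ring
  · fun_prop
  · fun_prop
  · fun_prop
  · fun_prop
  · intro x hx s hs
    norm_num
  · intro s hs t _
    simp
  · intro x hx t _
    constructor <;> norm_num
  · intro x hx s hs t ht
    have h1 := F.pos x (hx1 x hx) s (hs1 s hs) t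
    have h3 := F.le x (hx1 x hx) s (hs1 s hs) t
    have h4 := hP s hs
    have h5 := hσ s hs
    have h6 := energy_pointwise (F.w (x, s, t)) (F.wx (x, s, t)) (F.ws (x, s, t)) (X / 2 - x)
      (1 / 4 - (s - ρ) ^ 2) (s - ρ) 0
    have h7 : t ^ 2 ≤ 4 := by nlinarith [ht.1, ht.2]
    have hx2 : (X / 2 - x) ^ 2 ≤ 1 / 4 := by nlinarith [hx.1, hx.2]
    have hz2 : (1 / 4 - (s - ρ) ^ 2) ^ 2 ≤ 1 / 16 := by nlinarith [sq_nonneg (s - ρ)]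
    have h8 : 2 * ((1 / 4 - (s - ρ) ^ 2) ^ 2 + 4 * (s - ρ) ^ 2 * (X / 2 - x) ^ 2) ≤ 5 / 8 := by
      nlinarith [sq_nonneg (s - ρ), sq_nonneg (X / 2 - x)]
    have h9 : (4 - t ^ 2) ^ 2 ≤ 16 := by nlinarith [sq_nonneg t]
    have h10 : -4 * t * (4 - t ^ 2) ≤ 32 := by
      nlinarith [ht.1, ht.2, mul_nonneg (sub_nonneg.2 h7) (by linarith [ht.1] : 0 ≤ t + 2)]
    have h11 : 9 / 64 * X ^ 2 ≤ (X - x) ^ 2 * (1 - (s - ρ) ^ 2) ^ 2 := by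
      have e1 : X / 2 ≤ X - x := by linarith [hx.2]
      have e2 : 3 / 4 ≤ 1 - (s - ρ) ^ 2 := by linarith
      calc 9 / 64 * X ^ 2 = (X / 2) ^ 2 * (3 / 4) ^ 2 := by ring
        _ ≤ _ := by gcongr
    have h12 : (4 - t ^ 2) ^ 2 * (2 * ((1 / 4 - (s - ρ) ^ 2) ^ 2 + 4 * (s - ρ) ^ 2 * (X / 2 - x) ^ 2)) +
        -4 * t * (4 - t ^ 2) * (1 / 2 * ((X / 2 - x) ^ 2 * (1 / 4 - (s - ρ) ^ 2) ^ 2)) ≤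
        80 / X ^ 2 * ((X - x) ^ 2 * (1 - (s - ρ) ^ 2) ^ 2) := by
      calc _ ≤ 16 * (5 / 8) + 32 * (1 / 2 * (1 / 4 * (1 / 16))) := by gcongr
        _ ≤ 80 / X ^ 2 * (9 / 64 * X ^ 2) := by field_simp; norm_num
        _ ≤ _ := by gcongr
    have h13 : (4 - t ^ 2) ^ 2 * (2 * ((1 / 4 - (s - ρ) ^ 2) ^ 2 + 4 * (s - ρ) ^ 2 * (X / 2 - x) ^ 2)) *
        F.w (x, s, t) ^ 2 +
        -4 * t * (4 - t ^ 2) * (1 / 2 * ((X / 2 - x) ^ 2 * (1 / 4 - (s - ρ) ^ 2) ^ 2)) * F.w (x, s, t) ^ 2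
          ≤ 80 / X ^ 2 * ((X - x) ^ 2 * (1 - (s - ρ) ^ 2) ^ 2) * (B * F.w (x, s, t)) := by
      rw [← add_mul]
      have : F.w (x, s, t) ^ 2 ≤ B * F.w (x, s, t) := by rw [sq]; gcongr
      calc _ ≤ 80 / X ^ 2 * ((X - x) ^ 2 * (1 - (s - ρ) ^ 2) ^ 2) * F.w (x, s, t) ^ 2 := by gcongr
        _ ≤ _ := by gcongr
    have h14 := mul_le_mul_of_nonneg_left h6 (sq_nonneg (4 - t ^ 2))
    have h15 := mul_le_mul_of_nonneg_left (add_le_add h13 h14) h4.le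
    simp only
    rw [← sub_nonpos] at h15 ⊢
    refine le_of_eq_of_le ?_ h15
    ring

lemma energy (m : ℕ) {q : ℝ} (hq : 1 < q) {X : ℝ} (hX0 : 0 < X) (hX1 : X ≤ 1)
    (hXm : X ^ 2 * (2 + (12 + 4 * m / 3) ^ 2 / 32) ≤ 2) :
    ∃ C > 0, ∀ ρ B : ℝ, 4 ≤ ρ → ∀ F : Flat m ρ q B,
      (∫ p in Icc 0 (X / 2) ×ˢ Icc (ρ - 1 / 2) (ρ + 1 / 2) ×ˢ Icc (-2) 2,
        (F.wx p ^ 2 + F.ws p ^ 2) * ((X / 2 - p.1) ^ 2 * (1 / 4 - (p.2.1 - ρ) ^ 2) ^ 2 *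
          (4 - p.2.2 ^ 2) ^ 2 * wgt m ρ p.2.1)) ≤ C * B := by
  obtain ⟨C, hC, hmass⟩ := mass m hq hX0 hX1 hXm
  refine ⟨2 * (80 / X ^ 2 * C + 4 * C), by positivity, fun ρ B hρ F => ?_⟩
  obtain ⟨h1, h2⟩ := hmass ρ B hρ F
  have hB := F.B_pos
  have key := F.energy_aux hρ hX0 hX1
  have hsub := box_subset (X := X) (ρ := ρ) (t1 := -2) (t2 := 2) hX1 (le_refl (ρ - 1)) (le_refl (ρ + 1))
  have cw := F.cw.mono hsub
  have cwx := F.cwx.mono hsub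
  have cws := F.cws.mono hsub
  have cg := F.cwx.trace_zero (t1 := -2) (t2 := 2) (le_refl (ρ - 1)) (le_refl (ρ + 1))
  have cP := continuous_wgt m ρ
  have hP : ∀ s ∈ Icc (ρ - 1) (ρ + 1), 0 < wgt m ρ s :=
    fun s hs => lt_of_lt_of_le (by positivity) (le_wgt hρ hs)
  have hs2 : Icc (ρ - 1 / 2) (ρ + 1 / 2) ×ˢ Icc (-2:ℝ) 2 ⊆ Icc (ρ - 1) (ρ + 1) ×ˢ Icc (-2) 2 :=
    prod_mono (Icc_subset_Icc (by linarith) (by linarith)) le_rfl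
  have hs3 : Icc 0 (X / 2) ×ˢ Icc (ρ - 1 / 2) (ρ + 1 / 2) ×ˢ Icc (-2:ℝ) 2 ⊆
      Icc 0 X ×ˢ Icc (ρ - 1) (ρ + 1) ×ˢ Icc (-2) 2 :=
    prod_mono (Icc_subset_Icc_right (by linarith)) hs2
  have i1 : IntegrableOn (fun z : ℝ × ℝ => (1 - (z.1 - ρ) ^ 2) ^ 2 * wgt m ρ z.1 *
      -F.wx (0, z.1, z.2)) (Icc (ρ - 1) (ρ + 1) ×ˢ Icc (-2) 2) := integrableOn_box2 (by fun_prop)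
  have i2 : IntegrableOn (fun p : ℝ × ℝ × ℝ =>
      (X - p.1) ^ 2 * (1 - (p.2.1 - ρ) ^ 2) ^ 2 * wgt m ρ p.2.1 * F.w p)
      (Icc 0 X ×ˢ Icc (ρ - 1) (ρ + 1) ×ˢ Icc (-2) 2) := integrableOn_box3 (by fun_prop)
  have i3 : IntegrableOn (fun p : ℝ × ℝ × ℝ => (F.wx p ^ 2 + F.ws p ^ 2) * ((X / 2 - p.1) ^ 2 *
      (1 / 4 - (p.2.1 - ρ) ^ 2) ^ 2 * (4 - p.2.2 ^ 2) ^ 2 * wgt m ρ p.2.1))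
      (Icc 0 (X / 2) ×ˢ Icc (ρ - 1 / 2) (ρ + 1 / 2) ×ˢ Icc (-2) 2) := by
    have cws := cws.mono hs3
    have cwx := cwx.mono hs3
    exact integrableOn_box3 (by fun_prop)
  rw [integral_neg, integral_const_mul, integral_sub (Integrable.const_mul (i2.mono_set hs3) _)
    (i3.const_mul _), integral_const_mul, integral_const_mul] at key
  have b1 := setIntegral_le_of_subset isCompact_box2.measurableSet hs2 i1 fun z hz => by
    have h1 := (rpow_nonneg (F.pos 0 (by simp) z.1 hz.1 z.2).le q).trans (F.flux z.1 hz.1 z.2)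
    have := hP _ hz.1
    positivity
  have b2 := setIntegral_le_of_subset isCompact_box3.measurableSet hs3 i2 fun z hz => by
    have h1 := F.pos z.1 (hsub hz).1 z.2.1 hz.2.1 z.2.2
    have := hP _ hz.2.1
    positivity
  have b3 := mul_le_mul_of_nonneg_left (b1.trans h1) (by positivity : 0 ≤ 4 * B)
  have b4 := mul_le_mul_of_nonneg_left (b2.trans h2) (by positivity : 0 ≤ 80 / X ^ 2 * B)
  linarith

end Flat
end

section
open MeasureTheory Real

lemma wt_pointwise (v a b y z e : ℝ) :
    -(v ^ 2 * (y ^ 2 * z ^ 2)) - 2 * v * (a * (-y) * z ^ 2 + b * (-2 * e) * z * y ^ 2) ≤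
    -(1 / 2 * (v ^ 2 * (y ^ 2 * z ^ 2))) +
      4 * (z ^ 2 + 4 * e ^ 2 * y ^ 2) * (a ^ 2 + b ^ 2) := by
  have h1 : 0 ≤ (z * b + 2 * e * y * a) ^ 2 := sq_nonneg _
  have h2 : 0 ≤ (z * a - 2 * e * y * b) ^ 2 := sq_nonneg _
  nlinarith [sq_nonneg (v * y * z - 4 * a * z), sq_nonneg (v * y * z - 8 * b * e * y),
    sq_nonneg (a * z), sq_nonneg (b * z), sq_nonneg (e * y * a), sq_nonneg (e * y * b),
    sq_nonneg (v * y * z - 2 * a * z - 4 * b * e * y), sq_nonneg (a * z - 2 * b * e * y)]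

namespace Flat

variable {m : ℕ} {ρ q B : ℝ}

set_option maxHeartbeats 1000000 in
lemma wt_sq_aux (F : Flat m ρ q B) (hρ : 4 ≤ ρ) {X : ℝ} (hX0 : 0 < X) (hX1 : X ≤ 1) :
    ∫ z in Icc (ρ - 1 / 4) (ρ + 1 / 4) ×ˢ Icc (-1) 1,
        (X / 4) ^ 2 * (F.wx (0, z.1, z.2) * F.wt (0, z.1, z.2)) * ((1 / 16 - (z.1 - ρ) ^ 2) ^ 2 *
          (1 - z.2 ^ 2) ^ 2 * wgt m ρ z.1) ≤
      ∫ p in Icc 0 (X / 4) ×ˢ Icc (ρ - 1 / 4) (ρ + 1 / 4) ×ˢ Icc (-1) 1,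
        (4 / X ^ 2 * ((F.wx p ^ 2 + F.ws p ^ 2) * ((X / 2 - p.1) ^ 2 * (1 / 4 - (p.2.1 - ρ) ^ 2) ^ 2 *
          (4 - p.2.2 ^ 2) ^ 2 * wgt m ρ p.2.1))
        - 1 / 2 * (F.wt p ^ 2 * ((X / 4 - p.1) ^ 2 * (1 / 16 - (p.2.1 - ρ) ^ 2) ^ 2 *
          (1 - p.2.2 ^ 2) ^ 2 * wgt m ρ p.2.1))) := by
  have hsub := box_subset (X := X / 4) (ρ := ρ) (t1 := -1) (t2 := 1) (by linarith)
    (by linarith : ρ - 1 ≤ ρ - 1 / 4) (by linarith : ρ + 1 / 4 ≤ ρ + 1)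
  have cwx := F.cwx.mono hsub
  have cws := F.cws.mono hsub
  have cwxx := F.cwxx.mono hsub
  have cwxt := F.cwxt.mono hsub
  have cwst := F.cwst.mono hsub
  have cwt := F.cwt.mono hsub
  have cP := continuous_wgt m ρ
  have hx1 : ∀ x ∈ Icc 0 (X / 4), x ∈ Icc (0:ℝ) 1 := fun x hx => ⟨hx.1, hx.2.trans (by linarith)⟩
  have hs1 : ∀ s ∈ Icc (ρ - 1 / 4) (ρ + 1 / 4), s ∈ Icc (ρ - 1) (ρ + 1) := fun s hs =>
    ⟨by linarith [hs.1], by linarith [hs.2]⟩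
  have hP : ∀ s ∈ Icc (ρ - 1 / 4) (ρ + 1 / 4), 0 < wgt m ρ s :=
    fun s hs => lt_of_lt_of_le (by positivity) (le_wgt hρ (hs1 s hs))
  have hσ : ∀ s ∈ Icc (ρ - 1 / 4) (ρ + 1 / 4), (s - ρ) ^ 2 ≤ 1 / 16 := fun s hs => by
    nlinarith [hs.1, hs.2]
  refine le_of_eq_of_le ?_ (divergence_inequality_zero (X := X / 4) (a := ρ - 1 / 4) (b := ρ + 1 / 4)
    (t1 := -1) (t2 := 1)
    (T := fun p => (1 - p.2.2 ^ 2) ^ 2 * (1 / 2 * (F.wx p ^ 2 + F.ws p ^ 2) * ((X / 4 - p.1) ^ 2 *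
      (1 / 16 - (p.2.1 - ρ) ^ 2) ^ 2 * wgt m ρ p.2.1)))
    (F := fun p => -((X / 4 - p.1) ^ 2 * (F.wx p * F.wt p) * ((1 / 16 - (p.2.1 - ρ) ^ 2) ^ 2 *
      (1 - p.2.2 ^ 2) ^ 2 * wgt m ρ p.2.1)))
    (G := fun p => -((1 / 16 - (p.2.1 - ρ) ^ 2) ^ 2 * (F.wt p * (wgt m ρ p.2.1 * F.ws p)) *
      ((X / 4 - p.1) ^ 2 * (1 - p.2.2 ^ 2) ^ 2)))
    (T' := fun p => (-4 * p.2.2 * (1 - p.2.2 ^ 2) * (1 / 2 * (F.wx p ^ 2 + F.ws p ^ 2)) +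
      (1 - p.2.2 ^ 2) ^ 2 * (F.wx p * F.wxt p + F.ws p * F.wst p)) * ((X / 4 - p.1) ^ 2 *
      (1 / 16 - (p.2.1 - ρ) ^ 2) ^ 2 * wgt m ρ p.2.1))
    (F' := fun p => -((-2 * (X / 4 - p.1) * (F.wx p * F.wt p) + (X / 4 - p.1) ^ 2 *
      (F.wxx p * F.wt p + F.wx p * F.wxt p)) * ((1 / 16 - (p.2.1 - ρ) ^ 2) ^ 2 *
      (1 - p.2.2 ^ 2) ^ 2 * wgt m ρ p.2.1)))
    (G' := fun p => -((-4 * (p.2.1 - ρ) * (1 / 16 - (p.2.1 - ρ) ^ 2) *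
      (F.wt p * (wgt m ρ p.2.1 * F.ws p)) + (1 / 16 - (p.2.1 - ρ) ^ 2) ^ 2 *
        (F.wst p * (wgt m ρ p.2.1 * F.ws p) + F.wt p * (wgt m ρ p.2.1 * (F.wt p - F.wxx p)))) *
      ((X / 4 - p.1) ^ 2 * (1 - p.2.2 ^ 2) ^ 2)))
    (by linarith) (by linarith) (by linarith)
    ?_ ?_ ?_ ?_ ?_ ?_ ?_ ?_ ?_ ?_ ?_)
  · simp only [neg_neg, sub_zero]
  · intro x hx s hs t _
    refine ((hasDerivAt_time_sq 1 t).fun_mul (((((F.dxt x (hx1 x hx) s (hs1 s hs) t).fun_pow 2).fun_add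
      ((F.dst x (hx1 x hx) s (hs1 s hs) t).fun_pow 2)).const_mul
      (1 / 2)).mul_const ((X / 4 - x) ^ 2 * (1 / 16 - (s - ρ) ^ 2) ^ 2 * wgt m ρ s))).congr_deriv ?_
    simp only [Nat.cast_ofNat, Nat.add_one_sub_one, pow_one]
    ring
  · intro x hx s hs t _
    refine ((((hasDerivAt_sub_sq (X / 4) x).fun_mul ((F.dxx x (hx1 x hx) s (hs1 s hs) t).fun_mul
      (F.dtx x (hx1 x hx) s (hs1 s hs) t))).mul_const ((1 / 16 - (s - ρ) ^ 2) ^ 2 *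
      (1 - t ^ 2) ^ 2 * wgt m ρ s)).fun_neg).congr_deriv ?_
    ring
  · intro x hx s hs t _
    refine ((((hasDerivAt_cutoff_sq (1 / 16) ρ s).fun_mul ((F.dts x (hx1 x hx) s (hs1 s hs) t).fun_mul
      (F.hasDerivAt_wgt_ws hρ (hx1 x hx) (hs1 s hs) t))).mul_const
        ((X / 4 - x) ^ 2 * (1 - t ^ 2) ^ 2)).fun_neg).congr_deriv ?_
    ring
  · fun_prop
  · fun_prop
  · fun_prop
  · fun_prop
  · intro x hx s hs
    norm_num
  · intro s hs t _
    simp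
  · intro x hx t _
    constructor <;> norm_num
  · intro x hx s hs t ht
    have h4 := hP s hs
    have h5 := hσ s hs
    have h6 := wt_pointwise (F.wt (x, s, t)) (F.wx (x, s, t)) (F.ws (x, s, t)) (X / 4 - x)
      (1 / 16 - (s - ρ) ^ 2) (s - ρ)
    have h7 : t ^ 2 ≤ 1 := by nlinarith [ht.1, ht.2]
    have hx2 : (X / 4 - x) ^ 2 ≤ 1 / 16 := by nlinarith [hx.1, hx.2]
    have hz2 : (1 / 16 - (s - ρ) ^ 2) ^ 2 ≤ 1 / 256 := by nlinarith [sq_nonneg (s - ρ)]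
    have h8 : 4 * ((1 / 16 - (s - ρ) ^ 2) ^ 2 + 4 * (s - ρ) ^ 2 * (X / 4 - x) ^ 2) ≤ 20 / 256 := by
      nlinarith [sq_nonneg (s - ρ), sq_nonneg (X / 4 - x)]
    have h9 : (1 - t ^ 2) ^ 2 ≤ 1 := by nlinarith [sq_nonneg t]
    have h10 : -4 * t * (1 - t ^ 2) ≤ 4 := by
      nlinarith [ht.1, ht.2, mul_nonneg (sub_nonneg.2 h7) (by linarith [ht.1] : 0 ≤ t + 1)]
    have h11 : 81 / 4096 * X ^ 2 ≤ (X / 2 - x) ^ 2 * (1 / 4 - (s - ρ) ^ 2) ^ 2 * (4 - t ^ 2) ^ 2 := by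
      have e1 : X / 4 ≤ X / 2 - x := by linarith [hx.2]
      have e2 : 3 / 16 ≤ 1 / 4 - (s - ρ) ^ 2 := by linarith
      have e3 : 3 ≤ 4 - t ^ 2 := by linarith
      calc 81 / 4096 * X ^ 2 = (X / 4) ^ 2 * (3 / 16) ^ 2 * 3 ^ 2 := by ring
        _ ≤ _ := by gcongr
    have h12 : (1 - t ^ 2) ^ 2 * (4 * ((1 / 16 - (s - ρ) ^ 2) ^ 2 + 4 * (s - ρ) ^ 2 * (X / 4 - x) ^ 2)) +
        -4 * t * (1 - t ^ 2) * (1 / 2 * ((X / 4 - x) ^ 2 * (1 / 16 - (s - ρ) ^ 2) ^ 2)) ≤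
        4 / X ^ 2 * ((X / 2 - x) ^ 2 * (1 / 4 - (s - ρ) ^ 2) ^ 2 * (4 - t ^ 2) ^ 2) := by
      calc _ ≤ 1 * (20 / 256) + 4 * (1 / 2 * (1 / 16 * (1 / 256))) := by gcongr
        _ ≤ 4 / X ^ 2 * (81 / 4096 * X ^ 2) := by field_simp; norm_num
        _ ≤ _ := by gcongr
    have h13 := mul_le_mul_of_nonneg_right h12
      (by positivity : 0 ≤ F.wx (x, s, t) ^ 2 + F.ws (x, s, t) ^ 2)
    have h14 := mul_le_mul_of_nonneg_left h6 (sq_nonneg (1 - t ^ 2))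
    have h15 := mul_le_mul_of_nonneg_left (add_le_add h13 h14) h4.le
    simp only
    rw [← sub_nonpos] at h15 ⊢
    refine le_of_eq_of_le ?_ h15
    ring

end Flat
end

section
open MeasureTheory Real

namespace Flat

variable {m : ℕ} {ρ q B : ℝ}

/-- The part of the boundary term that is a time derivative integrates to zero. -/
lemma boundary_power_integral (F : Flat m ρ q B) (hq : 1 < q) :
    ∫ z in Icc (ρ - 1 / 4) (ρ + 1 / 4) ×ˢ Icc (-1) 1,
      (1 / 16 - (z.1 - ρ) ^ 2) ^ 2 * wgt m ρ z.1 * ((1 - z.2 ^ 2) ^ 2 *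
        (F.w (0, z.1, z.2) ^ q * F.wt (0, z.1, z.2)) +
        -4 * z.2 * (1 - z.2 ^ 2) * (F.w (0, z.1, z.2) ^ (q + 1) / (q + 1))) = 0 := by
  have cw := F.cw.trace_zero (t1 := -1) (t2 := 1)
    (by linarith : ρ - 1 ≤ ρ - 1 / 4) (by linarith : ρ + 1 / 4 ≤ ρ + 1)
  have cwt := F.cwt.trace_zero (t1 := -1) (t2 := 1)
    (by linarith : ρ - 1 ≤ ρ - 1 / 4) (by linarith : ρ + 1 / 4 ≤ ρ + 1)
  have cP := continuous_wgt m ρ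
  have hs1 : ∀ s ∈ Icc (ρ - 1 / 4) (ρ + 1 / 4), s ∈ Icc (ρ - 1) (ρ + 1) := fun s hs =>
    ⟨by linarith [hs.1], by linarith [hs.2]⟩
  have c1 : ContinuousOn (fun z : ℝ × ℝ => F.w (0, z.1, z.2) ^ q)
      (Icc (ρ - 1 / 4) (ρ + 1 / 4) ×ˢ Icc (-1) 1) :=
    cw.rpow_const fun z hz => Or.inr (by linarith)
  have c2 : ContinuousOn (fun z : ℝ × ℝ => F.w (0, z.1, z.2) ^ (q + 1))
      (Icc (ρ - 1 / 4) (ρ + 1 / 4) ×ˢ Icc (-1) 1) :=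
    cw.rpow_const fun z hz => Or.inr (by linarith)
  have cf : ContinuousOn (fun z : ℝ × ℝ =>
      (1 / 16 - (z.1 - ρ) ^ 2) ^ 2 * wgt m ρ z.1 * ((1 - z.2 ^ 2) ^ 2 *
        (F.w (0, z.1, z.2) ^ q * F.wt (0, z.1, z.2)) +
        -4 * z.2 * (1 - z.2 ^ 2) * (F.w (0, z.1, z.2) ^ (q + 1) / (q + 1))))
      (Icc (ρ - 1 / 4) (ρ + 1 / 4) ×ˢ Icc (-1) 1) := by fun_prop
  rw [Measure.volume_eq_prod, setIntegral_prod _ (integrableOn_box2 cf)]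
  refine setIntegral_eq_zero_of_forall_eq_zero fun s hs => ?_
  refine (setIntegral_Icc_eq_sub (f := fun t => (1 / 16 - (s - ρ) ^ 2) ^ 2 * wgt m ρ s *
    ((1 - t ^ 2) ^ 2 * (F.w (0, s, t) ^ (q + 1) / (q + 1)))) (by norm_num) (fun t ht => ?_)
    (cf.comp (f := fun t => (s, t)) (by fun_prop) fun t ht => ⟨hs, ht⟩)).trans ?_
  rotate_left
  · norm_num
  · have h := (F.dt 0 (by simp) s (hs1 s hs) t).rpow_const (p := q + 1) (Or.inr (by linarith))
    refine (((hasDerivAt_time_sq 1 t).fun_mul (h.div_const (q + 1))).const_mul _).congr_deriv ?_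
    have : q + 1 ≠ 0 := by linarith
    have e : F.wt (0, s, t) * (q + 1) * F.w (0, s, t) ^ q / (q + 1) =
        F.w (0, s, t) ^ q * F.wt (0, s, t) := by field_simp
    rw [add_sub_cancel_right, e]
    simp only [Function.comp_apply]
    ring

set_option maxHeartbeats 1000000 in
lemma wt_sq (m : ℕ) {q : ℝ} (hq : 1 < q) {X : ℝ} (hX0 : 0 < X) (hX1 : X ≤ 1)
    (hXm : X ^ 2 * (2 + (12 + 4 * m / 3) ^ 2 / 32) ≤ 2) :
    ∃ C > 0, ∀ ρ B : ℝ, 4 ≤ ρ → 1 ≤ B → ∀ F : Flat m ρ q B,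
      (∫ z in Icc (ρ - 1 / 4) (ρ + 1 / 4) ×ˢ Icc (-1) 1,
        (-F.wx (0, z.1, z.2) - F.w (0, z.1, z.2) ^ q) * |F.wt (0, z.1, z.2)|) ≤ 1 →
      (∫ p in Icc 0 (X / 4) ×ˢ Icc (ρ - 1 / 4) (ρ + 1 / 4) ×ˢ Icc (-1) 1,
        F.wt p ^ 2 * ((X / 4 - p.1) ^ 2 * (1 / 16 - (p.2.1 - ρ) ^ 2) ^ 2 *
          (1 - p.2.2 ^ 2) ^ 2 * wgt m ρ p.2.1)) ≤ C * B := by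
  obtain ⟨C, hC, hmass⟩ := mass m hq hX0 hX1 hXm
  obtain ⟨C', hC', henergy⟩ := energy m hq hX0 hX1 hXm
  refine ⟨2 * (4 / X ^ 2 * C' + 4 * C + (5 / 4) ^ m), by positivity, fun ρ B hρ hB1 F hE => ?_⟩
  have hm := (hmass ρ B hρ F).1
  have he := henergy ρ B hρ F
  have hB := F.B_pos
  have key := F.wt_sq_aux hρ hX0 hX1
  have hbd := F.boundary_power_integral hq
  have hsub := box_subset (X := X / 2) (ρ := ρ) (t1 := -2) (t2 := 2) (by linarith)
    (by linarith : ρ - 1 ≤ ρ - 1 / 2) (by linarith : ρ + 1 / 2 ≤ ρ + 1)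
  have hs3 : Icc 0 (X / 4) ×ˢ Icc (ρ - 1 / 4) (ρ + 1 / 4) ×ˢ Icc (-1:ℝ) 1 ⊆
      Icc 0 (X / 2) ×ˢ Icc (ρ - 1 / 2) (ρ + 1 / 2) ×ˢ Icc (-2) 2 :=
    prod_mono (Icc_subset_Icc_right (by linarith)) (prod_mono
      (Icc_subset_Icc (by linarith) (by linarith)) (Icc_subset_Icc (by norm_num) (by norm_num)))
  have hs2 : Icc (ρ - 1 / 4) (ρ + 1 / 4) ×ˢ Icc (-1:ℝ) 1 ⊆ Icc (ρ - 1) (ρ + 1) ×ˢ Icc (-2) 2 :=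
    prod_mono (Icc_subset_Icc (by linarith) (by linarith))
      (Icc_subset_Icc (by norm_num) (by norm_num))
  have cwx := F.cwx.mono hsub
  have cws := F.cws.mono hsub
  have cwt := F.cwt.mono hsub
  have cg2 := F.cwx.trace_zero (t1 := -2) (t2 := 2) (le_refl (ρ - 1)) (le_refl (ρ + 1))
  have cg := cg2.mono hs2
  have cw0 := (F.cw.trace_zero (t1 := -2) (t2 := 2) (le_refl (ρ - 1)) (le_refl (ρ + 1))).mono hs2
  have cwt0 := (F.cwt.trace_zero (t1 := -2) (t2 := 2) (le_refl (ρ - 1)) (le_refl (ρ + 1))).mono hs2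
  have cq : ContinuousOn (fun z : ℝ × ℝ => F.w (0, z.1, z.2) ^ q)
      (Icc (ρ - 1 / 4) (ρ + 1 / 4) ×ˢ Icc (-1) 1) :=
    cw0.rpow_const fun z hz => Or.inr (by linarith)
  have cq1 : ContinuousOn (fun z : ℝ × ℝ => F.w (0, z.1, z.2) ^ (q + 1))
      (Icc (ρ - 1 / 4) (ρ + 1 / 4) ×ˢ Icc (-1) 1) :=
    cw0.rpow_const fun z hz => Or.inr (by linarith)
  have cP := continuous_wgt m ρ
  have hP : ∀ s ∈ Icc (ρ - 1) (ρ + 1), 0 < wgt m ρ s :=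
    fun s hs => lt_of_lt_of_le (by positivity) (le_wgt hρ hs)
  have i1 : IntegrableOn (fun z : ℝ × ℝ => (1 - (z.1 - ρ) ^ 2) ^ 2 * wgt m ρ z.1 *
      -F.wx (0, z.1, z.2)) (Icc (ρ - 1) (ρ + 1) ×ˢ Icc (-2) 2) := integrableOn_box2 (by fun_prop)
  have i2 : IntegrableOn (fun z : ℝ × ℝ =>
      (-F.wx (0, z.1, z.2) - F.w (0, z.1, z.2) ^ q) * |F.wt (0, z.1, z.2)|)
      (Icc (ρ - 1 / 4) (ρ + 1 / 4) ×ˢ Icc (-1) 1) :=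
    integrableOn_box2 ((cg.neg.sub cq).mul cwt0.abs)
  have i3 : IntegrableOn (fun p : ℝ × ℝ × ℝ => (F.wx p ^ 2 + F.ws p ^ 2) * ((X / 2 - p.1) ^ 2 *
      (1 / 4 - (p.2.1 - ρ) ^ 2) ^ 2 * (4 - p.2.2 ^ 2) ^ 2 * wgt m ρ p.2.1))
      (Icc 0 (X / 2) ×ˢ Icc (ρ - 1 / 2) (ρ + 1 / 2) ×ˢ Icc (-2) 2) := integrableOn_box3 (by fun_prop)
  have i4 : IntegrableOn (fun p : ℝ × ℝ × ℝ => F.wt p ^ 2 * ((X / 4 - p.1) ^ 2 *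
      (1 / 16 - (p.2.1 - ρ) ^ 2) ^ 2 * (1 - p.2.2 ^ 2) ^ 2 * wgt m ρ p.2.1))
      (Icc 0 (X / 4) ×ˢ Icc (ρ - 1 / 4) (ρ + 1 / 4) ×ˢ Icc (-1) 1) := by
    have cwt := cwt.mono hs3
    exact integrableOn_box3 (by fun_prop)
  have i5 : IntegrableOn (fun z : ℝ × ℝ =>
      (1 / 16 - (z.1 - ρ) ^ 2) ^ 2 * wgt m ρ z.1 * ((1 - z.2 ^ 2) ^ 2 *
        (F.w (0, z.1, z.2) ^ q * F.wt (0, z.1, z.2)) +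
        -4 * z.2 * (1 - z.2 ^ 2) * (F.w (0, z.1, z.2) ^ (q + 1) / (q + 1))))
      (Icc (ρ - 1 / 4) (ρ + 1 / 4) ×ˢ Icc (-1) 1) := integrableOn_box2 (by fun_prop)
  rw [integral_sub (Integrable.const_mul (i3.mono_set hs3) _)
    (i4.const_mul _), integral_const_mul, integral_const_mul] at key
  have b1 := (setIntegral_le_of_subset isCompact_box2.measurableSet hs2 i1 fun z hz => by
    have h1 := (rpow_nonneg (F.pos 0 (by simp) z.1 hz.1 z.2).le q).trans (F.flux z.1 hz.1 z.2)
    have := hP _ hz.1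
    positivity).trans hm
  have b2 := (setIntegral_le_of_subset isCompact_box3.measurableSet hs3 i3 fun z hz => by
    have := hP z.2.1 ⟨by linarith [hz.2.1.1], by linarith [hz.2.1.2]⟩
    positivity).trans he
  have b3 : ∫ z in Icc (ρ - 1 / 4) (ρ + 1 / 4) ×ˢ Icc (-1) 1,
      (X / 4) ^ 2 * (-((1 / 16 - (z.1 - ρ) ^ 2) ^ 2 * wgt m ρ z.1 * ((1 - z.2 ^ 2) ^ 2 *
        (F.w (0, z.1, z.2) ^ q * F.wt (0, z.1, z.2)) +
        -4 * z.2 * (1 - z.2 ^ 2) * (F.w (0, z.1, z.2) ^ (q + 1) / (q + 1)))) -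
        4 * B * ((1 - (z.1 - ρ) ^ 2) ^ 2 * wgt m ρ z.1 * -F.wx (0, z.1, z.2)) -
        (5 / 4) ^ m * ((-F.wx (0, z.1, z.2) - F.w (0, z.1, z.2) ^ q) * |F.wt (0, z.1, z.2)|)) ≤
      ∫ z in Icc (ρ - 1 / 4) (ρ + 1 / 4) ×ˢ Icc (-1) 1,
        (X / 4) ^ 2 * (F.wx (0, z.1, z.2) * F.wt (0, z.1, z.2)) * ((1 / 16 - (z.1 - ρ) ^ 2) ^ 2 *
          (1 - z.2 ^ 2) ^ 2 * wgt m ρ z.1) := by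
    refine setIntegral_mono_on (((Integrable.sub (Integrable.sub i5.neg
      (Integrable.const_mul (i1.mono_set hs2) _)) (i2.const_mul _))).const_mul _)
      (integrableOn_box2 (by fun_prop)) isCompact_box2.measurableSet fun z hz => ?_
    obtain ⟨hs, ht⟩ := hz
    have hs1 : z.1 ∈ Icc (ρ - 1) (ρ + 1) := ⟨by linarith [hs.1], by linarith [hs.2]⟩
    have hw := F.pos 0 (by simp) z.1 hs1 z.2
    have hf := F.flux z.1 hs1 z.2
    have hwB := F.le 0 (by simp) z.1 hs1 z.2
    have hwq := rpow_pos_of_pos hw q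
    have hwq1 : F.w (0, z.1, z.2) ^ (q + 1) / (q + 1) ≤ B * -F.wx (0, z.1, z.2) := by
      rw [div_le_iff₀ (by linarith), rpow_add_one hw.ne', mul_comm (_ ^ q)]
      calc _ ≤ B * -F.wx (0, z.1, z.2) := by gcongr
        _ ≤ _ := le_mul_of_one_le_right (mul_nonneg hB.le (hwq.le.trans hf)) (by linarith)
    have hwq0 : 0 ≤ F.w (0, z.1, z.2) ^ (q + 1) / (q + 1) :=
      div_nonneg (rpow_nonneg hw.le _) (by linarith)
    have hPz := hP z.1 hs1
    have hPz' := wgt_le (m := m) hρ hs1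
    have h5 : (z.1 - ρ) ^ 2 ≤ 1 / 16 := by nlinarith [hs.1, hs.2]
    have h7 : z.2 ^ 2 ≤ 1 := by nlinarith [ht.1, ht.2]
    have h10 : 4 * z.2 * (1 - z.2 ^ 2) ≤ 4 := by
      have : z.2 * (1 - z.2 ^ 2) ≤ 1 * 1 :=
        mul_le_mul ht.2 (by linarith [sq_nonneg z.2]) (by linarith) (by norm_num)
      linarith
    have hz2 : (1 / 16 - (z.1 - ρ) ^ 2) ^ 2 ≤ (1 - (z.1 - ρ) ^ 2) ^ 2 :=
      pow_le_pow_left₀ (by linarith) (by linarith) 2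
    have hz3 : (1 / 16 - (z.1 - ρ) ^ 2) ^ 2 ≤ 1 :=
      pow_le_one₀ (by linarith) (by linarith [sq_nonneg (z.1 - ρ)])
    have h9 : (1 - z.2 ^ 2) ^ 2 ≤ 1 := pow_le_one₀ (by linarith) (by linarith [sq_nonneg z.2])
    have hg := sub_nonneg.2 hf
    have a1 : (1 / 16 - (z.1 - ρ) ^ 2) ^ 2 * wgt m ρ z.1 *
        (4 * z.2 * (1 - z.2 ^ 2) * (F.w (0, z.1, z.2) ^ (q + 1) / (q + 1))) ≤
        (1 - (z.1 - ρ) ^ 2) ^ 2 * wgt m ρ z.1 * (4 * (B * -F.wx (0, z.1, z.2))) := by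
      have e1 : 4 * z.2 * (1 - z.2 ^ 2) * (F.w (0, z.1, z.2) ^ (q + 1) / (q + 1)) ≤
          4 * (B * -F.wx (0, z.1, z.2)) := by
        calc _ ≤ 4 * (F.w (0, z.1, z.2) ^ (q + 1) / (q + 1)) := by gcongr
          _ ≤ _ := by gcongr
      have e2 : 0 ≤ 4 * (B * -F.wx (0, z.1, z.2)) :=
        mul_nonneg (by norm_num) (mul_nonneg hB.le (hwq.le.trans hf))
      calc _ ≤ (1 / 16 - (z.1 - ρ) ^ 2) ^ 2 * wgt m ρ z.1 * (4 * (B * -F.wx (0, z.1, z.2))) := by gcongr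
        _ ≤ _ := by gcongr
    have a2 : (1 / 16 - (z.1 - ρ) ^ 2) ^ 2 * (1 - z.2 ^ 2) ^ 2 * wgt m ρ z.1 *
        ((-F.wx (0, z.1, z.2) - F.w (0, z.1, z.2) ^ q) * F.wt (0, z.1, z.2)) ≤
        1 * 1 * (5 / 4) ^ m *
          ((-F.wx (0, z.1, z.2) - F.w (0, z.1, z.2) ^ q) * |F.wt (0, z.1, z.2)|) := by
      calc _ ≤ (1 / 16 - (z.1 - ρ) ^ 2) ^ 2 * (1 - z.2 ^ 2) ^ 2 * wgt m ρ z.1 *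
          ((-F.wx (0, z.1, z.2) - F.w (0, z.1, z.2) ^ q) * |F.wt (0, z.1, z.2)|) := by
            gcongr; exact le_abs_self _
        _ ≤ _ := by gcongr
    rw [mul_assoc ((X / 4) ^ 2)]
    refine mul_le_mul_of_nonneg_left ?_ (sq_nonneg (X / 4))
    have a3 := add_le_add a1 a2
    rw [← sub_nonpos] at a3 ⊢
    refine le_of_eq_of_le ?_ a3
    ring
  have j1 : IntegrableOn (fun z : ℝ × ℝ => -((1 / 16 - (z.1 - ρ) ^ 2) ^ 2 * wgt m ρ z.1 *
      ((1 - z.2 ^ 2) ^ 2 * (F.w (0, z.1, z.2) ^ q * F.wt (0, z.1, z.2)) +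
        -4 * z.2 * (1 - z.2 ^ 2) * (F.w (0, z.1, z.2) ^ (q + 1) / (q + 1)))))
      (Icc (ρ - 1 / 4) (ρ + 1 / 4) ×ˢ Icc (-1) 1) := Integrable.neg i5
  have j2 : IntegrableOn (fun z : ℝ × ℝ => 4 * B * ((1 - (z.1 - ρ) ^ 2) ^ 2 * wgt m ρ z.1 *
      -F.wx (0, z.1, z.2))) (Icc (ρ - 1 / 4) (ρ + 1 / 4) ×ˢ Icc (-1) 1) :=
    Integrable.const_mul (i1.mono_set hs2) _
  have j3 : IntegrableOn (fun z : ℝ × ℝ => (5 / 4) ^ m *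
      ((-F.wx (0, z.1, z.2) - F.w (0, z.1, z.2) ^ q) * |F.wt (0, z.1, z.2)|))
      (Icc (ρ - 1 / 4) (ρ + 1 / 4) ×ˢ Icc (-1) 1) := Integrable.const_mul i2 _
  have j4 := Integrable.sub j1 j2
  simp only [Pi.sub_def] at j4
  rw [integral_const_mul, integral_sub j4 j3, integral_sub j1 j2, integral_neg,
    integral_const_mul, integral_const_mul, hbd] at b3
  generalize (∫ z in Icc (ρ - 1 / 4) (ρ + 1 / 4) ×ˢ Icc (-1) 1,
        (-F.wx (0, z.1, z.2) - F.w (0, z.1, z.2) ^ q) * |F.wt (0, z.1, z.2)|) = e at *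
  generalize (∫ z in Icc (ρ - 1 / 4) (ρ + 1 / 4) ×ˢ Icc (-1) 1,
        (1 - (z.1 - ρ) ^ 2) ^ 2 * wgt m ρ z.1 * -F.wx (0, z.1, z.2)) = f at *
  have h5 : (0:ℝ) < (5 / 4) ^ m := by positivity
  have k1 : -(4 * B * C + (5 / 4) ^ m) ≤ (X / 4) ^ 2 * (-0 - 4 * B * f - (5 / 4) ^ m * e) := by
    have e1 : 4 * B * f ≤ 4 * B * C := by gcongr
    have e2 : (5 / 4) ^ m * e ≤ (5 / 4) ^ m * 1 := by gcongr
    have e3 : (X / 4) ^ 2 ≤ 1 := by nlinarith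
    have e4 : 0 ≤ (4 * B * C + (5 / 4) ^ m) := by positivity
    calc _ ≤ (X / 4) ^ 2 * -(4 * B * C + (5 / 4) ^ m) := by nlinarith [sq_nonneg (X / 4)]
      _ ≤ _ := by gcongr; linarith
  have k2 := mul_le_mul_of_nonneg_left b2 (by positivity : 0 ≤ 4 / X ^ 2)
  have k3 := (k1.trans b3).trans key
  have k4 : (5 / 4) ^ m ≤ (5 / 4) ^ m * B := le_mul_of_one_le_right h5.le hB1
  linarith

end Flat
end

section
open MeasureTheory Real

lemma hasDerivAt_max_zero_sq (y : ℝ) :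
    HasDerivAt (fun y : ℝ => max 0 y ^ 2) (2 * max 0 y) y := by
  rcases lt_trichotomy y 0 with h | rfl | h
  · rw [max_eq_left h.le, mul_zero]
    refine (hasDerivAt_const y (0:ℝ)).congr_of_eventuallyEq ?_
    filter_upwards [Iio_mem_nhds h] with z hz
    rw [max_eq_left (le_of_lt hz)]; norm_num
  · rw [max_self, mul_zero, hasDerivAt_iff_isLittleO_nhds_zero]
    have : (fun h : ℝ => h ^ 2) =o[𝓝 0] fun h : ℝ => h := by
      simpa using Asymptotics.isLittleO_pow_id (𝕜 := ℝ) (n := 2) (by norm_num)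
    refine Asymptotics.IsBigO.trans_isLittleO (Asymptotics.IsBigO.of_bound 1 (.of_forall fun z => ?_)) this
    simp only [zero_add, max_self, smul_zero, sub_zero, one_mul, norm_eq_abs, abs_pow, sq_abs,
      ne_eq, OfNat.ofNat_ne_zero, not_false_eq_true, zero_pow]
    rcases le_total z 0 with h | h
    · rw [max_eq_left h]; nlinarith [sq_nonneg z]
    · rw [max_eq_right h]
  · refine ((hasDerivAt_pow 2 y).congr_of_eventuallyEq ?_).congr_deriv ?_
    · filter_upwards [Ioi_mem_nhds h] with z hz
      rw [max_eq_right (le_of_lt hz)]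
    · rw [max_eq_right h.le]; norm_num

/-- A logarithmic cutoff centred at the origin of the plane. -/
noncomputable def lcut (l L x y : ℝ) : ℝ := max 0 (1 - log ((l ^ 2 + x ^ 2 + y ^ 2) / l ^ 2) / L)

lemma lcut_swap (l L x y : ℝ) : lcut l L x y = lcut l L y x := by
  unfold lcut; congr 5; ring

lemma lcut_nonneg (l L x y : ℝ) : 0 ≤ lcut l L x y := le_max_left _ _

lemma lcut_le_one {l L : ℝ} (hl : 0 < l) (hL : 0 < L) (x y : ℝ) : lcut l L x y ≤ 1 := by
  refine max_le zero_le_one ?_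
  have : 0 ≤ log ((l ^ 2 + x ^ 2 + y ^ 2) / l ^ 2) := by
    refine log_nonneg ?_
    rw [le_div_iff₀ (by positivity)]; nlinarith
  have := div_nonneg this hL.le
  linarith

lemma lcut_eq_zero {l L x y : ℝ} (hL : 0 < L) (h : L ≤ log ((l ^ 2 + x ^ 2 + y ^ 2) / l ^ 2)) :
    lcut l L x y = 0 := by
  refine max_eq_left ?_
  have := (one_le_div hL).2 h
  linarith

lemma hasDerivAt_lcut_sq {l L : ℝ} (hl : 0 < l) (x y : ℝ) :
    HasDerivAt (fun r => lcut l L r y ^ 2)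
      (2 * lcut l L x y * -(2 * x / (l ^ 2 + x ^ 2 + y ^ 2) / L)) x := by
  have hp : 0 < l ^ 2 + x ^ 2 + y ^ 2 := by positivity
  have h1 : HasDerivAt (fun r => (l ^ 2 + r ^ 2 + y ^ 2) / l ^ 2) (2 * x / l ^ 2) x := by
    refine ((((hasDerivAt_pow 2 x).const_add (l ^ 2)).add_const (y ^ 2)).div_const (l ^ 2)).congr_deriv ?_
    norm_num
  have h2 := ((h1.log (by positivity)).div_const L).const_sub 1
  refine ((hasDerivAt_max_zero_sq _).comp x h2).congr_deriv ?_
  unfold lcut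
  congr 2
  field_simp

lemma continuous_lcut {l L : ℝ} (hl : 0 < l) : Continuous fun p : ℝ × ℝ => lcut l L p.1 p.2 := by
  unfold lcut
  have : ∀ p : ℝ × ℝ, (l ^ 2 + p.1 ^ 2 + p.2 ^ 2) / l ^ 2 ≠ 0 := fun p => by positivity
  fun_prop (disch := assumption)

lemma setIntegral_inv_sq_add_sq_le {b r c t1 t2 : ℝ} (hb : 0 < b) (hr : 0 ≤ r) (ht : t1 ≤ t2) :
    ∫ z in Icc (c - r) (c + r) ×ˢ Icc t1 t2, 1 / (b ^ 2 + (z.1 - c) ^ 2) ≤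
      (t2 - t1) * (π / b) := by
  have hp : ∀ s : ℝ, b ^ 2 + (s - c) ^ 2 ≠ 0 := fun s => by positivity
  have hc : Continuous fun s : ℝ => 1 / (b ^ 2 + (s - c) ^ 2) := by
    fun_prop (disch := assumption)
  rw [Measure.volume_eq_prod, setIntegral_prod _ (integrableOn_box2
    (f := fun z => 1 / (b ^ 2 + (z.1 - c) ^ 2)) (hc.comp continuous_fst).continuousOn)]
  simp only [setIntegral_const, smul_eq_mul, Real.volume_real_Icc_of_le ht]
  rw [integral_const_mul]
  refine mul_le_mul_of_nonneg_left ?_ (sub_nonneg.2 ht)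
  rw [setIntegral_Icc_eq_sub (f := fun s => arctan ((s - c) / b) / b) (by linarith)]
  · rw [← sub_div]
    gcongr
    linarith [arctan_lt_pi_div_two ((c + r - c) / b), neg_pi_div_two_lt_arctan ((c - r - c) / b)]
  · intro s _
    refine (((((hasDerivAt_id s).sub_const c).div_const b).arctan).div_const b).congr_deriv ?_
    simp only [id]
    have := hp s
    have : 1 + ((s - c) / b) ^ 2 ≠ 0 := by positivity
    field_simp
  · exact hc.continuousOn

lemma setIntegral_inv_quadratic_le {l k c t1 t2 : ℝ} (hl : 0 < l) (hk : 1 ≤ k) (ht : t1 ≤ t2) :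
    ∫ p in Icc 0 (k * l) ×ˢ Icc (c - k * l) (c + k * l) ×ˢ Icc t1 t2,
      1 / (l ^ 2 + p.1 ^ 2 + (p.2.1 - c) ^ 2) ≤ (t2 - t1) * (2 * π * log (1 + k ^ 2)) := by
  have hR : 0 ≤ k * l := by positivity
  have hp : ∀ p : ℝ × ℝ × ℝ, l ^ 2 + p.1 ^ 2 + (p.2.1 - c) ^ 2 ≠ 0 := fun p => by positivity
  have hc : Continuous fun p : ℝ × ℝ × ℝ => 1 / (l ^ 2 + p.1 ^ 2 + (p.2.1 - c) ^ 2) := by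
    fun_prop (disch := assumption)
  have hi := integrableOn_box3 (X := k * l) (a := c - k * l) (b := c + k * l) (t1 := t1) (t2 := t2)
    hc.continuousOn
  have hl' : ∀ x ∈ Icc 0 (k * l), l + x ≠ 0 := fun x hx => by have := hx.1; positivity
  rw [Measure.volume_eq_prod, setIntegral_prod _ hi]
  calc _ ≤ ∫ x in Icc 0 (k * l), (t2 - t1) * (π * 2) * (1 / (l + x)) := by
        refine setIntegral_mono_on ?_ ?_ measurableSet_Icc fun x hx => ?_
        · rw [IntegrableOn, Measure.volume_eq_prod, ← Measure.prod_restrict] at hi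
          exact hi.integral_prod_left
        · refine ContinuousOn.integrableOn_Icc ?_
          fun_prop (disch := assumption)
        · have h1 := setIntegral_inv_sq_add_sq_le (b := √(l ^ 2 + x ^ 2)) (c := c)
            (sqrt_pos.2 (by positivity)) hR ht
          rw [sq_sqrt (by positivity)] at h1
          refine h1.trans ?_
          have h2 : (l + x) / 2 ≤ √(l ^ 2 + x ^ 2) := by
            refine le_sqrt_of_sq_le ?_
            nlinarith [sq_nonneg (l - x), sq_nonneg (l + x)]
          have := hx.1
          rw [mul_assoc]
          refine mul_le_mul_of_nonneg_left ?_ (sub_nonneg.2 ht)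
          calc π / √(l ^ 2 + x ^ 2) ≤ π / ((l + x) / 2) := by gcongr
            _ = _ := by field_simp
    _ = (t2 - t1) * (π * 2 * (log (l + k * l) - log (l + 0))) := by
        rw [integral_const_mul, setIntegral_Icc_eq_sub (f := fun x => log (l + x)) hR, mul_assoc]
        · intro x hx
          exact ((hasDerivAt_id x).const_add l).log (hl' x hx)
        · fun_prop (disch := assumption)
    _ ≤ _ := by
        refine mul_le_mul_of_nonneg_left ?_ (sub_nonneg.2 ht)
        rw [add_zero, ← log_div (by positivity) (by positivity)]
        rw [show (l + k * l) / l = 1 + k by field_simp, mul_comm π 2]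
        gcongr
        nlinarith

end

section
open MeasureTheory Real

lemma log_pointwise {y gx gs a b p τ L d D : ℝ} (hL : 0 < L) (hD : 0 < D) (hd : d ≤ D)
    (hg : gx ^ 2 + gs ^ 2 = 4 * d / (D ^ 2 * L ^ 2)) (hy0 : 0 ≤ y) (hy1 : y ≤ 1) (hτ : p ≤ τ)
    (h0 : 0 ≤ τ) :
    y ^ 2 * p + 2 * y * gx * a + 2 * y * gs * b - y ^ 2 * (a ^ 2 + b ^ 2) ≤
      4 / L ^ 2 * (1 / D) + τ := by
  have h1 : gx ^ 2 + gs ^ 2 ≤ 4 / L ^ 2 * (1 / D) := by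
    rw [hg]
    calc 4 * d / (D ^ 2 * L ^ 2) ≤ 4 * D / (D ^ 2 * L ^ 2) := by gcongr
      _ = _ := by field_simp
  have h2 : y ^ 2 * p ≤ τ := by
    calc y ^ 2 * p ≤ y ^ 2 * τ := by gcongr
      _ ≤ 1 * τ := by gcongr; exact pow_le_one₀ hy0 hy1
      _ = τ := one_mul _
  nlinarith [sq_nonneg (gx - y * a), sq_nonneg (gs - y * b)]

namespace Flat

variable {m : ℕ} {ρ q B : ℝ}

set_option maxHeartbeats 1000000 in
lemma log_aux (F : Flat m ρ q B) (hρ : 4 ≤ ρ) {l k t1 t2 α : ℝ} (hl : 0 < l) (hk : 1 ≤ k)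
    (hkl : k * l ≤ 1) (ht : t1 ≤ t2) (hα : 0 < α) :
    ∫ z in Icc (ρ - k * l) (ρ + k * l) ×ˢ Icc t1 t2,
        wgt m ρ z.1 * (lcut l (log (1 + k ^ 2)) 0 (z.1 - ρ) ^ 2 *
          (-F.wx (0, z.1, z.2) / (B + F.w (0, z.1, z.2)))) ≤
      ∫ p in Icc 0 (k * l) ×ˢ Icc (ρ - k * l) (ρ + k * l) ×ˢ Icc t1 t2,
        (5 / 4) ^ m * (4 / log (1 + k ^ 2) ^ 2 * (1 / (l ^ 2 + p.1 ^ 2 + (p.2.1 - ρ) ^ 2)) +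
          (α * F.wt p ^ 2 + 1 / (4 * α)) / B) := by
  have hR : 0 ≤ k * l := by positivity
  set L := log (1 + k ^ 2) with hL
  have hL0 : 0 < L := log_pos (by nlinarith)
  have hsub := box_subset (X := k * l) (ρ := ρ) (t1 := t1) (t2 := t2) hkl
    (by linarith : ρ - 1 ≤ ρ - k * l) (by linarith : ρ + k * l ≤ ρ + 1)
  have cw := F.cw.mono hsub
  have cwx := F.cwx.mono hsub
  have cws := F.cws.mono hsub
  have cwxx := F.cwxx.mono hsub
  have cwt := F.cwt.mono hsub
  have cP := continuous_wgt m ρ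
  have hx1 : ∀ x ∈ Icc 0 (k * l), x ∈ Icc (0:ℝ) 1 := fun x hx => ⟨hx.1, hx.2.trans hkl⟩
  have hs1 : ∀ s ∈ Icc (ρ - k * l) (ρ + k * l), s ∈ Icc (ρ - 1) (ρ + 1) := fun s hs =>
    ⟨by linarith [hs.1], by linarith [hs.2]⟩
  have hB := F.B_pos
  have hBw : ∀ x ∈ Icc 0 (k * l), ∀ s ∈ Icc (ρ - k * l) (ρ + k * l), ∀ t,
      0 < B + F.w (x, s, t) := fun x hx s hs t => add_pos hB (F.pos x (hx1 x hx) s (hs1 s hs) t)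
  have hBw' : ∀ p ∈ Icc 0 (k * l) ×ˢ Icc (ρ - k * l) (ρ + k * l) ×ˢ Icc t1 t2,
      B + F.w p ≠ 0 := fun p hp => (hBw p.1 hp.1 p.2.1 hp.2.1 p.2.2).ne'
  set S := Icc 0 (k * l) ×ˢ Icc (ρ - k * l) (ρ + k * l) ×ˢ Icc t1 t2 with hS
  have hBw2 : ∀ p ∈ S, (B + F.w p) ^ 2 ≠ 0 := fun p hp => pow_ne_zero 2 (hBw' p hp)
  have hDs : ∀ p ∈ S, l ^ 2 + p.1 ^ 2 + (p.2.1 - ρ) ^ 2 ≠ 0 := fun p _ => by positivity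
  have hDs' : ∀ p ∈ S, l ^ 2 + (p.2.1 - ρ) ^ 2 + p.1 ^ 2 ≠ 0 := fun p _ => by positivity
  have cPs : ContinuousOn (fun p : ℝ × ℝ × ℝ => wgt m ρ p.2.1) S :=
    (cP.comp (continuous_fst.comp continuous_snd)).continuousOn
  have cXs : ContinuousOn (fun p : ℝ × ℝ × ℝ => lcut l L p.1 (p.2.1 - ρ)) S :=
    ((continuous_lcut hl).comp (f := fun p : ℝ × ℝ × ℝ => (p.1, p.2.1 - ρ))
      (by fun_prop)).continuousOn
  have cXs' : ContinuousOn (fun p : ℝ × ℝ × ℝ => lcut l L (p.2.1 - ρ) p.1) S :=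
    ((continuous_lcut hl).comp (f := fun p : ℝ × ℝ × ℝ => (p.2.1 - ρ, p.1))
      (by fun_prop)).continuousOn
  have hend : ∀ x y : ℝ, (k * l) ^ 2 ≤ x ^ 2 + y ^ 2 → lcut l L x y = 0 := fun x y h => by
    refine lcut_eq_zero hL0 (log_le_log (by positivity) ?_)
    rw [le_div_iff₀ (by positivity)]
    linarith
  refine le_trans (le_of_eq ?_) (divergence_inequality_zero hR (by linarith) ht
    (T := fun _ => 0)
    (F := fun p => wgt m ρ p.2.1 * (lcut l L p.1 (p.2.1 - ρ) ^ 2 * (F.wx p / (B + F.w p))))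
    (G := fun p => lcut l L (p.2.1 - ρ) p.1 ^ 2 * ((wgt m ρ p.2.1 * F.ws p) / (B + F.w p)))
    (T' := fun _ => 0)
    (F' := fun p => wgt m ρ p.2.1 * (2 * lcut l L p.1 (p.2.1 - ρ) *
      -(2 * p.1 / (l ^ 2 + p.1 ^ 2 + (p.2.1 - ρ) ^ 2) / L) * (F.wx p / (B + F.w p)) +
      lcut l L p.1 (p.2.1 - ρ) ^ 2 *
        ((F.wxx p * (B + F.w p) - F.wx p * F.wx p) / (B + F.w p) ^ 2)))
    (G' := fun p => 2 * lcut l L (p.2.1 - ρ) p.1 *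
      -(2 * (p.2.1 - ρ) / (l ^ 2 + (p.2.1 - ρ) ^ 2 + p.1 ^ 2) / L) *
        ((wgt m ρ p.2.1 * F.ws p) / (B + F.w p)) +
      lcut l L (p.2.1 - ρ) p.1 ^ 2 *
        ((wgt m ρ p.2.1 * (F.wt p - F.wxx p) * (B + F.w p) - (wgt m ρ p.2.1 * F.ws p) * F.ws p) /
          (B + F.w p) ^ 2))
    ?_ ?_ ?_ ?_ ?_ ?_ ?_ ?_ ?_ ?_ ?_)
  · congr 1; ext z; rw [neg_div, mul_neg, mul_neg]
  · intro x _ s _ t _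
    exact hasDerivAt_const _ _
  · intro x hx s hs t _
    have h1 := (F.dx x (hx1 x hx) s (hs1 s hs) t)
    have h2 := (F.dxx x (hx1 x hx) s (hs1 s hs) t)
    exact ((hasDerivAt_lcut_sq hl x (s - ρ)).fun_mul
      (h2.fun_div (h1.const_add B) (hBw x hx s hs t).ne')).const_mul (wgt m ρ s)
  · intro x hx s hs t _
    have h1 := (F.ds x (hx1 x hx) s (hs1 s hs) t)
    have h2 := F.hasDerivAt_wgt_ws hρ (hx1 x hx) (hs1 s hs) t
    have h3 := (hasDerivAt_lcut_sq (L := L) hl (s - ρ) x).comp s ((hasDerivAt_id s).sub_const ρ)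
    refine (h3.fun_mul (h2.fun_div (h1.const_add B) (hBw x hx s hs t).ne')).congr_deriv ?_
    simp only [Function.comp_apply, mul_one, id]
  · fun_prop
  · fun_prop (disch := assumption)
  · fun_prop (disch := assumption)
  · fun_prop (disch := assumption)
  · intro x _ s _
    exact le_rfl
  · intro s hs t _
    simp only [hend (k * l) (s - ρ) (by nlinarith [sq_nonneg (s - ρ)])]
    ring
  · intro x hx t _
    simp only [hend (ρ - k * l - ρ) x (by nlinarith [sq_nonneg x]),
      hend (ρ + k * l - ρ) x (by nlinarith [sq_nonneg x])]
    constructor <;> ring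
  · intro x hx s hs t _
    have hb := hBw x hx s hs t
    have hw := F.pos x (hx1 x hx) s (hs1 s hs) t
    have hP0 : 0 ≤ wgt m ρ s := le_trans (by positivity) (le_wgt hρ (hs1 s hs))
    have hP1 := wgt_le (m := m) hρ (hs1 s hs)
    have hDp : 0 < l ^ 2 + x ^ 2 + (s - ρ) ^ 2 := by positivity
    have hτ : F.wt (x, s, t) / (B + F.w (x, s, t)) ≤ (α * F.wt (x, s, t) ^ 2 + 1 / (4 * α)) / B := by
      have e : F.wt (x, s, t) ≤ α * F.wt (x, s, t) ^ 2 + 1 / (4 * α) := by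
        have := sq_nonneg (2 * α * F.wt (x, s, t) - 1)
        have e2 : α * F.wt (x, s, t) ^ 2 + 1 / (4 * α) - F.wt (x, s, t) =
          (2 * α * F.wt (x, s, t) - 1) ^ 2 / (4 * α) := by field_simp; ring
        have : 0 ≤ (2 * α * F.wt (x, s, t) - 1) ^ 2 / (4 * α) := by positivity
        linarith
      calc _ ≤ (α * F.wt (x, s, t) ^ 2 + 1 / (4 * α)) / (B + F.w (x, s, t)) := by gcongr
        _ ≤ _ := by gcongr; linarith
    have key := log_pointwise (y := lcut l L x (s - ρ))
      (gx := -(2 * x / (l ^ 2 + x ^ 2 + (s - ρ) ^ 2) / L))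
      (gs := -(2 * (s - ρ) / (l ^ 2 + x ^ 2 + (s - ρ) ^ 2) / L))
      (a := F.wx (x, s, t) / (B + F.w (x, s, t))) (b := F.ws (x, s, t) / (B + F.w (x, s, t)))
      (d := x ^ 2 + (s - ρ) ^ 2) hL0 hDp (by nlinarith [sq_nonneg l]) (by field_simp; ring)
      (lcut_nonneg _ _ _ _) (lcut_le_one hl hL0 _ _) hτ (by positivity)
    refine le_trans (le_of_eq ?_) ((mul_le_mul_of_nonneg_left key hP0).trans
      (mul_le_mul_of_nonneg_right hP1 (by positivity)))
    have e1 : l ^ 2 + (s - ρ) ^ 2 + x ^ 2 = l ^ 2 + x ^ 2 + (s - ρ) ^ 2 := by ring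
    simp only [lcut_swap l L (s - ρ) x, e1]
    generalize lcut l L x (s - ρ) = y
    generalize wgt m ρ s = P
    generalize F.wx (x, s, t) = a
    generalize F.ws (x, s, t) = b
    generalize -(2 * x / (l ^ 2 + x ^ 2 + (s - ρ) ^ 2) / L) = gx
    generalize -(2 * (s - ρ) / (l ^ 2 + x ^ 2 + (s - ρ) ^ 2) / L) = gs
    generalize B + F.w (x, s, t) = N at hb
    have := hb.ne'
    field_simp
    ring

end Flat
end

section
open MeasureTheory Real

lemma volume_real_box2 {a b t1 t2 : ℝ} (hab : a ≤ b) (ht : t1 ≤ t2) :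
    volume.real (Icc a b ×ˢ Icc t1 t2) = (b - a) * (t2 - t1) := by
  rw [Measure.volume_eq_prod, measureReal_prod_prod, volume_real_Icc_of_le hab,
    volume_real_Icc_of_le ht]

lemma volume_real_box3 {X a b t1 t2 : ℝ} (hX : 0 ≤ X) (hab : a ≤ b) (ht : t1 ≤ t2) :
    volume.real (Icc 0 X ×ˢ Icc a b ×ˢ Icc t1 t2) = X * ((b - a) * (t2 - t1)) := by
  rw [Measure.volume_eq_prod, measureReal_prod_prod, volume_real_Icc_of_le hX,
    volume_real_box2 hab ht, sub_zero]

namespace Flat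

variable {m : ℕ} {ρ q B : ℝ}

lemma log_upper (F : Flat m ρ q B) {l k t1 t2 α D : ℝ} (hl : 0 < l) (hk : 1 ≤ k)
    (hkl : k * l ≤ 1) (ht : t1 ≤ t2) (hα : 0 < α)
    (hD : ∫ p in Icc 0 (k * l) ×ˢ Icc (ρ - k * l) (ρ + k * l) ×ˢ Icc t1 t2, F.wt p ^ 2 ≤ D * B) :
    ∫ p in Icc 0 (k * l) ×ˢ Icc (ρ - k * l) (ρ + k * l) ×ˢ Icc t1 t2,
        (5 / 4) ^ m * (4 / log (1 + k ^ 2) ^ 2 * (1 / (l ^ 2 + p.1 ^ 2 + (p.2.1 - ρ) ^ 2)) +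
          (α * F.wt p ^ 2 + 1 / (4 * α)) / B) ≤
      (5 / 4) ^ m * (8 * π * (t2 - t1) / log (1 + k ^ 2) + α * D +
        k ^ 2 * l ^ 2 * (t2 - t1) / (2 * α * B)) := by
  have hR : 0 ≤ k * l := by positivity
  have hB := F.B_pos
  have hL0 : 0 < log (1 + k ^ 2) := log_pos (by nlinarith)
  have hsub := box_subset (X := k * l) (ρ := ρ) (t1 := t1) (t2 := t2) hkl
    (by linarith : ρ - 1 ≤ ρ - k * l) (by linarith : ρ + k * l ≤ ρ + 1)
  have cwt := F.cwt.mono hsub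
  have hD0 : ∀ p : ℝ × ℝ × ℝ, l ^ 2 + p.1 ^ 2 + (p.2.1 - ρ) ^ 2 ≠ 0 := fun p => by positivity
  have hc : Continuous fun p : ℝ × ℝ × ℝ => 1 / (l ^ 2 + p.1 ^ 2 + (p.2.1 - ρ) ^ 2) := by
    fun_prop (disch := assumption)
  have i1 := integrableOn_box3 (X := k * l) (a := ρ - k * l) (b := ρ + k * l) (t1 := t1) (t2 := t2)
    hc.continuousOn
  have i2 : IntegrableOn (fun p => F.wt p ^ 2)
    (Icc 0 (k * l) ×ˢ Icc (ρ - k * l) (ρ + k * l) ×ˢ Icc t1 t2) := integrableOn_box3 (cwt.pow 2)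
  have i3 : IntegrableOn (fun _ : ℝ × ℝ × ℝ => 1 / (4 * α))
    (Icc 0 (k * l) ×ˢ Icc (ρ - k * l) (ρ + k * l) ×ˢ Icc t1 t2) :=
    integrableOn_box3 continuousOn_const
  have i2' : IntegrableOn (fun p => α * F.wt p ^ 2)
    (Icc 0 (k * l) ×ˢ Icc (ρ - k * l) (ρ + k * l) ×ˢ Icc t1 t2) := Integrable.const_mul i2 _
  have i23 : IntegrableOn (fun p => α * F.wt p ^ 2 + 1 / (4 * α))
    (Icc 0 (k * l) ×ˢ Icc (ρ - k * l) (ρ + k * l) ×ˢ Icc t1 t2) := Integrable.add i2' i3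
  have i4 : IntegrableOn (fun p => (α * F.wt p ^ 2 + 1 / (4 * α)) / B)
    (Icc 0 (k * l) ×ˢ Icc (ρ - k * l) (ρ + k * l) ×ˢ Icc t1 t2) := Integrable.div_const i23 _
  rw [integral_const_mul, integral_add (Integrable.const_mul i1 _) i4, integral_const_mul,
    integral_div, integral_add i2' i3, integral_const_mul, setIntegral_const,
    volume_real_box3 hR (by linarith) ht, smul_eq_mul]
  have h1 := setIntegral_inv_quadratic_le (c := ρ) hl hk ht
  gcongr _ * ?_
  have e1 : 4 / log (1 + k ^ 2) ^ 2 * ((t2 - t1) * (2 * π * log (1 + k ^ 2))) =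
      8 * π * (t2 - t1) / log (1 + k ^ 2) := by field_simp; ring
  have e2 : (α * (D * B) + k * l * ((ρ + k * l - (ρ - k * l)) * (t2 - t1)) * (1 / (4 * α))) / B =
      α * D + k ^ 2 * l ^ 2 * (t2 - t1) / (2 * α * B) := by field_simp; ring
  rw [add_assoc, ← e1, ← e2]
  gcongr

lemma log_lower (F : Flat m ρ q B) (hρ : 4 ≤ ρ) (hq : 1 < q) {l k t1 t2 c1 b : ℝ} (hl : 0 < l)
    (hk : 2 ≤ k) (hkl : k * l ≤ 1) (ht : t1 ≤ t2) (hc1 : 0 < c1) (hc1' : c1 ≤ 1 / 2) (hb : 0 < b)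
    (hw : ∀ s t, |s - ρ| ≤ c1 * l → t ∈ Icc t1 t2 → b ≤ F.w (0, s, t)) :
    (3 / 4) ^ m * (1 / 4 * (b ^ q / (2 * B))) * (2 * c1 * l * (t2 - t1)) ≤
    ∫ z in Icc (ρ - k * l) (ρ + k * l) ×ˢ Icc t1 t2,
        wgt m ρ z.1 * (lcut l (log (1 + k ^ 2)) 0 (z.1 - ρ) ^ 2 *
          (-F.wx (0, z.1, z.2) / (B + F.w (0, z.1, z.2)))) := by
  have hB := F.B_pos
  have hL0 : 0 < log (1 + k ^ 2) := log_pos (by nlinarith)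
  have hckl : c1 * l ≤ k * l := by gcongr; linarith
  have h1 : ρ - 1 ≤ ρ - k * l := by linarith
  have h2 : ρ + k * l ≤ ρ + 1 := by linarith
  have hs1 : ∀ s ∈ Icc (ρ - k * l) (ρ + k * l), s ∈ Icc (ρ - 1) (ρ + 1) := fun s hs =>
    ⟨by linarith [hs.1], by linarith [hs.2]⟩
  have cw := F.cw.trace_zero (t1 := t1) (t2 := t2) h1 h2
  have cwx := F.cwx.trace_zero (t1 := t1) (t2 := t2) h1 h2
  have hBw : ∀ z ∈ Icc (ρ - k * l) (ρ + k * l) ×ˢ Icc t1 t2, B + F.w (0, z.1, z.2) ≠ 0 :=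
    fun z hz => (add_pos hB (F.pos 0 (by simp) z.1 (hs1 z.1 hz.1) z.2)).ne'
  have cP : ContinuousOn (fun z : ℝ × ℝ => wgt m ρ z.1)
      (Icc (ρ - k * l) (ρ + k * l) ×ˢ Icc t1 t2) :=
    ((continuous_wgt m ρ).comp continuous_fst).continuousOn
  have cX : ContinuousOn (fun z : ℝ × ℝ => lcut l (log (1 + k ^ 2)) 0 (z.1 - ρ))
      (Icc (ρ - k * l) (ρ + k * l) ×ˢ Icc t1 t2) :=
    ((continuous_lcut hl).comp (f := fun z : ℝ × ℝ => (0, z.1 - ρ)) (by fun_prop)).continuousOn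
  have hi : IntegrableOn (fun z : ℝ × ℝ => wgt m ρ z.1 *
      (lcut l (log (1 + k ^ 2)) 0 (z.1 - ρ) ^ 2 *
        (-F.wx (0, z.1, z.2) / (B + F.w (0, z.1, z.2)))))
      (Icc (ρ - k * l) (ρ + k * l) ×ˢ Icc t1 t2) :=
    integrableOn_box2 (by fun_prop (disch := assumption))
  have hss : Icc (ρ - c1 * l) (ρ + c1 * l) ×ˢ Icc t1 t2 ⊆
      Icc (ρ - k * l) (ρ + k * l) ×ˢ Icc t1 t2 :=
    prod_mono (Icc_subset_Icc (by linarith) (by linarith)) le_rfl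
  refine le_trans ?_ (setIntegral_le_of_subset isCompact_box2.measurableSet hss hi fun z hz => ?_)
  · have hv : volume.real (Icc (ρ - c1 * l) (ρ + c1 * l) ×ˢ Icc t1 t2) =
        2 * c1 * l * (t2 - t1) := by
      rw [volume_real_box2 (by nlinarith) ht]; ring
    rw [← hv, mul_comm, ← smul_eq_mul, ← setIntegral_const]
    refine setIntegral_mono_on (integrableOn_box2 continuousOn_const) (hi.mono_set hss)
      isCompact_box2.measurableSet fun z hz => ?_
    have hzs := hs1 z.1 (hss hz).1
    have hzw := hw z.1 z.2 (abs_le.2 ⟨by linarith [hz.1.1], by linarith [hz.1.2]⟩) hz.2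
    have hwB := F.le 0 (by simp) z.1 hzs z.2
    have hf := F.flux z.1 hzs z.2
    have hbq : b ^ q ≤ F.w (0, z.1, z.2) ^ q := by gcongr
    have hbq0 : 0 < b ^ q := rpow_pos_of_pos hb q
    have hX : 1 / 2 ≤ lcut l (log (1 + k ^ 2)) 0 (z.1 - ρ) := by
      refine le_max_of_le_right ?_
      have h5 : (z.1 - ρ) ^ 2 ≤ (c1 * l) ^ 2 :=
        sq_le_sq' (by linarith [hz.1.1]) (by linarith [hz.1.2])
      have h6 : log ((l ^ 2 + 0 ^ 2 + (z.1 - ρ) ^ 2) / l ^ 2) ≤ log 2 := by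
        refine log_le_log (by positivity) ?_
        rw [div_le_iff₀ (by positivity)]
        have : (c1 * l) ^ 2 ≤ (1 / 2 * l) ^ 2 := by gcongr
        nlinarith
      have h7 : 2 * log 2 ≤ log (1 + k ^ 2) := by
        rw [← log_rpow (by norm_num)]
        refine log_le_log (by positivity) ?_
        norm_num; nlinarith
      have : log ((l ^ 2 + 0 ^ 2 + (z.1 - ρ) ^ 2) / l ^ 2) / log (1 + k ^ 2) ≤ 1 / 2 := by
        rw [div_le_iff₀ hL0]; linarith
      linarith
    have hX2 : 1 / 4 ≤ lcut l (log (1 + k ^ 2)) 0 (z.1 - ρ) ^ 2 := by nlinarith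
    have hw0 : 0 < F.w (0, z.1, z.2) := hb.trans_le hzw
    have hwx : 0 ≤ -F.wx (0, z.1, z.2) := by linarith
    gcongr
    · exact (by positivity : (0:ℝ) ≤ (3 / 4) ^ m).trans (le_wgt hρ hzs)
    · exact le_wgt hρ hzs
    · linarith
    · linarith
  · have hzs := hs1 z.1 hz.1
    have h0 := F.pos 0 (by simp) z.1 hzs z.2
    have h3 := (rpow_nonneg h0.le q).trans (F.flux z.1 hzs z.2)
    have h4 : 0 ≤ wgt m ρ z.1 := (by positivity : (0:ℝ) ≤ (3 / 4) ^ m).trans (le_wgt hρ hzs)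
    positivity

lemma wt_sq_small (F : Flat m ρ q B) (hρ : 4 ≤ ρ) {X R τ C : ℝ} (hX0 : 0 < X) (hX1 : X ≤ 1)
    (hR : R ≤ X / 8) (hτ : τ ≤ 1 / 2)
    (hC : (∫ p in Icc 0 (X / 4) ×ˢ Icc (ρ - 1 / 4) (ρ + 1 / 4) ×ˢ Icc (-1) 1,
        F.wt p ^ 2 * ((X / 4 - p.1) ^ 2 * (1 / 16 - (p.2.1 - ρ) ^ 2) ^ 2 *
          (1 - p.2.2 ^ 2) ^ 2 * wgt m ρ p.2.1)) ≤ C * B) :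
    ∫ p in Icc 0 R ×ˢ Icc (ρ - R) (ρ + R) ×ˢ Icc (-τ) 0, F.wt p ^ 2 ≤
      C / ((X / 8) ^ 2 * (3 / 64) ^ 2 * (3 / 4) ^ 2 * (3 / 4) ^ m) * B := by
  have hsub := box_subset (X := X / 4) (ρ := ρ) (t1 := -1) (t2 := 1) (by linarith)
    (by linarith : ρ - 1 ≤ ρ - 1 / 4) (by linarith : ρ + 1 / 4 ≤ ρ + 1)
  have hss : Icc 0 R ×ˢ Icc (ρ - R) (ρ + R) ×ˢ Icc (-τ) 0 ⊆
      Icc 0 (X / 4) ×ˢ Icc (ρ - 1 / 4) (ρ + 1 / 4) ×ˢ Icc (-1) 1 :=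
    prod_mono (Icc_subset_Icc_right (by linarith)) (prod_mono
      (Icc_subset_Icc (by linarith) (by linarith)) (Icc_subset_Icc (by linarith) (by norm_num)))
  have cwt := F.cwt.mono hsub
  have cP : ContinuousOn (fun p : ℝ × ℝ × ℝ => wgt m ρ p.2.1)
      (Icc 0 (X / 4) ×ˢ Icc (ρ - 1 / 4) (ρ + 1 / 4) ×ˢ Icc (-1) 1) :=
    ((continuous_wgt m ρ).comp (continuous_fst.comp continuous_snd)).continuousOn
  have hi : IntegrableOn (fun p => F.wt p ^ 2 * ((X / 4 - p.1) ^ 2 *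
      (1 / 16 - (p.2.1 - ρ) ^ 2) ^ 2 * (1 - p.2.2 ^ 2) ^ 2 * wgt m ρ p.2.1))
      (Icc 0 (X / 4) ×ˢ Icc (ρ - 1 / 4) (ρ + 1 / 4) ×ˢ Icc (-1) 1) :=
    integrableOn_box3 (by fun_prop)
  have hP : ∀ p ∈ Icc 0 (X / 4) ×ˢ Icc (ρ - 1 / 4) (ρ + 1 / 4) ×ˢ Icc (-1:ℝ) 1,
      (3 / 4) ^ m ≤ wgt m ρ p.2.1 := fun p hp => le_wgt hρ (hsub hp).2.1
  rw [div_mul_eq_mul_div, le_div_iff₀ (by positivity), mul_comm, ← integral_const_mul]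
  refine le_trans ?_ ((setIntegral_le_of_subset isCompact_box3.measurableSet hss hi
    fun p hp => ?_).trans hC)
  · refine setIntegral_mono_on (Integrable.const_mul (integrableOn_box3 ((cwt.mono hss).pow 2)) _)
      (hi.mono_set hss) isCompact_box3.measurableSet fun p hp => ?_
    obtain ⟨hx, hs, ht⟩ := hp
    have hPp := hP p (hss ⟨hx, hs, ht⟩)
    have h1 : X / 8 ≤ X / 4 - p.1 := by linarith [hx.2]
    have h2 : 3 / 64 ≤ 1 / 16 - (p.2.1 - ρ) ^ 2 := by
      have : (p.2.1 - ρ) ^ 2 ≤ (1 / 8) ^ 2 :=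
        sq_le_sq' (by linarith [hs.1]) (by linarith [hs.2])
      linarith
    have h3 : 3 / 4 ≤ 1 - p.2.2 ^ 2 := by
      have : p.2.2 ^ 2 ≤ (1 / 2) ^ 2 :=
        sq_le_sq' (by linarith [ht.1]) (by linarith [ht.2])
      linarith
    rw [mul_comm]
    gcongr
  · have := hP p hp
    have : 0 ≤ wgt m ρ p.2.1 := (by positivity : (0:ℝ) ≤ (3 / 4) ^ m).trans this
    positivity

end Flat
end

section
open MeasureTheory Real

set_option maxHeartbeats 1000000 in
/-- A flat solution of size comparable to `K` on a large box has bounded `K`. -/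
theorem Flat.bound (m : ℕ) {q A c0 c1 : ℝ} (hq : 1 < q) (hA : 1 ≤ A) (hc0 : 0 < c0) (hc1 : 0 < c1)
    (hc1' : c1 ≤ 1 / 2) : ∃ Kmax, ∀ ρ K : ℝ, 4 ≤ ρ → 1 ≤ K → ∀ F : Flat m ρ q (A * K),
      (∫ z in Icc (ρ - 1 / 4) (ρ + 1 / 4) ×ˢ Icc (-1) 1,
        (-F.wx (0, z.1, z.2) - F.w (0, z.1, z.2) ^ q) * |F.wt (0, z.1, z.2)|) ≤ 1 →
      (∀ s t, |s - ρ| ≤ c1 * K ^ (-(q - 1)) → t ∈ Icc (-(c1 * (K ^ (-(q - 1))) ^ 2)) 0 →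
        c0 * K ≤ F.w (0, s, t)) → K ≤ Kmax := by
  have hq1 : 0 < q - 1 := by linarith
  set Y : ℝ := 2 + (12 + 4 * m / 3) ^ 2 / 32 with hY
  have hY2 : 2 ≤ Y := le_add_of_nonneg_right (by positivity)
  set X : ℝ := 1 / Y with hX
  have hX0 : 0 < X := by positivity
  have hX1 : X ≤ 1 := by rw [hX, div_le_one (by linarith)]; linarith
  have hXY : X ^ 2 * Y = X := by rw [hX]; field_simp
  obtain ⟨C, hC, hwt⟩ := Flat.wt_sq m hq hX0 hX1 (by rw [hXY]; linarith)
  set D := C / ((X / 8) ^ 2 * (3 / 64) ^ 2 * (3 / 4) ^ 2 * (3 / 4) ^ m) with hD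
  have hD0 : 0 < D := by positivity
  set a := (3 / 4) ^ m * c0 ^ q * c1 / (4 * A) with ha
  have hc0q : 0 < c0 ^ q := rpow_pos_of_pos hc0 q
  have hA0 : 0 < A := by linarith
  have ha0 : 0 < a := by positivity
  set b := (5 / 4) ^ m * (8 * π) with hb
  have hb0 : 0 < b := by positivity
  set k := max 2 (exp (2 * b / a)) with hk
  have hk2 : 2 ≤ k := le_max_left _ _
  have hL : 2 * b / a ≤ log (1 + k ^ 2) := by
    rw [le_log_iff_exp_le (by positivity)]
    have : exp (2 * b / a) ≤ k := le_max_right _ _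
    nlinarith
  set E := (5 / 4) ^ m * (D / c1 + k ^ 2 / 2) with hE
  have hE0 : 0 < E := by positivity
  refine ⟨max ((2 * E / a) ^ 2) ((8 * k / X) ^ (1 / (q - 1))), fun ρ K hρ hK F hF hw => ?_⟩
  have hK0 : 0 < K := by linarith
  by_cases hKX : K ≤ (8 * k / X) ^ (1 / (q - 1))
  · exact le_max_of_le_right hKX
  refine le_max_of_le_left ?_
  push Not at hKX
  set l := K ^ (-(q - 1)) with hl
  have hl0 : 0 < l := rpow_pos_of_pos hK0 _
  have hlK : K ^ (q - 1) * l = 1 := by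
    rw [hl, ← rpow_add hK0]; simp
  have hkl : k * l ≤ X / 8 := by
    have h1 : 8 * k / X ≤ K ^ (q - 1) := by
      have := rpow_le_rpow (by positivity) hKX.le hq1.le
      rwa [← rpow_mul (by positivity), one_div_mul_cancel hq1.ne', rpow_one] at this
    rw [div_le_iff₀ hX0] at h1
    have h2 : 8 * k * l ≤ K ^ (q - 1) * X * l := by gcongr
    have h3 : K ^ (q - 1) * X * l = X := by rw [mul_right_comm, hlK, one_mul]
    linarith
  have hl1 : l ≤ 1 := by nlinarith
  set τ := c1 * l ^ 2 with hτ
  have hτ0 : 0 < τ := by positivity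
  have hτ1 : τ ≤ 1 / 2 := by
    calc c1 * l ^ 2 ≤ 1 / 2 * 1 := by gcongr; exact pow_le_one₀ hl0.le hl1
      _ = _ := by norm_num
  have hAK : 1 ≤ A * K := one_le_mul_of_one_le_of_one_le hA hK
  have hsm := F.wt_sq_small hρ hX0 hX1 hkl hτ1 (hwt ρ (A * K) hρ hAK F hF)
  rw [← hD] at hsm
  set α := l ^ 2 / √(A * K) with hα
  have hs0 : 0 < √(A * K) := sqrt_pos.2 (by linarith)
  have hα0 : 0 < α := by positivity
  have h1 := F.log_upper hl0 (by linarith) (by linarith) (by linarith : -τ ≤ 0) hα0 hsm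
  have h2 := F.log_aux hρ hl0 (by linarith : 1 ≤ k) (by linarith) (by linarith : -τ ≤ 0) hα0
  have h3 := F.log_lower hρ hq hl0 hk2 (by linarith) (by linarith : -τ ≤ 0) hc1 hc1'
    (by positivity : 0 < c0 * K) hw
  have h4 := h3.trans (h2.trans h1)
  have hL0 : 0 < log (1 + k ^ 2) := log_pos (by nlinarith)
  have e1 : (3 / 4) ^ m * (1 / 4 * ((c0 * K) ^ q / (2 * (A * K)))) * (2 * c1 * l * (0 - -τ)) =
      a * τ := by
    rw [mul_rpow hc0.le hK0.le, show K ^ q = K ^ (q - 1) * K by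
      rw [← rpow_add_one hK0.ne']; congr 1; ring, ha]
    calc _ = (3 / 4) ^ m * c0 ^ q * c1 / (4 * A) * τ * (K ^ (q - 1) * l) := by
          field_simp; ring
      _ = _ := by rw [hlK, mul_one]
  have hsq : √(A * K) ^ 2 = A * K := sq_sqrt (by linarith)
  have e2 : (5 / 4) ^ m * (8 * π * (0 - -τ) / log (1 + k ^ 2) + α * D +
      k ^ 2 * l ^ 2 * (0 - -τ) / (2 * α * (A * K))) =
      (b / log (1 + k ^ 2) + E / √(A * K)) * τ := by
    have e3 : ∀ S L : ℝ, 0 < S → 0 < L → (5 / 4) ^ m * (8 * π * (0 - -τ) / L + l ^ 2 / S * D +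
        k ^ 2 * l ^ 2 * (0 - -τ) / (2 * (l ^ 2 / S) * S ^ 2)) = (b / L + E / S) * τ := by
      intro S L hS hL
      rw [hb, hE, hτ]
      clear_value D
      field_simp
      ring
    have := e3 _ _ hs0 hL0
    rwa [hsq] at this
  rw [e1, e2] at h4
  have h5 := le_of_mul_le_mul_right h4 hτ0
  have h6 : b / log (1 + k ^ 2) ≤ a / 2 := by
    rw [div_le_div_iff₀ hL0 (by norm_num)]
    rw [div_le_iff₀ ha0] at hL
    linarith
  have h7 : √(A * K) ≤ 2 * E / a := by
    rw [le_div_iff₀ ha0]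
    have : a / 2 ≤ E / √(A * K) := by linarith
    rw [le_div_iff₀ hs0] at this
    linarith
  calc K ≤ A * K := le_mul_of_one_le_left hK0.le hA
    _ = √(A * K) ^ 2 := hsq.symm
    _ ≤ _ := by gcongr

end

section

variable {n : ℕ} {hn : 0 < n} {q M : ℝ} {u : Eu n × ℝ → ℝ}

lemma convex_closedHalf : Convex ℝ (closedHalf n hn) := by
  intro x hx y hy a b ha hb _
  change 0 ≤ (a • x + b • y) ⟨0, hn⟩
  have hx : 0 ≤ x ⟨0, hn⟩ := hx
  have hy : 0 ≤ y ⟨0, hn⟩ := hy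
  simp only [PiLp.add_apply, PiLp.smul_apply, smul_eq_mul]
  positivity

lemma hasDerivAt_line (x e : Eu n) (k : ℝ) : HasDerivAt (fun k : ℝ => x + k • e) e k := by
  simpa using ((hasDerivAt_id k).smul_const e).const_add x

lemma hJ_of_contDiffOn {f : Eu n × ℝ → ℝ} {x : Eu n} {t : ℝ} {U : Set (Eu n)} (hU : IsOpen U)
    (hx : x ∈ U) (hf : ContDiffOn ℝ 2 (fun y => f (y, t)) U)
    (ht : ContDiff ℝ 1 fun s => f (x, s))
    (he : deriv (fun s => f (x, s)) t = lap (fun y => f (y, t)) x) : HJ f x t 0 := by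
  refine ⟨fun i => fderiv ℝ (fun y => f (y, t)) x (ee i),
    fun i => fderiv ℝ (fun y => fderiv ℝ (fun y => f (y, t)) y (ee i)) x (ee i), _,
    fun i => ⟨fun k => fderiv ℝ (fun y => f (y, t)) (x + k • ee i) (ee i), ?_, by simp, ?_⟩,
    (ht.differentiable one_ne_zero t).hasDerivAt, sub_eq_zero.2 he⟩
  · have hU' : ∀ᶠ k in 𝓝 (0 : ℝ), x + k • ee i ∈ U := by
      have : Continuous fun k : ℝ => x + k • (ee i : Eu n) := by fun_prop
      exact this.continuousAt.eventually (hU.mem_nhds (by simpa using hx))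
    filter_upwards [hU'] with k hk
    have h1 : DifferentiableAt ℝ (fun y => f (y, t)) (x + k • ee i) :=
      (hf.contDiffAt (hU.mem_nhds hk)).differentiableAt (by norm_num)
    exact h1.hasFDerivAt.comp_hasDerivAt k (hasDerivAt_line x (ee i) k)
  · have h1 : ContDiffOn ℝ 1 (fun y => fderiv ℝ (fun y => f (y, t)) y) U :=
      hf.fderiv_of_isOpen hU (by norm_num)
    have h2 : DifferentiableAt ℝ (fun y => fderiv ℝ (fun y => f (y, t)) y (ee i)) x :=
      ((h1.contDiffAt (hU.mem_nhds hx)).differentiableAt (by norm_num)).clm_apply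
        (differentiableAt_const _)
    have h3 : HasFDerivAt (fun y => fderiv ℝ (fun y => f (y, t)) y (ee i))
        (fderiv ℝ (fun y => fderiv ℝ (fun y => f (y, t)) y (ee i)) x) (x + (0 : ℝ) • ee i) := by
      simpa using h2.hasFDerivAt
    exact h3.comp_hasDerivAt (0 : ℝ) (hasDerivAt_line x (ee i) 0)

lemma closedHalf_mem_nhds {x : Eu n} (hx : x ∈ openHalf n hn) : closedHalf n hn ∈ 𝓝 x :=
  mem_of_superset (isOpen_openHalf.mem_nhds hx) fun y (hy : 0 < y ⟨0, hn⟩) => hy.le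

/-- Classical solutions with bounded gradient satisfy the one-dimensional formulation. -/
lemma IsHalfSpaceSol.sol (h : IsHalfSpaceSol n hn q u) (hsym : AxiallySymmetric n hn u)
    (hM : ∀ x ∈ closedHalf n hn, ∀ t : ℝ, u (x, t) ≤ M ∧
      ‖fderivWithin ℝ (fun y => u (y, t)) (closedHalf n hn) x‖ ≤ M) : Sol n hn q M u := by
  obtain ⟨hcont, hC1, hgrad, hC2, ht, heq, hb, hpos⟩ := h
  have hline : ∀ x : Eu n, x ⟨0, hn⟩ = 0 → MapsTo (fun k : ℝ => x + k • ee ⟨0, hn⟩) (Ici 0)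
      (closedHalf n hn) := by
    intro x hx k hk
    have hk : 0 ≤ k := hk
    change 0 ≤ (x + k • ee ⟨0, hn⟩) ⟨0, hn⟩
    simp [hx, hk]
  refine ⟨hcont, hpos, fun x hx t => (hM x hx t).1, fun x hx y hy t => ?_, fun x hx t => ?_,
    fun x hx t => ?_, fun x hx t => ?_, hsym⟩
  · rw [norm_sub_rev]
    have := convex_closedHalf.norm_image_sub_le_of_norm_fderivWithin_le
      ((hC1 t).differentiableOn one_ne_zero) (fun z hz => (hM z hz t).2) hx hy
    rwa [Real.norm_eq_abs, abs_sub_comm] at this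
  · exact hJ_of_contDiffOn isOpen_openHalf hx (hC2 t) (ht x hx) (heq x hx t)
  · have hx' : x ∈ closedHalf n hn := hx.ge
    have h1 : HasFDerivWithinAt (fun y => u (y, t))
        (fderivWithin ℝ (fun y => u (y, t)) (closedHalf n hn) x) (closedHalf n hn)
        (x + (0 : ℝ) • ee ⟨0, hn⟩) := by
      simpa using ((hC1 t).differentiableOn one_ne_zero x hx').hasFDerivWithinAt
    have h2 := h1.comp_hasDerivWithinAt (0 : ℝ)
      (hasDerivAt_line x (ee ⟨0, hn⟩) 0).hasDerivWithinAt (hline x hx)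
    refine h2.congr_deriv ?_
    rw [← hb x hx t, neg_neg, ee]
  · have h1 : ContinuousWithinAt (fun k : ℝ => fderivWithin ℝ (fun y => u (y, t)) (closedHalf n hn)
        (x + k • ee ⟨0, hn⟩) (ee ⟨0, hn⟩)) (Ici 0) 0 := by
      have h2 : ContinuousWithinAt (fun x => fderivWithin ℝ (fun y => u (y, t)) (closedHalf n hn) x)
          (closedHalf n hn) (x + (0 : ℝ) • ee ⟨0, hn⟩) := hgrad t _ (by rw [zero_smul, add_zero]; exact hx.ge)
      have h3 := h2.comp (t := closedHalf n hn) (x := (0 : ℝ))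
        (f := fun k : ℝ => x + k • ee ⟨0, hn⟩) (by fun_prop : Continuous _).continuousWithinAt
        (hline x hx)
      exact h3.clm_apply continuousWithinAt_const
    have h4 := h1.tendsto.mono_left (nhdsWithin_mono _ Ioi_subset_Ici_self)
    simp only [zero_smul, add_zero] at h4
    rw [show fderivWithin ℝ (fun y => u (y, t)) (closedHalf n hn) x (ee ⟨0, hn⟩) = -(u (x, t) ^ q) by
      rw [← hb x hx t, neg_neg, ee]] at h4
    refine h4.congr' ?_
    filter_upwards [self_mem_nhdsWithin] with k hk
    have hk : 0 < k := hk
    have hxk : x + k • ee ⟨0, hn⟩ ∈ openHalf n hn := by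
      change 0 < (x + k • ee ⟨0, hn⟩) ⟨0, hn⟩
      simp [hx, hk]
    have h5 : DifferentiableAt ℝ (fun y => u (y, t)) (x + k • ee ⟨0, hn⟩) :=
      ((hC1 t).contDiffAt (closedHalf_mem_nhds hxk)).differentiableAt (by norm_num)
    rw [fderivWithin_of_mem_nhds (closedHalf_mem_nhds hxk)]
    exact (h5.hasFDerivAt.comp_hasDerivAt k (hasDerivAt_line x (ee ⟨0, hn⟩) k)).deriv.symm

lemma smul_mem_closedHalf {l : ℝ} (hl : 0 ≤ l) {x : Eu n} (hx : x ∈ closedHalf n hn) :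
    l • x ∈ closedHalf n hn := by
  have hx : 0 ≤ x ⟨0, hn⟩ := hx
  change 0 ≤ (l • x) ⟨0, hn⟩
  simp only [PiLp.smul_apply, smul_eq_mul]
  positivity

/-- The scaling invariance of the half-space problem. -/
lemma Sol.scale (hu : Sol n hn q M u) (hq : 1 < q) {l : ℝ} (hl : 0 < l) (t0 : ℝ) :
    Sol n hn q (l ^ (1 / (q - 1)) * M * (1 + l))
      (fun p => l ^ (1 / (q - 1)) * u (l • p.1, t0 + l ^ 2 * p.2)) := by
  set b := l ^ (1 / (q - 1)) with hb
  have hb0 : 0 < b := Real.rpow_pos_of_pos hl _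
  have hM := hu.M_pos
  have hbq : b * l = b ^ q := by
    have : q - 1 ≠ 0 := by linarith
    rw [hb, ← Real.rpow_mul hl.le, ← Real.rpow_add_one hl.ne']
    congr 1
    field_simp; ring
  have hfl : ∀ (x : Eu n) (k : ℝ) (i : Fin n), l • (x + k • ee i) = l • x + (l * k) • ee i :=
    fun x k i => by rw [smul_add, smul_smul]
  refine ⟨?_, fun x hx t => mul_pos hb0 (hu.pos _ (smul_mem_closedHalf hl.le hx) _),
    fun x hx t => ?_, fun x hx y hy t => ?_, fun x hx t => ?_, fun x hx t => ?_, fun x hx t => ?_,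
    fun x y h1 h2 t => ?_⟩
  · refine continuousOn_const.mul (hu.cont.comp (by fun_prop) ?_)
    rintro ⟨x, t⟩ ⟨hx, -⟩
    exact ⟨smul_mem_closedHalf hl.le hx, mem_univ _⟩
  · have := hu.le _ (smul_mem_closedHalf hl.le hx) (t0 + l ^ 2 * t)
    calc _ ≤ b * M := by gcongr
      _ ≤ b * M * (1 + l) := le_mul_of_one_le_right (by positivity) (by linarith)
  · have := hu.lip _ (smul_mem_closedHalf hl.le hx) _ (smul_mem_closedHalf hl.le hy) (t0 + l ^ 2 * t)
    rw [← mul_sub, abs_mul, abs_of_pos hb0]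
    rw [← smul_sub, norm_smul, Real.norm_eq_abs, abs_of_pos hl] at this
    calc _ ≤ b * (M * (l * ‖x - y‖)) := by gcongr
      _ = b * M * l * ‖x - y‖ := by ring
      _ ≤ _ := by gcongr; linarith
  · have hx' : l • x ∈ openHalf n hn := by
      have hx : 0 < x ⟨0, hn⟩ := hx
      change 0 < (l • x) ⟨0, hn⟩
      simp only [PiLp.smul_apply, smul_eq_mul]
      positivity
    obtain ⟨d, a, τ, h1, h2, h3⟩ := hu.heat _ hx' (t0 + l ^ 2 * t)
    refine ⟨fun i => b * (l * d i), fun i => b * (l ^ 2 * a i), b * (τ * l ^ 2), fun i => ?_, ?_, ?_⟩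
    · refine (((h1 i).comp_mul l).const_mul b).congr (Eventually.of_forall fun k => ?_)
      simp only [hfl]
    · refine HasDerivAt.const_mul b (HasDerivAt.comp t (h₂ := fun s => u (l • x, s)) h2 ?_)
      simpa using ((hasDerivAt_id t).const_mul (l ^ 2)).const_add t0
    · rw [← Finset.mul_sum, ← Finset.mul_sum, show τ = ∑ i, a i by linarith]; ring
  · have hx' : (l • x) ⟨0, hn⟩ = 0 := by simp [hx]
    have h1 := hu.bdry _ hx' (t0 + l ^ 2 * t)
    simp only [hfl]
    have h2 : HasDerivWithinAt (fun k : ℝ => l * k) l (Ici 0) 0 := by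
      simpa using ((hasDerivAt_id (0 : ℝ)).const_mul l).hasDerivWithinAt
    have h3 := HasDerivWithinAt.comp (0 : ℝ)
      (h₂ := fun k : ℝ => u (l • x + k • ee ⟨0, hn⟩, t0 + l ^ 2 * t)) (s' := Ici 0)
      (h := fun k => l * k) (by simpa using h1) h2 (fun k (hk : 0 ≤ k) => mul_nonneg hl.le hk)
    refine (h3.const_mul b).congr_deriv ?_
    rw [Real.mul_rpow hb0.le (hu.pos _ hx'.ge _).le, ← hbq]; ring
  · have hx' : (l • x) ⟨0, hn⟩ = 0 := by simp [hx]
    have h1 := hu.bdry_tendsto _ hx' (t0 + l ^ 2 * t)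
    simp only [hfl]
    have h2 : Tendsto (fun k : ℝ => l * k) (𝓝[>] 0) (𝓝[>] 0) := by
      refine tendsto_nhdsWithin_iff.2 ⟨?_, ?_⟩
      · have : Continuous fun k : ℝ => l * k := by fun_prop
        simpa using (this.tendsto 0).mono_left nhdsWithin_le_nhds
      · filter_upwards [self_mem_nhdsWithin] with k hk using mul_pos hl hk
    have h3 := ((h1.comp h2).const_mul l).const_mul b
    rw [show b * (l * -u (l • x, t0 + l ^ 2 * t) ^ q) =
      -(b * u (l • x, t0 + l ^ 2 * t)) ^ q by
        rw [Real.mul_rpow hb0.le (hu.pos _ hx'.ge _).le, ← hbq]; ring] at h3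
    refine h3.congr fun k => ?_
    have h4 := deriv_comp_mul_left l (fun k : ℝ => u (l • x + k • ee ⟨0, hn⟩, t0 + l ^ 2 * t)) k
    rw [deriv_const_mul_field, h4]
    rfl
  · have := hu.sym (l • x) (l • y) (by simp [h1]) (by
      simp only [PiLp.smul_apply, smul_eq_mul, mul_pow, ← Finset.mul_sum, h2]) (t0 + l ^ 2 * t)
    rw [this]

end

section

variable {n : ℕ} {hn : 0 < n} {q M : ℝ} {u f g : Eu n × ℝ → ℝ} {j : Fin n}

/-- The point of the plane spanned by the first and the `j`-th axis. -/
noncomputable def pt (hn : 0 < n) (j : Fin n) (x s : ℝ) : Eu n := x • ee ⟨0, hn⟩ + s • ee j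

/-- The restriction of `f` to the plane spanned by the first and the `j`-th axis. -/
noncomputable def planar (hn : 0 < n) (j : Fin n) (f : Eu n × ℝ → ℝ) (p : ℝ × ℝ × ℝ) : ℝ :=
  f (pt hn j p.1 p.2.1, p.2.2)

lemma continuous_pt : Continuous fun p : ℝ × ℝ × ℝ => (pt hn j p.1 p.2.1, p.2.2) := by
  unfold pt; fun_prop

lemma pt_apply_zero (hj : j ≠ ⟨0, hn⟩) (x s : ℝ) : pt hn j x s ⟨0, hn⟩ = x := by
  simp [pt, Ne.symm hj]

lemma pt_mem_closedHalf (hj : j ≠ ⟨0, hn⟩) {x : ℝ} (hx : 0 ≤ x) (s : ℝ) :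
    pt hn j x s ∈ closedHalf n hn := by
  change 0 ≤ pt hn j x s ⟨0, hn⟩
  rwa [pt_apply_zero hj]

lemma pt_mem_openHalf (hj : j ≠ ⟨0, hn⟩) {x : ℝ} (hx : 0 < x) (s : ℝ) :
    pt hn j x s ∈ openHalf n hn := by
  change 0 < pt hn j x s ⟨0, hn⟩
  rwa [pt_apply_zero hj]

lemma continuousOn_planar (hj : j ≠ ⟨0, hn⟩) (hf : ContinuousOn f (openHalf n hn ×ˢ univ)) :
    ContinuousOn (planar hn j f) {p | 0 < p.1} :=
  hf.comp continuous_pt.continuousOn fun _ hp => ⟨pt_mem_openHalf hj hp _, mem_univ _⟩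

lemma hasDerivAt_planar_fst
    (h : ∀ x ∈ openHalf n hn, ∀ t, HasDerivAt (fun k : ℝ => f (x + k • ee ⟨0, hn⟩, t)) (g (x, t)) 0)
    (hj : j ≠ ⟨0, hn⟩) {x : ℝ} (hx : 0 < x) (s t : ℝ) :
    HasDerivAt (fun r => planar hn j f (r, s, t)) (planar hn j g (x, s, t)) x := by
  have h1 : ∀ r, pt hn j r s = s • ee j + r • ee ⟨0, hn⟩ := fun r => add_comm _ _
  simp only [planar, h1]
  refine hasDerivAt_slice ?_
  rw [← h1]
  exact h _ (pt_mem_openHalf hj hx s) t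

lemma hasDerivAt_planar_snd
    (h : ∀ x ∈ openHalf n hn, ∀ t, HasDerivAt (fun k : ℝ => f (x + k • ee j, t)) (g (x, t)) 0)
    (hj : j ≠ ⟨0, hn⟩) {x : ℝ} (hx : 0 < x) (s t : ℝ) :
    HasDerivAt (fun r => planar hn j f (x, r, t)) (planar hn j g (x, s, t)) s :=
  hasDerivAt_slice (h _ (pt_mem_openHalf hj hx s) t)

lemma J2_sqrt {s : ℝ} (hs : 0 < s) : J2 (fun k => √(s ^ 2 + k ^ 2)) 0 (1 / s) := by
  have h1 := (J2.poly (s ^ 2) 0 1)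
  have h2 := h1.comp_left (F := Real.sqrt) (F' := fun y => 1 / (2 * √y))
    (F'' := deriv (fun y => 1 / (2 * √y)) (s ^ 2)) ?_ ?_
  · refine (h2.congr (Eventually.of_forall fun k => by simp)).cast (by simp) ?_
    simp [Real.sqrt_sq hs.le]
  · have : ∀ᶠ y in 𝓝 (s ^ 2), 0 < y := lt_mem_nhds (by positivity)
    simp only [add_zero, ne_eq, OfNat.ofNat_ne_zero, not_false_eq_true, zero_pow, mul_zero]
    filter_upwards [this] with y hy using Real.hasDerivAt_sqrt hy.ne'
  · have h3 : DifferentiableAt ℝ (fun y : ℝ => 1 / (2 * √y)) (s ^ 2) := by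
      refine (differentiableAt_const _).div ((differentiableAt_const _).mul
        (DifferentiableAt.sqrt differentiableAt_id (by simp; positivity))) ?_
      simp [Real.sqrt_sq hs.le, hs.ne']
    simpa using h3.hasDerivAt

/-- The second derivatives in the directions orthogonal to the plane. -/
lemma Sol.pd_pd_orthogonal (hu : Sol n hn q M u) (hj : j ≠ ⟨0, hn⟩) {i : Fin n}
    (hi : i ≠ ⟨0, hn⟩) (hij : i ≠ j) {x s : ℝ} (hx : 0 < x) (hs : 0 < s) (t : ℝ) :
    planar hn j (pd i (pd i u)) (x, s, t) = planar hn j (pd j u) (x, s, t) / s := by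
  have h1 := ((hu.heat _ (pt_mem_openHalf hj hx s) t).J2_pd i).1
  have h2 : ∀ k : ℝ, u (pt hn j x s + k • ee i, t) = planar hn j u (x, √(s ^ 2 + k ^ 2), t) := by
    intro k
    refine hu.sym _ _ ?_ ?_ t
    · simp [pt, Ne.symm hj, Ne.symm hi]
    · have e1 : ∀ l ∈ Finset.univ.erase (⟨0, hn⟩ : Fin n), (pt hn j x s + k • ee i) l ^ 2 =
          (if l = j then s ^ 2 else 0) + if l = i then k ^ 2 else 0 := by
        intro l hl
        have hl := Finset.ne_of_mem_erase hl
        by_cases h3 : l = j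
        · subst h3; simp [pt, hl, Ne.symm hij]
        · by_cases h4 : l = i
          · subst h4; simp [pt, h3, hl]
          · simp [pt, h3, h4, hl]
      have e2 : ∀ l ∈ Finset.univ.erase (⟨0, hn⟩ : Fin n), pt hn j x √(s ^ 2 + k ^ 2) l ^ 2 =
          if l = j then s ^ 2 + k ^ 2 else 0 := by
        intro l hl
        have hl := Finset.ne_of_mem_erase hl
        by_cases h3 : l = j
        · subst h3; simp [pt, hl, Real.sq_sqrt (by positivity : 0 ≤ s ^ 2 + k ^ 2)]
        · simp [pt, h3, hl]
      rw [Finset.sum_congr rfl e1, Finset.sum_congr rfl e2, Finset.sum_add_distrib]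
      simp [hj, hi]
  have h3 := (J2_sqrt hs).comp_left (F := fun r => planar hn j u (x, r, t))
    (F' := fun r => planar hn j (pd j u) (x, r, t))
    (F'' := planar hn j (pd j (pd j u)) (x, s, t))
    (Eventually.of_forall fun r => hasDerivAt_planar_snd
      (fun y hy t => (hu.heat y hy t).pd_spec j) hj hx r t)
    (by
      simp only [ne_eq, OfNat.ofNat_ne_zero, not_false_eq_true, zero_pow, add_zero, Real.sqrt_sq hs.le]
      exact hasDerivAt_planar_snd (fun y hy t => ((hu.heat y hy t).J2_pd j).2) hj hx s t)
  have h4 := (h1.unique (h3.congr (Eventually.of_forall h2))).2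
  simp only [ne_eq, OfNat.ofNat_ne_zero, not_false_eq_true, zero_pow, add_zero, Real.sqrt_sq hs.le,
    mul_zero, zero_add, mul_one_div] at h4
  exact h4

/-- The heat equation for axially symmetric solutions in the plane. -/
lemma Sol.planar_time_deriv (hu : Sol n hn q M u) (hj : j ≠ ⟨0, hn⟩) {x s : ℝ} (hx : 0 < x)
    (hs : 0 < s) (t : ℝ) : HasDerivAt (fun r => planar hn j u (x, s, r))
      (planar hn j (pd ⟨0, hn⟩ (pd ⟨0, hn⟩ u)) (x, s, t) + planar hn j (pd j (pd j u)) (x, s, t) +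
        ((n - 2 : ℕ) : ℝ) / s * planar hn j (pd j u) (x, s, t)) t := by
  have h1 := (hu.heat _ (pt_mem_openHalf hj hx s) t).time_deriv
  refine h1.congr_deriv ?_
  rw [← Finset.add_sum_erase _ _ (Finset.mem_univ (⟨0, hn⟩ : Fin n)),
    ← Finset.add_sum_erase _ _ (Finset.mem_erase.2 ⟨hj, Finset.mem_univ j⟩),
    Finset.sum_congr rfl (g := fun _ => planar hn j (pd j u) (x, s, t) / s) (fun i hi => ?_),
    Finset.sum_const, Finset.card_erase_of_mem (Finset.mem_erase.2 ⟨hj, Finset.mem_univ j⟩),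
    Finset.card_erase_of_mem (Finset.mem_univ _), Finset.card_univ, Fintype.card_fin, nsmul_eq_mul,
    Nat.sub_sub]
  · simp only [planar]; ring
  · simp only [Finset.mem_erase, Finset.mem_univ, and_true] at hi
    exact hu.pd_pd_orthogonal hj hi.2 hi.1 hx hs t

/-- The slope of the solution in the normal direction. -/
lemma Sol.pd_le_neg_rpow (hu : Sol n hn q M u) (hq : 1 < q) {x : Eu n} (hx : x ∈ openHalf n hn)
    (t : ℝ) : u (x, t) ^ q ≤ -pd ⟨0, hn⟩ u (x, t) := by
  have hx' : x ∈ closedHalf n hn := le_of_lt (show 0 < x ⟨0, hn⟩ from hx)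
  have h0 := hu.pos x hx' t
  have h1 := (hu.heat x hx t).pd_spec ⟨0, hn⟩
  have h2 : HasDerivAt (fun k => flow q k (u (x, t))) (-u (x, t) ^ q) 0 := by
    have hb := flow_base_pos hq le_rfl h0
    have h3 := ((hasDerivAt_id (0 : ℝ)).const_mul (q - 1)).const_add (u (x, t) ^ (1 - q))
    have h4 := h3.rpow_const (p := -(1 / (q - 1))) (Or.inl (by simpa using hb.ne'))
    refine h4.congr_deriv ?_
    have hq1 : q - 1 ≠ 0 := by linarith
    simp only [id, mul_zero, add_zero, mul_one]
    rw [← Real.rpow_mul h0.le, show (1 - q) * (-(1 / (q - 1)) - 1) = q by field_simp; ring]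
    field_simp
  have h3 := ((h1.sub h2).hasDerivWithinAt (s := Ici 0)).nonpos_of_right_max (by
    filter_upwards [self_mem_nhdsWithin] with k hk
    have := hu.le_flow hq hx' (le_of_lt hk) t
    simp only [Pi.sub_apply, zero_smul, add_zero, flow_zero hq h0, sub_self]
    linarith)
  linarith

end

section
open MeasureTheory

lemma hasDerivAt_integral_unit {U : Set ℝ} (hU : IsOpen U) {f g : ℝ → ℝ → ℝ} {x : ℝ} (hx : x ∈ U)
    (hf : ContinuousOn (fun p : ℝ × ℝ => f p.1 p.2) (U ×ˢ univ))
    (hg : ContinuousOn (fun p : ℝ × ℝ => g p.1 p.2) (U ×ˢ univ))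
    (hd : ∀ r ∈ U, ∀ τ, HasDerivAt (fun r => f r τ) (g r τ) r) :
    HasDerivAt (fun r => ∫ τ in (0:ℝ)..1, f r τ) (∫ τ in (0:ℝ)..1, g x τ) x := by
  obtain ⟨ε, hε, hεU⟩ := Metric.nhds_basis_closedBall.mem_iff.1 (hU.mem_nhds hx)
  obtain ⟨C, hC⟩ := ((isCompact_closedBall x ε).prod (isCompact_Icc (a := (0:ℝ)) (b := 1)))
    |>.exists_bound_of_continuousOn (hg.mono (prod_mono hεU (subset_univ _)))
  have hfc : ∀ r ∈ U, Continuous (f r) := fun r hr =>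
    hf.comp_continuous (f := fun τ => (r, τ)) (by fun_prop) fun τ => ⟨hr, mem_univ _⟩
  have hgc : ∀ r ∈ U, Continuous (g r) := fun r hr =>
    hg.comp_continuous (f := fun τ => (r, τ)) (by fun_prop) fun τ => ⟨hr, mem_univ _⟩
  refine (intervalIntegral.hasDerivAt_integral_of_dominated_loc_of_deriv_le
    (Metric.closedBall_mem_nhds x hε) (bound := fun _ => C) ?_ ((hfc x hx).intervalIntegrable _ _)
    (hgc x hx).aestronglyMeasurable (Eventually.of_forall fun τ hτ r hr => ?_)
    intervalIntegrable_const (Eventually.of_forall fun τ _ r hr => hd r (hεU hr) τ)).2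
  · filter_upwards [hU.mem_nhds hx] with r hr using (hfc r hr).aestronglyMeasurable
  · rw [uIoc_of_le zero_le_one] at hτ
    exact hC (r, τ) ⟨hr, hτ.1.le, hτ.2⟩

/-- The time average of `f`, shifted in the first variable. -/
noncomputable def stek (δ h : ℝ) (f : ℝ × ℝ × ℝ → ℝ) (p : ℝ × ℝ × ℝ) : ℝ :=
  ∫ τ in (0:ℝ)..1, f (p.1 + δ, p.2.1, p.2.2 + h * τ)

/-- The forward difference quotient in time, shifted in the first variable. -/
noncomputable def tdq (δ h : ℝ) (f : ℝ × ℝ × ℝ → ℝ) (p : ℝ × ℝ × ℝ) : ℝ :=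
  (f (p.1 + δ, p.2.1, p.2.2 + h) - f (p.1 + δ, p.2.1, p.2.2)) / h

variable {δ h : ℝ} {f g : ℝ × ℝ × ℝ → ℝ}

lemma continuousOn_stek (hf : ContinuousOn f {p | 0 < p.1}) :
    ContinuousOn (stek δ h f) {p | 0 < p.1 + δ} := by
  rw [continuousOn_iff_continuous_domRestrict]
  refine intervalIntegral.continuous_parametric_intervalIntegral_of_continuous'
    (f := fun (p : {p : ℝ × ℝ × ℝ // 0 < p.1 + δ}) τ => f (p.1.1 + δ, p.1.2.1, p.1.2.2 + h * τ)) ?_ 0 1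
  exact hf.comp_continuous (f := fun z : {p : ℝ × ℝ × ℝ // 0 < p.1 + δ} × ℝ =>
    (z.1.1.1 + δ, z.1.1.2.1, z.1.1.2.2 + h * z.2)) (by fun_prop) fun z => z.1.2

lemma continuousOn_tdq (hf : ContinuousOn f {p | 0 < p.1}) :
    ContinuousOn (tdq δ h f) {p | 0 < p.1 + δ} := by
  unfold tdq
  exact ((hf.comp (f := fun p : ℝ × ℝ × ℝ => (p.1 + δ, p.2.1, p.2.2 + h)) (by fun_prop)
    fun p hp => hp).sub (hf.comp (f := fun p : ℝ × ℝ × ℝ => (p.1 + δ, p.2.1, p.2.2)) (by fun_prop)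
    fun p hp => hp)).div_const _

lemma hasDerivAt_stek_fst (hf : ContinuousOn f {p | 0 < p.1}) (hg : ContinuousOn g {p | 0 < p.1})
    (hd : ∀ x > 0, ∀ s t, HasDerivAt (fun r => f (r, s, t)) (g (x, s, t)) x) {x : ℝ}
    (hx : 0 < x + δ) (s t : ℝ) :
    HasDerivAt (fun r => stek δ h f (r, s, t)) (stek δ h g (x, s, t)) x := by
  refine hasDerivAt_integral_unit (U := {r | 0 < r + δ})
    (isOpen_lt continuous_const (by fun_prop)) (f := fun r τ => f (r + δ, s, t + h * τ))
    (g := fun r τ => g (r + δ, s, t + h * τ)) hx ?_ ?_ fun r hr τ => ?_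
  · exact hf.comp (f := fun z : ℝ × ℝ => (z.1 + δ, s, t + h * z.2)) (by fun_prop) fun z hz => hz.1
  · exact hg.comp (f := fun z : ℝ × ℝ => (z.1 + δ, s, t + h * z.2)) (by fun_prop) fun z hz => hz.1
  · exact (hd (r + δ) hr s (t + h * τ)).comp_add_const r δ

lemma hasDerivAt_stek_snd (hf : ContinuousOn f {p | 0 < p.1}) (hg : ContinuousOn g {p | 0 < p.1})
    (hd : ∀ x > 0, ∀ s t, HasDerivAt (fun r => f (x, r, t)) (g (x, s, t)) s) {x : ℝ}
    (hx : 0 < x + δ) (s t : ℝ) :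
    HasDerivAt (fun r => stek δ h f (x, r, t)) (stek δ h g (x, s, t)) s := by
  refine hasDerivAt_integral_unit (U := univ)
    isOpen_univ (f := fun r τ => f (x + δ, r, t + h * τ))
    (g := fun r τ => g (x + δ, r, t + h * τ)) (mem_univ s) ?_ ?_ fun r hr τ => hd _ hx r _
  · exact hf.comp (f := fun z : ℝ × ℝ => (x + δ, z.1, t + h * z.2)) (by fun_prop) fun z hz => hx
  · exact hg.comp (f := fun z : ℝ × ℝ => (x + δ, z.1, t + h * z.2)) (by fun_prop) fun z hz => hx

lemma hasDerivAt_average {φ : ℝ → ℝ} (hφ : Continuous φ) (hh : h ≠ 0) (t : ℝ) :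
    HasDerivAt (fun t => ∫ τ in (0:ℝ)..1, φ (t + h * τ)) ((φ (t + h) - φ t) / h) t := by
  have h1 : ∀ t, ∫ τ in (0:ℝ)..1, φ (t + h * τ) =
      ((∫ r in (0:ℝ)..(t + h), φ r) - ∫ r in (0:ℝ)..t, φ r) / h := by
    intro t
    have := intervalIntegral.mul_integral_comp_add_mul (a := 0) (b := 1) (f := φ) h t
    rw [eq_div_iff hh, mul_comm, this, intervalIntegral.integral_interval_sub_left
      (hφ.intervalIntegrable _ _) (hφ.intervalIntegrable _ _)]
    simp
  simp only [h1]
  have h2 : ∀ r, HasDerivAt (fun r => ∫ y in (0:ℝ)..r, φ y) (φ r) r := fun r =>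
    intervalIntegral.integral_hasDerivAt_right (hφ.intervalIntegrable _ _)
      (hφ.stronglyMeasurableAtFilter _ _) hφ.continuousAt
  exact (((h2 (t + h)).comp_add_const t h).fun_sub (h2 t)).div_const h

lemma continuous_time (hf : ContinuousOn f {p | 0 < p.1}) {x : ℝ} (hx : 0 < x) (s : ℝ) :
    Continuous fun t => f (x, s, t) :=
  hf.comp_continuous (f := fun t => (x, s, t)) (by fun_prop) fun _ => hx

lemma hasDerivAt_stek_time (hf : ContinuousOn f {p | 0 < p.1}) (hh : h ≠ 0) {x : ℝ}
    (hx : 0 < x + δ) (s t : ℝ) :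
    HasDerivAt (fun r => stek δ h f (x, s, r)) (tdq δ h f (x, s, t)) t :=
  hasDerivAt_average (φ := fun r => f (x + δ, s, r)) (continuous_time hf hx s) hh t

lemma hasDerivAt_tdq_fst
    (hd : ∀ x > 0, ∀ s t, HasDerivAt (fun r => f (r, s, t)) (g (x, s, t)) x) {x : ℝ}
    (hx : 0 < x + δ) (s t : ℝ) :
    HasDerivAt (fun r => tdq δ h f (r, s, t)) (tdq δ h g (x, s, t)) x :=
  (((hd _ hx s (t + h)).comp_add_const x δ).fun_sub
    ((hd _ hx s t).comp_add_const x δ)).div_const h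

lemma hasDerivAt_tdq_snd
    (hd : ∀ x > 0, ∀ s t, HasDerivAt (fun r => f (x, r, t)) (g (x, s, t)) s) {x : ℝ}
    (hx : 0 < x + δ) (s t : ℝ) :
    HasDerivAt (fun r => tdq δ h f (x, r, t)) (tdq δ h g (x, s, t)) s :=
  ((hd _ hx s (t + h)).fun_sub (hd _ hx s t)).div_const h

/-- The difference quotient is the average of the derivative. -/
lemma tdq_eq_stek (hg : ContinuousOn g {p | 0 < p.1}) (hh : h ≠ 0) {x s : ℝ} (hx : 0 < x + δ)
    (hd : ∀ t, HasDerivAt (fun r => f (x + δ, s, r)) (g (x + δ, s, t)) t) (t : ℝ) :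
    tdq δ h f (x, s, t) = stek δ h g (x, s, t) := by
  have h1 := intervalIntegral.integral_eq_sub_of_hasDerivAt (a := t) (b := t + h)
    (fun r _ => hd r) ((continuous_time hg hx s).intervalIntegrable _ _)
  have h2 := intervalIntegral.mul_integral_comp_add_mul (a := 0) (b := 1)
    (f := fun r => g (x + δ, s, r)) h t
  rw [tdq, div_eq_iff hh, ← h1, mul_comm, stek, h2]
  simp

lemma le_stek (hf : ContinuousOn f {p | 0 < p.1}) {x s t a : ℝ} (hx : 0 < x + δ)
    (ha : ∀ τ ∈ Icc (0:ℝ) 1, a ≤ f (x + δ, s, t + h * τ)) : a ≤ stek δ h f (x, s, t) := by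
  have hc := continuous_time hf hx s
  have := intervalIntegral.integral_mono_on (μ := volume) (a := 0) (b := 1) (f := fun _ => a)
    (g := fun τ => f (x + δ, s, t + h * τ)) zero_le_one intervalIntegrable_const
    ((hc.comp (by fun_prop : Continuous fun τ : ℝ => t + h * τ)).intervalIntegrable _ _) ha
  simpa [stek] using this

lemma stek_le (hf : ContinuousOn f {p | 0 < p.1}) {x s t a : ℝ} (hx : 0 < x + δ)
    (ha : ∀ τ ∈ Icc (0:ℝ) 1, f (x + δ, s, t + h * τ) ≤ a) : stek δ h f (x, s, t) ≤ a := by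
  have hc := continuous_time hf hx s
  have := intervalIntegral.integral_mono_on (μ := volume) (a := 0) (b := 1) (g := fun _ => a)
    (f := fun τ => f (x + δ, s, t + h * τ)) zero_le_one
    ((hc.comp (by fun_prop : Continuous fun τ : ℝ => t + h * τ)).intervalIntegrable _ _)
    intervalIntegrable_const ha
  simpa [stek] using this

end

section
open MeasureTheory

lemma rpow_sub_rpow_le_tangent {q a b : ℝ} (hq : 1 < q) (ha : 0 < a) (hb : 0 < b) :
    a ^ q - b ^ q ≤ q * (a ^ (q - 1) * (a - b)) := by
  have h1 : 1 + q * (b / a - 1) ≤ (b / a) ^ q := by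
    have := one_add_mul_self_le_rpow_one_add (s := b / a - 1) (p := q)
      (by have : 0 < b / a := by positivity
          linarith) hq.le
    simpa using this
  have h2 : a ^ q * (1 + q * (b / a - 1)) ≤ b ^ q := by
    calc a ^ q * (1 + q * (b / a - 1)) ≤ a ^ q * (b / a) ^ q := by gcongr
      _ = b ^ q := by rw [← Real.mul_rpow ha.le (by positivity)]; congr 1; field_simp
  have h3 : a ^ q = a ^ (q - 1) * a := by
    rw [← Real.rpow_add_one ha.ne']; congr 1; ring
  have : a ^ q * (1 + q * (b / a - 1)) = a ^ q - q * (a ^ (q - 1) * (a - b)) := by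
    rw [h3]; field_simp; ring
  linarith

lemma integral_unit_pos {φ : ℝ → ℝ} (hφ : Continuous φ) (h0 : ∀ τ, 0 < φ τ) :
    0 < ∫ τ in (0:ℝ)..1, φ τ :=
  intervalIntegral.intervalIntegral_pos_of_pos_on (hφ.intervalIntegrable _ _)
    (fun τ _ => h0 τ) zero_lt_one

lemma integral_rpow_ge {φ : ℝ → ℝ} {q : ℝ} (hq : 1 < q) (hφ : Continuous φ) (h0 : ∀ τ, 0 < φ τ) :
    (∫ τ in (0:ℝ)..1, φ τ) ^ q ≤ ∫ τ in (0:ℝ)..1, φ τ ^ q := by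
  have hp := integral_unit_pos hφ h0
  set y := ∫ τ in (0:ℝ)..1, φ τ with hy
  have hc : Continuous fun τ => φ τ ^ q := hφ.rpow_const fun τ => Or.inl (h0 τ).ne'
  have h1 := intervalIntegral.integral_mono_on (μ := volume) (a := 0) (b := 1) (f := fun τ => y ^ q - φ τ ^ q)
    (g := fun τ => q * (y ^ (q - 1) * (y - φ τ))) zero_le_one
    ((continuous_const.sub hc).intervalIntegrable _ _)
    ((by fun_prop : Continuous fun τ => q * (y ^ (q - 1) * (y - φ τ))).intervalIntegrable _ _)
    fun τ _ => rpow_sub_rpow_le_tangent hq hp (h0 τ)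
  rw [intervalIntegral.integral_sub intervalIntegrable_const (hc.intervalIntegrable _ _),
    intervalIntegral.integral_const_mul, intervalIntegral.integral_const_mul,
    intervalIntegral.integral_sub intervalIntegrable_const (hφ.intervalIntegrable _ _), ← hy] at h1
  simp only [intervalIntegral.integral_const, sub_zero, one_smul, sub_self, mul_zero] at h1
  linarith

lemma integral_rpow_sub_le {φ : ℝ → ℝ} {q ω o : ℝ} (hq : 1 < q) (hφ : Continuous φ)
    (h0 : ∀ τ, 0 < φ τ)
    (h1 : ∀ τ ∈ Icc (0:ℝ) 1, |φ τ ^ (q - 1) - (∫ τ in (0:ℝ)..1, φ τ) ^ (q - 1)| ≤ ω)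
    (h2 : ∀ τ ∈ Icc (0:ℝ) 1, |φ τ - ∫ τ in (0:ℝ)..1, φ τ| ≤ o) :
    (∫ τ in (0:ℝ)..1, φ τ ^ q) - (∫ τ in (0:ℝ)..1, φ τ) ^ q ≤ q * (ω * o) := by
  have hp := integral_unit_pos hφ h0
  set y := ∫ τ in (0:ℝ)..1, φ τ with hy
  have hc : Continuous fun τ => φ τ ^ q := hφ.rpow_const fun τ => Or.inl (h0 τ).ne'
  have h4 : ∫ τ in (0:ℝ)..1, q * (y ^ (q - 1) * (φ τ - y)) = 0 := by
    rw [intervalIntegral.integral_const_mul, intervalIntegral.integral_const_mul,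
      intervalIntegral.integral_sub (hφ.intervalIntegrable _ _) intervalIntegrable_const, ← hy]
    simp
  have h3 := intervalIntegral.integral_mono_on (μ := volume) (a := 0) (b := 1) (f := fun τ => φ τ ^ q - y ^ q)
    (g := fun τ => q * (ω * o) + q * (y ^ (q - 1) * (φ τ - y))) zero_le_one
    ((hc.sub continuous_const).intervalIntegrable _ _)
    ((by fun_prop : Continuous fun τ =>
      q * (ω * o) + q * (y ^ (q - 1) * (φ τ - y))).intervalIntegrable _ _)
    fun τ hτ => by
      have e1 := rpow_sub_rpow_le_tangent hq (h0 τ) hp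
      have e2 : (φ τ ^ (q - 1) - y ^ (q - 1)) * (φ τ - y) ≤ ω * o :=
        (le_abs_self _).trans (by
          rw [abs_mul]
          exact mul_le_mul (h1 τ hτ) (h2 τ hτ) (abs_nonneg _) ((abs_nonneg _).trans (h1 τ hτ)))
      have e3 : q * ((φ τ ^ (q - 1) - y ^ (q - 1)) * (φ τ - y)) ≤ q * (ω * o) := by gcongr
      linarith
  rw [intervalIntegral.integral_sub (hc.intervalIntegrable _ _) intervalIntegrable_const,
    intervalIntegral.integral_add intervalIntegrable_const
      ((by fun_prop : Continuous fun τ => q * (y ^ (q - 1) * (φ τ - y))).intervalIntegrable _ _),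
    h4] at h3
  simp only [intervalIntegral.integral_const, sub_zero, one_smul, add_zero] at h3
  linarith

variable {n : ℕ} {hn : 0 < n} {q M : ℝ} {u : Eu n × ℝ → ℝ} {j : Fin n}

lemma Sol.continuousOn_planar_self (hu : Sol n hn q M u) (hj : j ≠ ⟨0, hn⟩) :
    ContinuousOn (planar hn j u) {p | 0 < p.1} :=
  continuousOn_planar hj (hu.cont.mono
    (prod_mono (fun x hx => le_of_lt (show 0 < x ⟨0, hn⟩ from hx)) subset_rfl))

lemma Sol.rpow_stek_le (hu : Sol n hn q M u) (hq : 1 < q) (hj : j ≠ ⟨0, hn⟩) {δ h : ℝ}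
    (hδ : 0 < δ) (s t : ℝ) : stek δ h (planar hn j u) (0, s, t) ^ q ≤
      -stek δ h (planar hn j (pd ⟨0, hn⟩ u)) (0, s, t) := by
  have hδ' : 0 < 0 + δ := by linarith
  have hpt : ∀ t, 0 < planar hn j u (0 + δ, s, t) := fun t =>
    hu.pos _ (pt_mem_closedHalf hj hδ'.le s) t
  have hc1 := (continuous_time (hu.continuousOn_planar_self hj) hδ' s).comp
    (by fun_prop : Continuous fun τ : ℝ => t + h * τ)
  have hc2 := (continuous_time (continuousOn_planar hj (hu.continuousOn_pd ⟨0, hn⟩)) hδ' s).comp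
    (by fun_prop : Continuous fun τ : ℝ => t + h * τ)
  refine (integral_rpow_ge hq hc1 fun τ => hpt _).trans ?_
  rw [stek, ← intervalIntegral.integral_neg]
  refine intervalIntegral.integral_mono_on zero_le_one
    ((hc1.rpow_const fun τ => Or.inl (hpt _).ne').intervalIntegrable _ _)
    (hc2.neg.intervalIntegrable _ _) fun τ _ => ?_
  exact hu.pd_le_neg_rpow hq (pt_mem_openHalf hj hδ' s) _

/-- Time averages of an axially symmetric solution. -/
noncomputable def Sol.flat (hu : Sol n hn q M u) (hq : 1 < q) (hj : j ≠ ⟨0, hn⟩) {ρ δ h B : ℝ}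
    (hρ : 1 < ρ) (hδ : 0 < δ) (hh : h ≠ 0) (hB : ∀ x, 0 < x → ∀ s ∈ Icc (ρ - 1) (ρ + 1), ∀ t,
      planar hn j u (x, s, t) ≤ B) : Flat (n - 2) ρ q B :=
  have c := hu.continuousOn_planar_self hj
  have cx := continuousOn_planar hj (hu.continuousOn_pd ⟨0, hn⟩)
  have cs := continuousOn_planar hj (hu.continuousOn_pd j)
  have cxx := continuousOn_planar hj (hu.continuousOn_pd_pd ⟨0, hn⟩)
  have css := continuousOn_planar hj (hu.continuousOn_pd_pd j)
  have dx := fun x (hx : 0 < x) s t => hasDerivAt_planar_fst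
    (fun y hy t => (hu.heat y hy t).pd_spec ⟨0, hn⟩) hj hx s t
  have ds := fun x (hx : 0 < x) s t => hasDerivAt_planar_snd
    (fun y hy t => (hu.heat y hy t).pd_spec j) hj hx s t
  have dxx := fun x (hx : 0 < x) s t => hasDerivAt_planar_fst
    (fun y hy t => ((hu.heat y hy t).J2_pd ⟨0, hn⟩).2) hj hx s t
  have dss := fun x (hx : 0 < x) s t => hasDerivAt_planar_snd
    (fun y hy t => ((hu.heat y hy t).J2_pd j).2) hj hx s t
  have hsub : Icc 0 1 ×ˢ Icc (ρ - 1) (ρ + 1) ×ˢ univ ⊆ {p : ℝ × ℝ × ℝ | 0 < p.1 + δ} :=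
    fun _ hp => add_pos_of_nonneg_of_pos hp.1.1 hδ
  have hpos : ∀ x ∈ Icc (0 : ℝ) 1, 0 < x + δ := fun _ hx => add_pos_of_nonneg_of_pos hx.1 hδ
  have hpt : ∀ x, 0 < x → ∀ s t, 0 < planar hn j u (x, s, t) := fun _ hx s t =>
    hu.pos _ (pt_mem_closedHalf hj hx.le s) t
  { w := stek δ h (planar hn j u)
    wx := stek δ h (planar hn j (pd ⟨0, hn⟩ u))
    ws := stek δ h (planar hn j (pd j u))
    wxx := stek δ h (planar hn j (pd ⟨0, hn⟩ (pd ⟨0, hn⟩ u)))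
    wss := stek δ h (planar hn j (pd j (pd j u)))
    wt := tdq δ h (planar hn j u)
    wxt := tdq δ h (planar hn j (pd ⟨0, hn⟩ u))
    wst := tdq δ h (planar hn j (pd j u))
    cw := (continuousOn_stek c).mono hsub
    cwx := (continuousOn_stek cx).mono hsub
    cws := (continuousOn_stek cs).mono hsub
    cwxx := (continuousOn_stek cxx).mono hsub
    cwt := (continuousOn_tdq c).mono hsub
    cwxt := (continuousOn_tdq cx).mono hsub
    cwst := (continuousOn_tdq cs).mono hsub
    dx := fun x hx s _ t => hasDerivAt_stek_fst c cx dx (hpos x hx) s t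
    ds := fun x hx s _ t => hasDerivAt_stek_snd c cs ds (hpos x hx) s t
    dt := fun x hx s _ t => hasDerivAt_stek_time c hh (hpos x hx) s t
    dxx := fun x hx s _ t => hasDerivAt_stek_fst cx cxx dxx (hpos x hx) s t
    dss := fun x hx s _ t => hasDerivAt_stek_snd cs css dss (hpos x hx) s t
    dxt := fun x hx s _ t => hasDerivAt_stek_time cx hh (hpos x hx) s t
    dst := fun x hx s _ t => hasDerivAt_stek_time cs hh (hpos x hx) s t
    dtx := fun x hx s _ t => hasDerivAt_tdq_fst dx (hpos x hx) s t
    dts := fun x hx s _ t => hasDerivAt_tdq_snd ds (hpos x hx) s t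
    eq := by
      intro x hx s hs t
      have hs0 : 0 < s := by linarith [hs.1]
      have hx' := hpos x hx
      have cm : ContinuousOn (fun p => ((n - 2 : ℕ) : ℝ) / s * planar hn j (pd j u) p)
          {p | 0 < p.1} := continuousOn_const.mul cs
      rw [tdq_eq_stek ((cxx.add css).add cm) hh hx'
        (fun r => hu.planar_time_deriv hj hx' hs0 r) t]
      have i : ∀ {f : ℝ × ℝ × ℝ → ℝ}, ContinuousOn f {p | 0 < p.1} →
          IntervalIntegrable (fun τ => f (x + δ, s, t + h * τ)) volume 0 1 := fun hf =>
        ((continuous_time hf hx' s).comp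
          (by fun_prop : Continuous fun τ : ℝ => t + h * τ)).intervalIntegrable _ _
      simp only [stek, Pi.add_apply]
      rw [intervalIntegral.integral_add ((i cxx).add (i css)) (i cm),
        intervalIntegral.integral_add (i cxx) (i css), intervalIntegral.integral_const_mul]
    pos := by
      intro x hx s hs t
      exact integral_unit_pos ((continuous_time c (hpos x hx) s).comp
          (by fun_prop : Continuous fun τ : ℝ => t + h * τ)) fun τ => hpt _ (hpos x hx) s _
    le := fun x hx s hs t => stek_le c (hpos x hx) fun τ _ => hB _ (hpos x hx) s hs _
    flux := fun s _ t => hu.rpow_stek_le hq hj hδ s t }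

end

section
open MeasureTheory

variable {n : ℕ} {hn : 0 < n} {q M : ℝ} {u : Eu n × ℝ → ℝ} {j : Fin n}

lemma Sol.tendsto_planar_pd (hu : Sol n hn q M u) (hj : j ≠ ⟨0, hn⟩) (s t : ℝ) :
    Tendsto (fun δ => planar hn j (pd ⟨0, hn⟩ u) (δ, s, t)) (𝓝[>] 0)
      (𝓝 (-(planar hn j u (0, s, t) ^ q))) := by
  refine (hu.bdry_tendsto (pt hn j 0 s) (pt_apply_zero hj 0 s) t).congr' ?_
  filter_upwards [self_mem_nhdsWithin] with δ hδ
  have h1 : pt hn j 0 s + δ • ee ⟨0, hn⟩ = pt hn j δ s := by simp [pt, add_comm]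
  refine (hasDerivAt_slice (v := u) ?_).deriv
  rw [h1]
  exact (hu.heat _ (pt_mem_openHalf hj hδ s) t).pd_spec _

lemma Sol.abs_planar_sub_le (hu : Sol n hn q M u) (hj : j ≠ ⟨0, hn⟩) {δ : ℝ} (hδ : 0 ≤ δ)
    (s t : ℝ) : |planar hn j u (δ, s, t) - planar hn j u (0, s, t)| ≤ M * δ := by
  refine (hu.lip _ (pt_mem_closedHalf hj hδ s) _ (pt_mem_closedHalf hj le_rfl s) t).trans_eq ?_
  have : pt hn j δ s - pt hn j 0 s = δ • ee ⟨0, hn⟩ := by simp [pt]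
  rw [this, norm_smul_ee, abs_of_nonneg hδ]

lemma Sol.tendsto_planar (hu : Sol n hn q M u) (hj : j ≠ ⟨0, hn⟩) (s t : ℝ) :
    Tendsto (fun δ => planar hn j u (δ, s, t)) (𝓝[>] 0) (𝓝 (planar hn j u (0, s, t))) := by
  rw [tendsto_iff_norm_sub_tendsto_zero]
  have h1 : Tendsto (fun δ : ℝ => M * δ) (𝓝[>] 0) (𝓝 0) := by
    have : Continuous fun δ : ℝ => M * δ := by fun_prop
    simpa using (this.tendsto 0).mono_left nhdsWithin_le_nhds
  refine squeeze_zero' (Eventually.of_forall fun _ => norm_nonneg _) ?_ h1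
  filter_upwards [self_mem_nhdsWithin] with δ hδ
  exact hu.abs_planar_sub_le hj (le_of_lt hδ) s t

lemma Sol.continuous_planar_time (hu : Sol n hn q M u) (hj : j ≠ ⟨0, hn⟩) {x : ℝ} (hx : 0 ≤ x)
    (s : ℝ) : Continuous fun t => planar hn j u (x, s, t) :=
  hu.cont.comp_continuous (f := fun t : ℝ => (pt hn j x s, t)) (by fun_prop)
    fun _ => ⟨pt_mem_closedHalf hj hx s, mem_univ _⟩

lemma abs_sub_integral_unit_le {φ : ℝ → ℝ} (hφ : Continuous φ) {y o : ℝ}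
    (h : ∀ τ ∈ Icc (0:ℝ) 1, |φ τ - y| ≤ o) : |y - ∫ τ in (0:ℝ)..1, φ τ| ≤ o := by
  have h1 := intervalIntegral.integral_mono_on (μ := volume) (a := 0) (b := 1) (f := φ)
    (g := fun _ => y + o) zero_le_one (hφ.intervalIntegrable _ _) intervalIntegrable_const
    fun τ hτ => by linarith [(abs_le.1 (h τ hτ)).2]
  have h2 := intervalIntegral.integral_mono_on (μ := volume) (a := 0) (b := 1) (g := φ)
    (f := fun _ => y - o) zero_le_one intervalIntegrable_const (hφ.intervalIntegrable _ _)
    fun τ hτ => by linarith [(abs_le.1 (h τ hτ)).1]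
  simp only [intervalIntegral.integral_const, sub_zero, one_smul] at h1 h2
  exact abs_le.2 ⟨by linarith, by linarith⟩

lemma exists_rpow_modulus {p M ω : ℝ} (hp : 0 < p) (hω : 0 < ω) : ∃ θ > 0,
    ∀ a ∈ Icc 0 M, ∀ b ∈ Icc 0 M, |a - b| < θ → |a ^ p - b ^ p| ≤ ω := by
  have h1 : ContinuousOn (fun r : ℝ => r ^ p) (Icc 0 M) :=
    (Real.continuous_rpow_const hp.le).continuousOn
  have h2 := isCompact_Icc.uniformContinuousOn_of_continuous h1
  obtain ⟨θ, hθ, h3⟩ := Metric.uniformContinuousOn_iff.1 h2 ω hω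
  exact ⟨θ, hθ, fun a ha b hb hab => (h3 a ha b hb hab).le⟩

/-- The constant of the time regularity of solutions. -/
noncomputable def timeConst (n : ℕ) (M : ℝ) : ℝ := 2 * M + 4 * n * (M * (2 * n + 3))

lemma Sol.timeConst_pos (hu : Sol n hn q M u) : 0 < timeConst n M := by
  have := hu.M_pos
  unfold timeConst; positivity

lemma Sol.abs_planar_time_sub_le (hu : Sol n hn q M u) (hj : j ≠ ⟨0, hn⟩) {x : ℝ} (hx : 0 ≤ x)
    {s t t' h : ℝ} (hh : 0 < h) (ht : |t' - t| ≤ h) :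
    |planar hn j u (x, s, t') - planar hn j u (x, s, t)| ≤ timeConst n M * √h :=
  hu.time_holder (pt_mem_closedHalf hj hx s) (Real.sqrt_pos.2 hh) t' (by rwa [Real.sq_sqrt hh.le])

lemma abs_mul_sub_mul_le {h a b : ℝ} (hh : 0 < h) (ha : a ∈ Icc (0:ℝ) 1) (hb : b ∈ Icc (0:ℝ) 1)
    (t : ℝ) : |t + h * a - (t + h * b)| ≤ h := by
  have h1 : |a - b| ≤ 1 := abs_le.2 ⟨by linarith [ha.1, hb.2], by linarith [ha.2, hb.1]⟩
  calc |t + h * a - (t + h * b)| = h * |a - b| := by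
        rw [← abs_of_pos hh, ← abs_mul, abs_of_pos hh]; congr 1; ring
    _ ≤ h * 1 := by gcongr
    _ = h := mul_one h

/-- The gap in Jensen's inequality for time averages on short intervals. -/
lemma Sol.eventually_gap_le (hu : Sol n hn q M u) (hq : 1 < q) (hj : j ≠ ⟨0, hn⟩) {ε : ℝ}
    (hε : 0 < ε) : ∀ᶠ h in 𝓝[>] (0:ℝ), ∀ s t,
      (∫ τ in (0:ℝ)..1, planar hn j u (0, s, t + h * τ) ^ q) -
        (∫ τ in (0:ℝ)..1, planar hn j u (0, s, t + h * τ)) ^ q ≤ ε * √h := by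
  have hC := hu.timeConst_pos
  set C := timeConst n M
  have hq0 : 0 < q := by linarith
  obtain ⟨θ, hθ, hmod⟩ := exists_rpow_modulus (M := M) (sub_pos.2 hq)
    (by positivity : 0 < ε / (q * C))
  have h1 : Tendsto (fun h : ℝ => C * √h) (𝓝[>] 0) (𝓝 0) := by
    have : Continuous fun h : ℝ => C * √h := by fun_prop
    simpa using (this.tendsto 0).mono_left nhdsWithin_le_nhds
  filter_upwards [h1.eventually_lt_const hθ, self_mem_nhdsWithin] with h hh hh0 s t
  have hh0 : 0 < h := hh0
  have hc := (hu.continuous_planar_time hj le_rfl s).comp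
    (by fun_prop : Continuous fun τ : ℝ => t + h * τ)
  have hpos : ∀ τ, 0 < planar hn j u (0, s, t + h * τ) := fun τ =>
    hu.pos _ (pt_mem_closedHalf hj le_rfl s) _
  have hle : ∀ τ, planar hn j u (0, s, t + h * τ) ≤ M := fun τ =>
    hu.le _ (pt_mem_closedHalf hj le_rfl s) _
  have hosc : ∀ τ ∈ Icc (0:ℝ) 1, |planar hn j u (0, s, t + h * τ) -
      ∫ τ in (0:ℝ)..1, planar hn j u (0, s, t + h * τ)| ≤ C * √h := fun τ hτ =>
    abs_sub_integral_unit_le hc fun τ' hτ' =>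
      hu.abs_planar_time_sub_le hj le_rfl hh0 (abs_mul_sub_mul_le hh0 hτ' hτ t)
  have havg : (∫ τ in (0:ℝ)..1, planar hn j u (0, s, t + h * τ)) ∈ Icc 0 M := by
    refine ⟨(integral_unit_pos hc hpos).le, ?_⟩
    have := intervalIntegral.integral_mono_on (μ := volume) (a := 0) (b := 1) (g := fun _ => M)
      zero_le_one (hc.intervalIntegrable _ _) intervalIntegrable_const fun τ _ => hle τ
    simpa using this
  refine (integral_rpow_sub_le hq hc hpos (ω := ε / (q * C)) (fun τ hτ =>
    hmod _ ⟨(hpos τ).le, hle τ⟩ _ havg ((hosc τ hτ).trans_lt hh)) hosc).trans_eq ?_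
  field_simp

/-- The integrand of the flux deficit. -/
noncomputable def deficit (hn : 0 < n) (j : Fin n) (q : ℝ) (u : Eu n × ℝ → ℝ) (δ h : ℝ)
    (z : ℝ × ℝ) : ℝ :=
  -stek δ h (planar hn j (pd ⟨0, hn⟩ u)) (0, z.1, z.2) - stek δ h (planar hn j u) (0, z.1, z.2) ^ q

lemma continuousOn_stek_zero {f : ℝ × ℝ × ℝ → ℝ} (hf : ContinuousOn f {p | 0 < p.1}) {δ h : ℝ}
    (hδ : 0 < δ) : Continuous fun z : ℝ × ℝ => stek δ h f (0, z.1, z.2) :=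
  (continuousOn_stek hf).comp_continuous (f := fun z : ℝ × ℝ => (0, z.1, z.2)) (by fun_prop)
    fun _ => by simpa using hδ

lemma Sol.stek_pos (hu : Sol n hn q M u) (hj : j ≠ ⟨0, hn⟩) {δ h : ℝ} (hδ : 0 < δ) (s t : ℝ) :
    0 < stek δ h (planar hn j u) (0, s, t) :=
  integral_unit_pos ((continuous_time (hu.continuousOn_planar_self hj)
    (by linarith : 0 < 0 + δ) s).comp (by fun_prop : Continuous fun τ : ℝ => t + h * τ))
    fun τ => hu.pos _ (pt_mem_closedHalf hj (by linarith : 0 ≤ 0 + δ) s) _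

lemma Sol.continuous_deficit (hu : Sol n hn q M u) (hj : j ≠ ⟨0, hn⟩) {δ h : ℝ} (hδ : 0 < δ) :
    Continuous (deficit hn j q u δ h) :=
  (continuousOn_stek_zero (continuousOn_planar hj (hu.continuousOn_pd ⟨0, hn⟩)) hδ).neg.sub
    ((continuousOn_stek_zero (hu.continuousOn_planar_self hj) hδ).rpow_const
      fun z => Or.inl (hu.stek_pos hj hδ z.1 z.2).ne')

lemma Sol.abs_deficit_le (hu : Sol n hn q M u) (hq : 1 < q) (hj : j ≠ ⟨0, hn⟩) {δ h : ℝ}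
    (hδ : 0 < δ) (z : ℝ × ℝ) : |deficit hn j q u δ h z| ≤ M + M ^ q := by
  have hδ' : 0 < 0 + δ := by linarith
  have cx := continuousOn_planar hj (hu.continuousOn_pd ⟨0, hn⟩)
  have hb := fun t => abs_le.1 (hu.abs_pd_le ⟨0, hn⟩ (pt_mem_openHalf hj hδ' z.1) t)
  have h1 : stek δ h (planar hn j (pd ⟨0, hn⟩ u)) (0, z.1, z.2) ≤ M :=
    stek_le cx hδ' fun τ _ => (hb _).2
  have h2 : -M ≤ stek δ h (planar hn j (pd ⟨0, hn⟩ u)) (0, z.1, z.2) :=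
    le_stek cx hδ' fun τ _ => (hb _).1
  have h3 := hu.stek_pos (h := h) hj hδ z.1 z.2
  have h4 : stek δ h (planar hn j u) (0, z.1, z.2) ≤ M :=
    stek_le (hu.continuousOn_planar_self hj) hδ' fun τ _ =>
      hu.le _ (pt_mem_closedHalf hj hδ'.le z.1) _
  have h5 := Real.rpow_le_rpow h3.le h4 (by linarith : 0 ≤ q)
  have h6 := Real.rpow_nonneg h3.le q
  have hM := hu.M_pos
  rw [deficit, abs_le]
  constructor <;> linarith

lemma Sol.tendsto_deficit (hu : Sol n hn q M u) (hq : 1 < q) (hj : j ≠ ⟨0, hn⟩) (h : ℝ)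
    (z : ℝ × ℝ) : Tendsto (fun δ => deficit hn j q u δ h z) (𝓝[>] 0)
      (𝓝 ((∫ τ in (0:ℝ)..1, planar hn j u (0, z.1, z.2 + h * τ) ^ q) -
        (∫ τ in (0:ℝ)..1, planar hn j u (0, z.1, z.2 + h * τ)) ^ q)) := by
  have hτ : Continuous fun τ : ℝ => z.2 + h * τ := by fun_prop
  have hd : ∀ δ : ℝ, 0 < δ → 0 < 0 + δ := fun δ hδ => by linarith
  have h1 : Tendsto (fun δ => stek δ h (planar hn j (pd ⟨0, hn⟩ u)) (0, z.1, z.2)) (𝓝[>] 0)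
      (𝓝 (∫ τ in (0:ℝ)..1, -(planar hn j u (0, z.1, z.2 + h * τ) ^ q))) := by
    refine intervalIntegral.tendsto_integral_filter_of_dominated_convergence (fun _ => M) ?_ ?_
      intervalIntegrable_const (Eventually.of_forall fun τ _ => ?_)
    · filter_upwards [self_mem_nhdsWithin] with δ hδ
      exact ((continuous_time (continuousOn_planar hj (hu.continuousOn_pd ⟨0, hn⟩))
        (hd δ hδ) z.1).comp hτ).aestronglyMeasurable
    · filter_upwards [self_mem_nhdsWithin] with δ hδ
      exact Eventually.of_forall fun τ _ => hu.abs_pd_le _ (pt_mem_openHalf hj (hd δ hδ) z.1) _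
    · simpa using hu.tendsto_planar_pd hj z.1 (z.2 + h * τ)
  have h2 : Tendsto (fun δ => stek δ h (planar hn j u) (0, z.1, z.2)) (𝓝[>] 0)
      (𝓝 (∫ τ in (0:ℝ)..1, planar hn j u (0, z.1, z.2 + h * τ))) := by
    refine intervalIntegral.tendsto_integral_filter_of_dominated_convergence (fun _ => M) ?_ ?_
      intervalIntegrable_const (Eventually.of_forall fun τ _ => ?_)
    · filter_upwards [self_mem_nhdsWithin] with δ hδ
      exact ((hu.continuous_planar_time hj (hd δ hδ).le z.1).comp hτ).aestronglyMeasurable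
    · filter_upwards [self_mem_nhdsWithin] with δ hδ
      refine Eventually.of_forall fun τ _ => ?_
      have hm := pt_mem_closedHalf hj (hd δ hδ).le z.1
      exact (abs_of_pos (hu.pos _ hm _)).trans_le (hu.le _ hm _)
    · simpa using hu.tendsto_planar hj z.1 (z.2 + h * τ)
  have h3 := h1.neg.sub (h2.rpow_const (p := q) (Or.inr (by linarith)))
  rw [intervalIntegral.integral_neg, neg_neg] at h3
  exact h3

lemma Sol.eventually_flux_le (hu : Sol n hn q M u) (hq : 1 < q) (hj : j ≠ ⟨0, hn⟩) (ρ : ℝ) :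
    ∀ᶠ h in 𝓝[>] (0:ℝ), ∀ᶠ δ in 𝓝[>] (0:ℝ),
      ∫ z in Icc (ρ - 1 / 4) (ρ + 1 / 4) ×ˢ Icc (-1) 1,
        deficit hn j q u δ h z * |tdq δ h (planar hn j u) (0, z.1, z.2)| ≤ 1 := by
  have hC := hu.timeConst_pos
  set C := timeConst n M with hCdef
  set Q : Set (ℝ × ℝ) := Icc (ρ - 1 / 4) (ρ + 1 / 4) ×ˢ Icc (-1) 1 with hQ
  have hQc : IsCompact Q := isCompact_Icc.prod isCompact_Icc
  have hQm : MeasurableSet Q := measurableSet_Icc.prod measurableSet_Icc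
  have hQv : volume.real Q = 1 := by
    rw [hQ, volume_real_box2 (by linarith) (by norm_num)]; ring
  filter_upwards [hu.eventually_gap_le hq hj (ε := 1 / (2 * C)) (by positivity),
    self_mem_nhdsWithin] with h hgap hh
  have hh : 0 < h := hh
  have hs : 0 < √h := Real.sqrt_pos.2 hh
  set G : ℝ × ℝ → ℝ := fun z => (∫ τ in (0:ℝ)..1, planar hn j u (0, z.1, z.2 + h * τ) ^ q) -
        (∫ τ in (0:ℝ)..1, planar hn j u (0, z.1, z.2 + h * τ)) ^ q with hG
  have hlim : Tendsto (fun δ => ∫ z in Q, deficit hn j q u δ h z) (𝓝[>] 0) (𝓝 (∫ z in Q, G z)) := by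
    refine tendsto_integral_filter_of_dominated_convergence (fun _ => M + M ^ q) ?_ ?_
      (integrableOn_const hQc.measure_lt_top.ne) (Eventually.of_forall fun z => hu.tendsto_deficit hq hj h z)
    · filter_upwards [self_mem_nhdsWithin] with δ hδ
      exact (hu.continuous_deficit hj hδ).aestronglyMeasurable
    · filter_upwards [self_mem_nhdsWithin] with δ hδ
      exact Eventually.of_forall fun z => hu.abs_deficit_le hq hj hδ z
  have hG1 : ∫ z in Q, G z ≤ 1 / (2 * C) * √h := by
    have h0 : ∀ z ∈ Q, ‖G z‖ ≤ 1 / (2 * C) * √h := fun z _ => by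
      have : 0 ≤ G z := sub_nonneg.2 (integral_rpow_ge hq ((hu.continuous_planar_time hj le_rfl
        z.1).comp (by fun_prop : Continuous fun τ : ℝ => z.2 + h * τ))
        fun τ => hu.pos _ (pt_mem_closedHalf hj le_rfl z.1) _)
      rw [Real.norm_eq_abs, abs_of_nonneg this]
      exact hgap z.1 z.2
    have := norm_setIntegral_le_of_norm_le_const (μ := volume) hQc.measure_lt_top h0
    rw [hQv, mul_one] at this
    exact (le_abs_self _).trans this
  have hlt : ∫ z in Q, G z < √h / C := hG1.trans_lt (by
    rw [one_div_mul_eq_div, div_lt_div_iff_of_pos_left hs (by positivity) hC]; linarith)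
  filter_upwards [hlim.eventually_lt_const hlt, self_mem_nhdsWithin] with δ h1 hδ
  have hδ : 0 < δ := hδ
  have hdc := hu.continuous_deficit (h := h) hj hδ
  have htc : Continuous fun z : ℝ × ℝ => tdq δ h (planar hn j u) (0, z.1, z.2) :=
    (continuousOn_tdq (hu.continuousOn_planar_self hj)).comp_continuous
      (f := fun z : ℝ × ℝ => (0, z.1, z.2)) (by fun_prop) fun _ => by simpa using hδ
  have h2 : ∀ z : ℝ × ℝ, |tdq δ h (planar hn j u) (0, z.1, z.2)| ≤ C / √h := by
    intro z
    have := hu.abs_planar_time_sub_le hj (by linarith : 0 ≤ 0 + δ) (s := z.1) (t := z.2)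
      (t' := z.2 + h) hh (by simp [abs_of_pos hh])
    rw [tdq, abs_div, abs_of_pos hh, div_le_div_iff₀ hh hs]
    calc _ ≤ C * √h * √h := by gcongr
      _ = C * h := by rw [mul_assoc, Real.mul_self_sqrt hh.le]
  have h3 : ∀ z : ℝ × ℝ, 0 ≤ deficit hn j q u δ h z := fun z =>
    sub_nonneg.2 (hu.rpow_stek_le hq hj hδ z.1 z.2)
  calc _ ≤ ∫ z in Q, deficit hn j q u δ h z * (C / √h) :=
        setIntegral_mono_on ((hdc.mul htc.abs).continuousOn.integrableOn_compact hQc)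
          ((hdc.mul continuous_const).continuousOn.integrableOn_compact hQc) hQm
          fun z _ => mul_le_mul_of_nonneg_left (h2 z) (h3 z)
    _ = (∫ z in Q, deficit hn j q u δ h z) * (C / √h) := integral_mul_const _ _
    _ ≤ √h / C * (C / √h) := by gcongr
    _ = 1 := by field_simp

end

section
open MeasureTheory

variable {n : ℕ} {hn : 0 < n} {q M : ℝ} {u : Eu n × ℝ → ℝ} {j : Fin n}

lemma tendsto_const_mul_sqrt (C : ℝ) : Tendsto (fun h : ℝ => C * √h) (𝓝[>] 0) (𝓝 0) := by
  have : Continuous fun h : ℝ => C * √h := by fun_prop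
  simpa using (this.tendsto 0).mono_left nhdsWithin_le_nhds

lemma tendsto_const_mul_right (C : ℝ) : Tendsto (fun h : ℝ => C * h) (𝓝[>] 0) (𝓝 0) := by
  have : Continuous fun h : ℝ => C * h := by fun_prop
  simpa using (this.tendsto 0).mono_left nhdsWithin_le_nhds

theorem planar_bound (n : ℕ) {q A c0 c1 : ℝ} (hq : 1 < q) (hA : 1 ≤ A) (hc0 : 0 < c0)
    (hc1 : 0 < c1) (hc1' : c1 ≤ 1 / 2) : ∃ Kmax : ℝ, ∀ (hn : 0 < n) (M : ℝ) (u : Eu n × ℝ → ℝ)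
      (_ : Sol n hn q M u) (j : Fin n) (_ : j ≠ ⟨0, hn⟩) (ρ K : ℝ), 4 ≤ ρ → 1 ≤ K →
      (∀ x, 0 < x → ∀ s ∈ Icc (ρ - 1) (ρ + 1), ∀ t, planar hn j u (x, s, t) ≤ A * K) →
      (∀ s t, |s - ρ| ≤ c1 * K ^ (-(q - 1)) → t ∈ Icc (-(c1 * (K ^ (-(q - 1))) ^ 2)) 0 →
        2 * c0 * K ≤ planar hn j u (0, s, t)) → K ≤ Kmax := by
  obtain ⟨Kmax, hK⟩ := Flat.bound (n - 2) hq hA hc0 hc1 hc1'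
  refine ⟨Kmax, fun hn M u hu j hj ρ K hρ hK1 hup hlow => ?_⟩
  have hcK : 0 < c0 * K / 2 := by positivity
  obtain ⟨h, hflux, hh1, hh⟩ := ((hu.eventually_flux_le hq hj ρ).and
    (((tendsto_const_mul_sqrt (timeConst n M)).eventually_lt_const hcK).and
      self_mem_nhdsWithin)).exists
  have hh : 0 < h := hh
  obtain ⟨δ, hfl, hδ1, hδ⟩ := (hflux.and
    (((tendsto_const_mul_right M).eventually_lt_const hcK).and self_mem_nhdsWithin)).exists
  have hδ : 0 < δ := hδ
  refine hK ρ K hρ hK1 (hu.flat hq hj (by linarith) hδ hh.ne' hup) hfl fun s t hs ht => ?_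
  refine le_stek (hu.continuousOn_planar_self hj) (by linarith : 0 < 0 + δ) fun τ hτ => ?_
  have h1 := abs_le.1 (hu.abs_planar_sub_le hj hδ.le s (t + h * τ))
  have h2 := abs_le.1 (hu.abs_planar_time_sub_le hj le_rfl (s := s) hh
    (abs_mul_sub_mul_le hh hτ (left_mem_Icc.2 zero_le_one) t))
  rw [mul_zero, add_zero] at h2
  have h3 := hlow s t hs ht
  rw [zero_add]
  linarith [h1.1, h2.1]

end

section

variable {n : ℕ} {hn : 0 < n} {q M : ℝ} {u : Eu n × ℝ → ℝ} {j : Fin n}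

/-- The distance to the axis of symmetry. -/
noncomputable def axialDist (hn : 0 < n) (x : Eu n) : ℝ := ‖x - x ⟨0, hn⟩ • ee ⟨0, hn⟩‖

lemma sum_erase_sq_eq (x : Eu n) :
    ∑ i ∈ Finset.univ.erase ⟨0, hn⟩, x i ^ 2 = axialDist hn x ^ 2 := by
  rw [axialDist, ← sum_sq_eq_norm, ← Finset.add_sum_erase _ _ (Finset.mem_univ ⟨0, hn⟩)]
  simp only [PiLp.sub_apply, PiLp.smul_apply, ee_apply, smul_eq_mul]
  rw [if_pos trivial, mul_one, sub_self, zero_pow two_ne_zero, zero_add]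
  refine Finset.sum_congr rfl fun i hi => ?_
  rw [if_neg (Finset.ne_of_mem_erase hi), mul_zero, sub_zero]

lemma norm_sq_eq_axialDist (x : Eu n) : ‖x‖ ^ 2 = x ⟨0, hn⟩ ^ 2 + axialDist hn x ^ 2 := by
  rw [← sum_sq_eq_norm, ← sum_erase_sq_eq,
    Finset.add_sum_erase Finset.univ (fun i => x i ^ 2) (Finset.mem_univ _)]

lemma axialDist_nonneg (x : Eu n) : 0 ≤ axialDist hn x := norm_nonneg _

lemma axialDist_le_norm (x : Eu n) : axialDist hn x ≤ ‖x‖ := by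
  refine le_of_sq_le_sq ?_ (norm_nonneg x)
  rw [norm_sq_eq_axialDist (hn := hn) x]
  exact le_add_of_nonneg_left (sq_nonneg _)

lemma abs_axialDist_sub_le (x y : Eu n) : |axialDist hn x - axialDist hn y| ≤ ‖x - y‖ := by
  refine (abs_norm_sub_norm_le _ _).trans ((le_of_eq ?_).trans (axialDist_le_norm (hn := hn) _))
  rw [axialDist, PiLp.sub_apply, sub_smul]
  congr 1; abel

lemma axialDist_pt (hj : j ≠ ⟨0, hn⟩) (x s : ℝ) :
    axialDist hn (pt hn j x s) = |s| := by
  rw [axialDist, pt_apply_zero hj, pt, add_sub_cancel_left, norm_smul_ee]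

lemma Sol.eq_planar (hu : Sol n hn q M u) (hj : j ≠ ⟨0, hn⟩) (x : Eu n) (t : ℝ) :
    u (x, t) = planar hn j u (x ⟨0, hn⟩, axialDist hn x, t) := by
  refine hu.sym _ _ (pt_apply_zero hj _ _).symm ?_ t
  rw [sum_erase_sq_eq, sum_erase_sq_eq, axialDist_pt hj, abs_of_nonneg (axialDist_nonneg x)]

lemma Sol.planar_le_planar_zero (hu : Sol n hn q M u) (hq : 1 < q) (hj : j ≠ ⟨0, hn⟩) {x : ℝ}
    (hx : 0 ≤ x) (s t : ℝ) : planar hn j u (x, s, t) ≤ planar hn j u (0, s, t) := by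
  have hm := pt_mem_closedHalf hj (le_refl (0:ℝ)) s
  have h := (hu.le_flow hq hm hx t).trans (flow_le hq hx (hu.pos _ hm t))
  have e : pt hn j 0 s + x • ee ⟨0, hn⟩ = pt hn j x s := by simp [pt, add_comm]
  rwa [e] at h

lemma Sol.planar_le_rpow (hu : Sol n hn q M u) (hq : 1 < q) (hj : j ≠ ⟨0, hn⟩) {x : ℝ}
    (hx : 0 < x) (s t : ℝ) : planar hn j u (x, s, t) ≤ ((q - 1) * x) ^ (-(1 / (q - 1))) := by
  have hm := pt_mem_closedHalf hj (le_refl (0:ℝ)) s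
  have h := (hu.le_flow hq hm hx.le t).trans (flow_le_rpow hq hx (hu.pos _ hm t))
  have e : pt hn j 0 s + x • ee ⟨0, hn⟩ = pt hn j x s := by simp [pt, add_comm]
  rwa [e] at h

lemma Sol.le_planar_zero (hu : Sol n hn q M u) (hq : 1 < q) (hj : j ≠ ⟨0, hn⟩) {x : Eu n}
    (hx : x ∈ closedHalf n hn) (t : ℝ) : u (x, t) ≤ planar hn j u (0, axialDist hn x, t) :=
  (hu.eq_planar hj x t).trans_le (hu.planar_le_planar_zero hq hj hx _ t)

lemma Sol.planar_neg (hu : Sol n hn q M u) (hj : j ≠ ⟨0, hn⟩) (x s t : ℝ) :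
    planar hn j u (x, -s, t) = planar hn j u (x, s, t) := by
  refine hu.sym _ _ (by rw [pt_apply_zero hj, pt_apply_zero hj]) ?_ t
  rw [sum_erase_sq_eq, sum_erase_sq_eq, axialDist_pt hj, axialDist_pt hj, abs_neg]

lemma Sol.planar_tangential (hu : Sol n hn q M u) (hq : 1 < q) (hj : j ≠ ⟨0, hn⟩) {a l P : ℝ}
    (hl : 0 < l) (hP : 0 < P) (hb : ∀ s, a ≤ s → ∀ t, planar hn j u (0, s, t) ≤ P)
    (hPl : 2 * (q * P ^ (q - 1)) * l < 1) {c h : ℝ} (hc : a + l ≤ |c|) (h0 : 0 ≤ h) (h1 : h ≤ l)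
    (t : ℝ) : planar hn j u (0, c + h, t) - planar hn j u (0, c - h, t) ≤
      P * (4 * n + 6) * (h / l) := by
  have h2 := hu.tangential hq hj (pt_apply_zero hj 0 c) hl hP (fun x hx hxc t => by
    refine (hu.le_planar_zero hq hj hx t).trans (hb _ ?_ t)
    have := abs_le.1 ((abs_axialDist_sub_le (hn := hn) x (pt hn j 0 c)).trans hxc)
    rw [axialDist_pt hj] at this
    linarith [this.1]) hPl h0 h1 t
  have e1 : pt hn j 0 c + h • ee j = pt hn j 0 (c + h) := by simp [pt, add_smul]
  have e2 : pt hn j 0 c - h • ee j = pt hn j 0 (c - h) := by simp [pt, sub_smul]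
  rwa [e1, e2] at h2

/-- Lipschitz continuity of the boundary values. -/
lemma Sol.planar_zero_lipschitz (hu : Sol n hn q M u) (hq : 1 < q) (hj : j ≠ ⟨0, hn⟩) {a l P : ℝ}
    (hl : 0 < l) (hP : 0 < P) (hb : ∀ s, a ≤ s → ∀ t, planar hn j u (0, s, t) ≤ P)
    (hPl : 2 * (q * P ^ (q - 1)) * l < 1) {s s' : ℝ} (hs : a + l ≤ s) (hs' : a + l ≤ s')
    (hss : |s - s'| ≤ 2 * l) (t : ℝ) :
    planar hn j u (0, s, t) ≤ planar hn j u (0, s', t) + P * (2 * n + 3) / l * |s - s'| := by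
  rcases le_total s' s with h | h
  · rw [abs_of_nonneg (sub_nonneg.2 h)] at hss ⊢
    have h1 := hu.planar_tangential hq hj hl hP hb hPl (c := (s + s') / 2) (h := (s - s') / 2)
      (le_trans (by linarith) (le_abs_self _)) (by linarith) (by linarith) t
    rw [show (s + s') / 2 + (s - s') / 2 = s by ring,
      show (s + s') / 2 - (s - s') / 2 = s' by ring, sub_le_iff_le_add'] at h1
    refine h1.trans_eq ?_
    ring
  · rw [abs_of_nonpos (sub_nonpos.2 h)] at hss ⊢
    have h1 := hu.planar_tangential hq hj hl hP hb hPl (c := -((s + s') / 2)) (h := (s' - s) / 2)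
      (by rw [abs_neg]; exact le_trans (by linarith) (le_abs_self _)) (by linarith) (by linarith) t
    rw [show -((s + s') / 2) + (s' - s) / 2 = -s by ring,
      show -((s + s') / 2) - (s' - s) / 2 = -s' by ring, hu.planar_neg hj, hu.planar_neg hj,
      sub_le_iff_le_add'] at h1
    refine h1.trans_eq ?_
    ring

/-- Persistence of a lower bound of the boundary values. -/
lemma Sol.le_planar_zero_of_le (hu : Sol n hn q M u) (hq : 1 < q) (hj : j ≠ ⟨0, hn⟩) {A K ρ c l : ℝ}
    (hA : 1 ≤ A) (hK : 0 < K) (hl : 0 < l) (hl1 : 2 * l ≤ 1) (hρ : 4 ≤ ρ)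
    (hc : 0 < c) (hc1 : c ≤ 1) (hcA : 4 * ((2 * n + 5) * ((2 * n + 4) * (A * c))) ≤ 1)
    (hb : ∀ s, 2 ≤ s → ∀ t, planar hn j u (0, s, t) ≤ A * K)
    (hPl : 2 * (q * (A * K) ^ (q - 1)) * l < 1) (h0 : K ≤ planar hn j u (0, ρ, 0)) {s t : ℝ}
    (hs : |s - ρ| ≤ c * l) (ht : t ∈ Icc (-(c * l) ^ 2) 0) : K / 2 ≤ planar hn j u (0, s, t) := by
  have hn0 : (0:ℝ) ≤ n := Nat.cast_nonneg n
  have hP : 0 < A * K := by positivity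
  have hlip := fun s (h1 : 2 + l ≤ s) s' (h2 : 2 + l ≤ s') (h3 : |s - s'| ≤ 2 * l) t =>
    hu.planar_zero_lipschitz hq hj hl hP hb hPl h1 h2 h3 t
  have hNP : (A * K) ^ q ≤ A * K / l := by
    have h1 : (A * K) ^ q = (A * K) ^ (q - 1) * (A * K) := by
      rw [← Real.rpow_add_one hP.ne']; congr 1; ring
    have h2 := Real.rpow_pos_of_pos hP (q - 1)
    rw [h1, le_div_iff₀ hl]
    generalize (A * K) ^ (q - 1) = y at *
    have h3 : y * l ≤ 1 := by nlinarith [mul_pos h2 hl]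
    calc y * (A * K) * l = y * l * (A * K) := by ring
      _ ≤ 1 * (A * K) := by gcongr
      _ = _ := one_mul _
  have hcl : c * l ≤ l := mul_le_of_le_one_left hl.le hc1
  have htime : K ≤ planar hn j u (0, ρ, t) + K / 4 := by
    rcases ht.2.eq_or_lt with rfl | ht0
    · linarith
    · set r := √(-t) with hr
      have hr0 : 0 < r := Real.sqrt_pos.2 (by linarith)
      have hr2 : r ^ 2 = -t := Real.sq_sqrt (by linarith)
      have hrc : r ≤ c * l := by
        refine le_of_sq_le_sq ?_ (by positivity)
        rw [hr2]; linarith [ht.1]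
      have hball : ∀ x ∈ closedHalf n hn, ‖x - pt hn j 0 ρ‖ ≤ l →
          |axialDist hn x - ρ| ≤ ‖x - pt hn j 0 ρ‖ ∧ ρ - l ≤ axialDist hn x := fun x _ hxl => by
        have := abs_axialDist_sub_le (hn := hn) x (pt hn j 0 ρ)
        rw [axialDist_pt hj, abs_of_nonneg (by linarith : 0 ≤ ρ)] at this
        exact ⟨this, by linarith [(abs_le.1 (this.trans hxl)).1]⟩
      have h1 := hu.time_growth hq (pt_apply_zero hj 0 ρ) (l := l) (P := A * K)
        (L := A * K * (2 * n + 3) / l) (N := A * K / l) (m := planar hn j u (0, ρ, t)) (t1 := t)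
        (r := r) hl (by positivity) (by positivity) hr0 (hu.pos _ (pt_mem_closedHalf hj le_rfl ρ) t).le
        (fun x hx hxl t _ => (hu.le_planar_zero hq hj hx t).trans
          (hb _ (by linarith [(hball x hx hxl).2]) t)) hNP
        (fun x hx hxl => by
          obtain ⟨h1, h2⟩ := hball x hx hxl
          refine (hu.le_planar_zero hq hj hx t).trans ((hlip _ (by linarith) ρ (by linarith)
            (by linarith) t).trans ?_)
          gcongr) (by
          rw [← add_div, div_mul_eq_mul_div, le_div_iff₀ hl]
          have : r ≤ l := hrc.trans hcl
          calc A * K * r * l ≤ A * K * l * l := by gcongr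
            _ ≤ (A * K * (2 * n + 4)) * l ^ 2 := by
              have : 0 ≤ A * K * (2 * n + 3) * l ^ 2 := by positivity
              linarith
            _ = _ := by ring)
      rw [hr2, add_neg_cancel] at h1
      refine h0.trans (h1.trans ?_)
      gcongr
      calc (2 * n + 5) * (A * K * (2 * n + 3) / l + A * K / l) * r
          ≤ (2 * n + 5) * (A * K * (2 * n + 3) / l + A * K / l) * (c * l) := by gcongr
        _ = (2 * n + 5) * ((2 * n + 4) * (A * c)) * K := by field_simp; ring
        _ ≤ 1 / 4 * K := by gcongr; linarith
        _ = K / 4 := by ring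
  have hs' := abs_le.1 hs
  have h2 := hlip ρ (by linarith) s (by linarith) (by rw [abs_sub_comm]; linarith) t
  have h3 : A * K * (2 * n + 3) / l * |ρ - s| ≤ K / 4 := by
    rw [abs_sub_comm]
    calc A * K * (2 * n + 3) / l * |s - ρ| ≤ A * K * (2 * n + 3) / l * (c * l) := by gcongr
      _ = (2 * n + 3) * (A * c) * K := by field_simp
      _ ≤ (2 * n + 5) * ((2 * n + 4) * (A * c)) * K := by
        have h5 : 0 < A * c := by positivity
        refine mul_le_mul_of_nonneg_right ?_ hK.le
        generalize A * c = y at h5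
        nlinarith [mul_nonneg hn0 h5.le, mul_nonneg (mul_nonneg hn0 hn0) h5.le]
      _ ≤ 1 / 4 * K := by gcongr; linarith
      _ = K / 4 := by ring
  linarith

end

section

variable {n : ℕ} {hn : 0 < n} {q M : ℝ} {u : Eu n × ℝ → ℝ} {j : Fin n}

theorem exists_normalized_bound (n : ℕ) {q A : ℝ} (hq : 1 < q) (hA : 1 ≤ A) :
    ∃ Kmax : ℝ, ∀ (hn : 0 < n) (M : ℝ) (u : Eu n × ℝ → ℝ) (_ : Sol n hn q M u) (j : Fin n)
      (_ : j ≠ ⟨0, hn⟩) (ρ K : ℝ), 4 ≤ ρ → 1 ≤ K →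
      (∀ s, 2 ≤ s → ∀ t, planar hn j u (0, s, t) ≤ A * K) → K ≤ planar hn j u (0, ρ, 0) →
      K ≤ Kmax := by
  have hA0 : 0 < A := by linarith
  have hA1 : 1 ≤ A ^ (q - 1) := Real.one_le_rpow hA (by linarith)
  set c : ℝ := 1 / (4 * ((2 * n + 5) * ((2 * n + 4) * A))) with hc
  set κ : ℝ := 1 / (4 * (q * A ^ (q - 1))) with hκ
  have hc0 : 0 < c := by positivity
  have hκ0 : 0 < κ := by positivity
  have hn0 : (0:ℝ) ≤ n := Nat.cast_nonneg n
  have hcA : 4 * ((2 * n + 5) * ((2 * n + 4) * (A * c))) = 1 := by rw [hc]; field_simp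
  have hc1 : c ≤ 1 := by
    rw [hc, div_le_one (by positivity)]
    have h1 : 1 ≤ (2 * n + 4) * A := one_le_mul_of_one_le_of_one_le (by linarith) hA
    have h2 : 1 ≤ (2 * n + 5) * ((2 * n + 4) * A) :=
      one_le_mul_of_one_le_of_one_le (by linarith) h1
    linarith
  have hκ1 : κ ≤ 1 / 4 := by
    have h2 : 1 ≤ q * A ^ (q - 1) := one_le_mul_of_one_le_of_one_le hq.le hA1
    rw [hκ]
    exact one_div_le_one_div_of_le (by norm_num) (by linarith)
  have hcκ : c * κ ≤ 1 / 4 := (mul_le_of_le_one_left hκ0.le hc1).trans hκ1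
  have hcκ0 : 0 < c * κ := by positivity
  have hsq : (c * κ) ^ 2 ≤ c * κ := by nlinarith
  obtain ⟨Kmax, hK⟩ := planar_bound n hq hA (c0 := 1 / 4) (c1 := (c * κ) ^ 2) (by norm_num)
    (by positivity) (by linarith)
  refine ⟨Kmax, fun hn M u hu j hj ρ K hρ hK1 hb h0 => hK hn M u hu j hj ρ K hρ hK1
    (fun x hx s hs t => (hu.planar_le_planar_zero hq hj hx.le s t).trans
      (hb s (by linarith [hs.1]) t)) fun s t hs ht => ?_⟩
  have hK0 : 0 < K := by linarith
  have hlam0 : 0 < K ^ (-(q - 1)) := Real.rpow_pos_of_pos hK0 _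
  have hlam1 : K ^ (-(q - 1)) ≤ 1 := Real.rpow_le_one_of_one_le_of_nonpos hK1 (by linarith)
  have hPl : 2 * (q * (A * K) ^ (q - 1)) * (κ * K ^ (-(q - 1))) = 1 / 2 := by
    rw [Real.mul_rpow hA0.le hK0.le, Real.rpow_neg hK0.le, hκ]
    have : 0 < K ^ (q - 1) := Real.rpow_pos_of_pos hK0 _
    field_simp; norm_num
  set lam := K ^ (-(q - 1))
  have h2l : κ * lam ≤ 1 / 4 := (mul_le_of_le_one_right hκ0.le hlam1).trans hκ1
  have := hu.le_planar_zero_of_le hq hj hA hK0 (l := κ * lam) (by positivity) (by linarith) hρ hc0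
    hc1 hcA.le hb (by linarith) h0 (s := s) (t := t)
    (hs.trans (by rw [← mul_assoc]; gcongr)) (by
      rw [show -(c * (κ * lam)) ^ 2 = -((c * κ) ^ 2 * lam ^ 2) by ring]; exact ht)
  linarith

theorem Sol.boundary_decay (n : ℕ) {q : ℝ} (hq : 1 < q) :
    ∃ C > 0, ∀ (hn : 0 < n) (M : ℝ) (u : Eu n × ℝ → ℝ) (_ : Sol n hn q M u) (j : Fin n)
      (_ : j ≠ ⟨0, hn⟩) (s t : ℝ), 0 < s →
      planar hn j u (0, s, t) ≤ C * s ^ (-(1 / (q - 1))) := by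
  have hβ : 0 < 1 / (q - 1) := one_div_pos.2 (by linarith)
  set β := 1 / (q - 1) with hβdef
  obtain ⟨Kmax, hK⟩ := exists_normalized_bound n hq (A := (2:ℝ) ^ (β + 1))
    (Real.one_le_rpow one_le_two (by linarith))
  set Kb := max Kmax 1
  have hKb : 0 < Kb := lt_max_of_lt_right one_pos
  have h4 : 0 < (4:ℝ) ^ β := Real.rpow_pos_of_pos (by norm_num) _
  refine ⟨2 * (4 ^ β * Kb), by positivity, fun hn M u hu j hj L t hL => ?_⟩
  have hg : ∀ s t, 0 < planar hn j u (0, s, t) := fun s t =>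
    hu.pos _ (pt_mem_closedHalf hj le_rfl s) t
  have hgM : ∀ s t, planar hn j u (0, s, t) ≤ M := fun s t =>
    hu.le _ (pt_mem_closedHalf hj le_rfl s) t
  set φ : Ioi (0:ℝ) × ℝ → ℝ := fun p => planar hn j u (0, p.1, p.2) * (min p.1.1 L) ^ β with hφ
  have hmin : ∀ s : Ioi (0:ℝ), 0 < min s.1 L := fun s => lt_min s.2 hL
  have hbdd : BddAbove (range φ) := by
    refine ⟨M * L ^ β, ?_⟩
    rintro _ ⟨⟨s, t⟩, rfl⟩
    have := hmin s
    have h1 := hu.M_pos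
    exact mul_le_mul (hgM _ _) (Real.rpow_le_rpow this.le (min_le_right _ _) hβ.le)
      (by positivity) h1.le
  set S := ⨆ p, φ p with hS
  have hφpos : ∀ p, 0 < φ p := fun p => mul_pos (hg _ _) (Real.rpow_pos_of_pos (hmin p.1) _)
  have hle : ∀ p, φ p ≤ S := fun p => le_ciSup hbdd p
  have hSpos : 0 < S := (hφpos (⟨L, hL⟩, t)).trans_le (hle _)
  obtain ⟨⟨⟨r, hr⟩, t0⟩, hrt⟩ := exists_lt_of_lt_ciSup (half_lt_self hSpos : S / 2 < ⨆ p, φ p)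
  have hr : 0 < r := hr
  set R := min r L with hR
  have hR0 : 0 < R := lt_min hr hL
  have hl : 0 < R / 4 := by positivity
  have hv := hu.scale hq hl t0
  have hpl : ∀ s t, planar hn j (fun p : Eu n × ℝ => (R / 4) ^ β * u ((R / 4) • p.1,
      t0 + (R / 4) ^ 2 * p.2)) (0, s, t) =
      (R / 4) ^ β * planar hn j u (0, R / 4 * s, t0 + (R / 4) ^ 2 * t) := fun s t => by
    simp [planar, pt, smul_smul]
  set K := (R / 4) ^ β * planar hn j u (0, r, t0) with hKdef
  have hKS : S / 2 < 4 ^ β * K := by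
    refine hrt.trans_eq ?_
    change planar hn j u (0, r, t0) * R ^ β = _
    rw [hKdef, Real.div_rpow hR0.le (by norm_num)]
    field_simp
  have hup : ∀ s, 2 ≤ s → ∀ t, planar hn j (fun p : Eu n × ℝ => (R / 4) ^ β * u ((R / 4) • p.1,
      t0 + (R / 4) ^ 2 * p.2)) (0, s, t) ≤ 2 ^ (β + 1) * K := by
    intro s hs t
    rw [hpl]
    have hs0 : 0 < R / 4 * s := by positivity
    have h1 := hle (⟨R / 4 * s, hs0⟩, t0 + (R / 4) ^ 2 * t)
    have h2 : (2 * (R / 4)) ^ β ≤ (min (R / 4 * s) L) ^ β := by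
      refine Real.rpow_le_rpow (by positivity) (le_min ?_ ?_) hβ.le
      · nlinarith
      · linarith [min_le_right r L]
    have h3 := (mul_le_mul_of_nonneg_left h2 (hg (R / 4 * s) (t0 + (R / 4) ^ 2 * t)).le).trans h1
    rw [Real.mul_rpow (by norm_num) hl.le] at h3
    have h5 : (0:ℝ) < 2 ^ β := by positivity
    have h6 : (4:ℝ) ^ β = 2 ^ β * 2 ^ β := by
      rw [← Real.mul_rpow (by norm_num) (by norm_num)]; norm_num
    rw [Real.rpow_add_one (by norm_num)]
    refine le_of_mul_le_mul_left ?_ h5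
    rw [h6] at hKS
    linarith
  have hKle : K ≤ Kb := by
    rcases le_total K 1 with h | h
    · exact h.trans (le_max_right _ _)
    · refine (hK hn _ _ hv j hj (r / (R / 4)) K ?_ h hup ?_).trans (le_max_left _ _)
      · rw [le_div_iff₀ hl]; linarith [min_le_left r L]
      · rw [hpl, mul_zero, add_zero, mul_div_cancel₀ _ hl.ne']
  have hSK : S ≤ 2 * (4 ^ β * Kb) := by
    have : 4 ^ β * K ≤ 4 ^ β * Kb := by gcongr
    linarith
  have h1 := (hle (⟨L, hL⟩, t)).trans hSK
  simp only [hφ, min_self] at h1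
  rwa [Real.rpow_neg hL.le, ← div_eq_mul_inv, le_div_iff₀ (Real.rpow_pos_of_pos hL _)]

theorem Sol.decay (n : ℕ) {q : ℝ} (hq : 1 < q) :
    ∃ C > 0, ∀ (hn : 0 < n) (M : ℝ) (u : Eu n × ℝ → ℝ) (_ : Sol n hn q M u) (j : Fin n)
      (_ : j ≠ ⟨0, hn⟩), ∀ x ∈ openHalf n hn, ∀ t, u (x, t) ≤ C * ‖x‖ ^ (-(1 / (q - 1))) := by
  have hβ : 0 < 1 / (q - 1) := one_div_pos.2 (by linarith)
  obtain ⟨C, hC, hb⟩ := Sol.boundary_decay n hq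
  set β := 1 / (q - 1) with hβdef
  have hq1 : 0 < q - 1 := by linarith
  refine ⟨((q - 1) / 2) ^ (-β) + C * (1 / 2) ^ (-β), by positivity, fun hn M u hu j hj x hx t => ?_⟩
  have hx0 : 0 < x ⟨0, hn⟩ := hx
  have hsq := norm_sq_eq_axialDist (hn := hn) x
  have hxn : 0 < ‖x‖ := hx0.trans_le ((le_abs_self _).trans (abs_apply_le_norm x _))
  have hN := Real.rpow_pos_of_pos hxn (-β)
  have hmono : ∀ {a b : ℝ}, 0 < a → a ≤ b → b ^ (-β) ≤ a ^ (-β) := fun ha hab =>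
    Real.rpow_le_rpow_of_nonpos ha hab (by linarith)
  have hC1 : 0 < ((q - 1) / 2) ^ (-β) := Real.rpow_pos_of_pos (by positivity) _
  have hC2 : 0 < C * (1 / 2) ^ (-β) := mul_pos hC (Real.rpow_pos_of_pos (by norm_num) _)
  rw [add_mul]
  rcases le_total (‖x‖ / 2) (x ⟨0, hn⟩) with h | h
  · have h1 := (hu.eq_planar hj x t).trans_le (hu.planar_le_rpow hq hj hx0 (axialDist hn x) t)
    have h2 := h1.trans (hmono (by positivity : 0 < (q - 1) / 2 * ‖x‖) (by nlinarith))
    rw [Real.mul_rpow (by positivity) hxn.le] at h2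
    have := mul_pos hC2 hN
    linarith
  · have hd : 1 / 2 * ‖x‖ ≤ axialDist hn x := by
      refine le_of_sq_le_sq ?_ (axialDist_nonneg x)
      nlinarith
    have hd0 : 0 < 1 / 2 * ‖x‖ := by positivity
    have h1 := (hu.le_planar_zero hq hj (le_of_lt hx0) t).trans
      (hb hn M u hu j hj (axialDist hn x) t (hd0.trans_le hd))
    have h2 := h1.trans (mul_le_mul_of_nonneg_left (hmono hd0 hd) hC.le)
    rw [Real.mul_rpow (by norm_num) hxn.le] at h2
    have := mul_pos hC1 hN
    linarith

end

/-- Spatial decay of an axially symmetric positive bounded classical solution of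
the half-space problem with bounded gradient: `u(x,t) ≤ C |x|^{-1/(q-1)}`. -/
theorem axisymmetric_halfspace_solution_decay
    (n : ℕ) (hn3 : 3 ≤ n) (hn : 0 < n) (q : ℝ) (hq : 1 < q)
    (hqn : 1 / (q - 1) < (n : ℝ) - 1)
    (u : EuclideanSpace ℝ (Fin n) × ℝ → ℝ)
    (hsol : IsHalfSpaceSol n hn q u)
    (hsym : AxiallySymmetric n hn u)
    (hbdd : ∃ M : ℝ, ∀ x ∈ closedHalf n hn, ∀ t : ℝ,
      u (x, t) ≤ M ∧
      ‖fderivWithin ℝ (fun y => u (y, t)) (closedHalf n hn) x‖ ≤ M) :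
    ∃ C > 0, ∀ x ∈ openHalf n hn, ∀ t : ℝ,
      u (x, t) ≤ C * ‖x‖ ^ (-(1 / (q - 1))) := by
  obtain ⟨M, hM⟩ := hbdd
  obtain ⟨C, hC, hb⟩ := Sol.decay n hq
  exact ⟨C, hC, hb hn M u (hsol.sol hsym hM) ⟨1, by omega⟩ (by simp)⟩
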